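/- Let h ∈ (0,1], ε ∈ (0,1/(2N)), and w ∈ ℝᴺ with wⁱ ∈ [0,1] for all i and Σ_i wⁱ ≥ 1. Let r : 𝒦^ε → ℝ be the map assigning to ψ the unique real number r(ψ) with ψ − r(ψ)·𝟙 ∈ 𝒩_{w,h,ε} (𝟙 = (1,…,1)), and let π(ψ) := ψ − r(ψ)·𝟙. Then r is C^{1,α} on 𝒦^ε, and there is a constant C > 0, depending only on n, N, α, X, Y, c and μ, such that sup_{ψ∈𝒦^ε} ‖Dπ(ψ)‖ + sup_{ψ₁≠ψ₂∈𝒦^ε} ‖Dπ(ψ₁) − Dπ(ψ₂)‖ / ‖ψ₁ − ψ₂‖^α ≤ C · h^{-18} · ε^{-9} (operator norms). -/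

import Mathlib

open MeasureTheory Metric Set Filter
open scoped Classical

noncomputable section

abbrev Pt (n : ℕ) := EuclideanSpace ℝ (Fin n)

/-- The function `g(t) = 2(1 + t² − t√(1+t²))`. -/
def gfun (t : ℝ) : ℝ := 2 * (1 + t ^ 2 - t * Real.sqrt (1 + t ^ 2))

variable {n N : ℕ}

/-- The `i`-th Laguerre cell associated to `ψ`. -/
def LagCell (X : Set (Pt n)) (c : Pt n → Fin N → ℝ) (ψ : Fin N → ℝ) (i : Fin N) :
    Set (Pt n) :=
  {x ∈ X | -c x i - ψ i = ⨆ j, (-c x j - ψ j)}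

/-- `G(ψ) = (μ(Lag_1(ψ)),…,μ(Lag_N(ψ)))`. -/
def Gfun (X : Set (Pt n)) (c : Pt n → Fin N → ℝ) (μ : Measure (Pt n)) (ψ : Fin N → ℝ)
    (i : Fin N) : ℝ := (μ (LagCell X c ψ i)).toReal

/-- `𝒦^ε = {ψ : Gⁱ(ψ) > ε for all i}`. -/
def Kset (X : Set (Pt n)) (c : Pt n → Fin N → ℝ) (μ : Measure (Pt n)) (ε : ℝ) :
    Set (Fin N → ℝ) := {ψ | ∀ i, ε < Gfun X c μ ψ i}

/-- `wⁱ_{h,ε}(ψ) = (Gⁱ(ψ) − ε)·g(ψⁱ/h)`. -/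
def wmap (X : Set (Pt n)) (c : Pt n → Fin N → ℝ) (μ : Measure (Pt n)) (h ε : ℝ)
    (ψ : Fin N → ℝ) : Fin N → ℝ := fun i => (Gfun X c μ ψ i - ε) * gfun (ψ i / h)

/-- `𝒩_{w,h,ε} = {ψ ∈ 𝒦^ε : Σ wⁱ = Σ wⁱ_{h,ε}(ψ)}`. -/
def Nset (X : Set (Pt n)) (c : Pt n → Fin N → ℝ) (μ : Measure (Pt n)) (h ε : ℝ)
    (w : Fin N → ℝ) : Set (Fin N → ℝ) :=
  {ψ ∈ Kset X c μ ε | ∑ i, w i = ∑ i, wmap X c μ h ε ψ i}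

/-- `𝒲^{ε₀} = {ψ : wⁱ_{h,ε}(ψ) ≥ ε₀ for all i}`. -/
def Wset (X : Set (Pt n)) (c : Pt n → Fin N → ℝ) (μ : Measure (Pt n)) (h ε ε₀ : ℝ) :
    Set (Fin N → ℝ) := {ψ | ∀ i, ε₀ ≤ wmap X c μ h ε ψ i}

/-- Euclidean (ℓ²) norm on `ℝᴺ`. -/
def eNorm2 (v : Fin N → ℝ) : ℝ := Real.sqrt (∑ i, v i ^ 2)

/-- ℓ¹ norm on `ℝᴺ`. -/
def l1Norm (v : Fin N → ℝ) : ℝ := ∑ i, |v i|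

/-- `T_#μ = Σ βⁱ δ_{y_i}`, with target points recorded by their indices. -/
def IsPush (μ : Measure (Pt n)) (T : Pt n → Fin N) (β : Fin N → ℝ) : Prop :=
  ∀ i, μ (T ⁻¹' {i}) = ENNReal.ofReal (β i)

/-- `(T,β)` minimizes the optimal transport problem with storage fee `F`. -/
def MinimizesStorage (c : Pt n → Fin N → ℝ) (μ : Measure (Pt n))
    (F : (Fin N → ℝ) → EReal) (T : Pt n → Fin N) (β : Fin N → ℝ) : Prop :=
  Measurable T ∧ IsPush μ T β ∧
    ∀ (T' : Pt n → Fin N) (β' : Fin N → ℝ), Measurable T' → IsPush μ T' β' →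
      ((∫ x, c x (T x) ∂μ : ℝ) : EReal) + F β ≤ ((∫ x, c x (T' x) ∂μ : ℝ) : EReal) + F β'

/-- The storage fee `F_w`: indicator of the box `Π [0, wⁱ]`. -/
def Fw (w β : Fin N → ℝ) : EReal := if ∀ i, β i ∈ Icc 0 (w i) then 0 else ⊤

/-- The standard simplex `Δ_N`. -/
def simplexSet (N : ℕ) : Set (Fin N → ℝ) := {β | ∑ i, β i = 1 ∧ ∀ i, 0 ≤ β i}

/-- The smoothed storage fee `F_{w,h,ε}`. -/
def Fwhe (w : Fin N → ℝ) (h ε : ℝ) (β : Fin N → ℝ) : EReal :=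
  if β ∈ simplexSet N ∧ ∀ i, β i ∈ Icc ε (w i + ε) then
    (((-h) * ∑ i, Real.sqrt ((β i - ε) * (w i - β i + ε)) : ℝ) : EReal)
  else ⊤

/-- (Reg): each `c(·,y_i)` is `C²` on `X`. -/
def RegCond (X : Set (Pt n)) (c : Pt n → Fin N → ℝ) : Prop :=
  ∀ i, ContDiffOn ℝ 2 (fun x => c x i) X

/-- (Twist): the gradients `∇_x c(x,y_i)` are pairwise distinct. -/
def TwistCond (X : Set (Pt n)) (c : Pt n → Fin N → ℝ) : Prop :=
  ∀ x ∈ X, ∀ i k : Fin N, i ≠ k →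
    fderivWithin ℝ (fun y => c y i) X x ≠ fderivWithin ℝ (fun y => c y k) X x

/-- Loeper's condition (QC), together with `c`-convexity of `X` with respect to `Y`. -/
def LoeperCond (X : Set (Pt n)) (c : Pt n → Fin N → ℝ) : Prop :=
  ∃ (Xi : Fin N → Set (Pt n)) (expc iexpc : Fin N → Pt n → Pt n),
    ∀ i, Convex ℝ (Xi i) ∧ ContDiffOn ℝ 2 (expc i) (Xi i) ∧
      ContDiffOn ℝ 2 (iexpc i) X ∧ Set.BijOn (expc i) (Xi i) X ∧
      Set.InvOn (iexpc i) (expc i) (Xi i) X ∧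
      ∀ (t : ℝ) (k : Fin N), Convex ℝ {p ∈ Xi i | -c (expc i p) k + c (expc i p) i ≤ t}

/-- `μ = ρ dx` for a `C^{0,α}` density `ρ`. -/
def HolderDensity (X : Set (Pt n)) (μ : Measure (Pt n)) (α : ℝ) : Prop :=
  ∃ ρ : Pt n → ℝ, μ = volume.withDensity (fun x => ENNReal.ofReal (ρ x)) ∧
    ContinuousOn ρ X ∧ ∃ Cρ : ℝ, ∀ x ∈ X, ∀ y ∈ X, |ρ x - ρ y| ≤ Cρ * ‖x - y‖ ^ α

/-- `(q,1)`-Poincaré–Wirtinger inequality with constant `CPW`. -/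
def PWineq (μ : Measure (Pt n)) (q CPW : ℝ) : Prop :=
  ∀ f : Pt n → ℝ, ContDiff ℝ 1 f →
    (∫ x, |f x - ∫ y, f y ∂μ| ^ q ∂μ) ^ (1 / q) ≤ CPW * ∫ x, ‖fderiv ℝ f x‖ ∂μ

/-- `T` agrees `μ`-a.e. with the Laguerre-cell map `T_ψ`. -/
def AgreesAE (X : Set (Pt n)) (c : Pt n → Fin N → ℝ) (μ : Measure (Pt n))
    (ψ : Fin N → ℝ) (T : Pt n → Fin N) : Prop :=
  ∀ᵐ x ∂μ, x ∈ LagCell X c ψ (T x)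

/-- The Kantorovich transport-cost functional `𝒞`. -/
def Cfun (c : Pt n → Fin N → ℝ) (μ : Measure (Pt n)) (β : Fin N → ℝ) : ℝ :=
  ⨆ ψ : Fin N → ℝ, (-(∫ x, (⨆ i, (-c x i - ψ i)) ∂μ) - ∑ i, ψ i * β i)

/-- One step of the damped Newton algorithm with parameters `h, ε, ε₀, w`. -/
def NewtonIter (X : Set (Pt n)) (c : Pt n → Fin N → ℝ) (μ : Measure (Pt n))
    (h ε ε₀ : ℝ) (w : Fin N → ℝ) (ψ ψ' : Fin N → ℝ) : Prop :=
  ∃ A : (Fin N → ℝ) ≃L[ℝ] (Fin N → ℝ),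
    (A : (Fin N → ℝ) →L[ℝ] (Fin N → ℝ)) = fderiv ℝ (wmap X c μ h ε) ψ ∧
    ∃ (ℓ : ℕ) (r : ℝ),
      ψ' = ψ - ((2 : ℝ)⁻¹ ^ ℓ) • A.symm (wmap X c μ h ε ψ - w) + r • (fun _ => (1 : ℝ)) ∧
      ψ' ∈ Nset X c μ h ε w ∧ (∀ i, ε₀ ≤ wmap X c μ h ε ψ' i) ∧
      eNorm2 (wmap X c μ h ε ψ' - w) ≤
        (1 - (2 : ℝ)⁻¹ ^ (ℓ + 1)) * eNorm2 (wmap X c μ h ε ψ - w) ∧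
      ∀ ℓ' < ℓ, ∀ r' : ℝ,
        (ψ - ((2 : ℝ)⁻¹ ^ ℓ') • A.symm (wmap X c μ h ε ψ - w) + r' • (fun _ => (1 : ℝ)))
          ∈ Nset X c μ h ε w →
        ¬((∀ i, ε₀ ≤ wmap X c μ h ε
              (ψ - ((2 : ℝ)⁻¹ ^ ℓ') • A.symm (wmap X c μ h ε ψ - w)
                + r' • (fun _ => (1 : ℝ))) i) ∧
          eNorm2 (wmap X c μ h ε
              (ψ - ((2 : ℝ)⁻¹ ^ ℓ') • A.symm (wmap X c μ h ε ψ - w)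
                + r' • (fun _ => (1 : ℝ))) - w) ≤
            (1 - (2 : ℝ)⁻¹ ^ (ℓ' + 1)) * eNorm2 (wmap X c μ h ε ψ - w))


/-- `C^{1,1}` functions on a set, with explicit derivative and constant. -/
def C11 (K : Set (Pt n)) (f : Pt n → ℝ) (f' : Pt n → (Pt n →L[ℝ] ℝ)) (L : ℝ) : Prop :=
  (∀ x ∈ K, HasFDerivWithinAt f (f' x) K x) ∧ (∀ x ∈ K, ‖f' x‖ ≤ L) ∧
    ∀ x ∈ K, ∀ y ∈ K, ‖f' x - f' y‖ ≤ L * ‖x - y‖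

lemma C11.sub {K : Set (Pt n)} {f g : Pt n → ℝ} {f' g' : Pt n → (Pt n →L[ℝ] ℝ)} {L : ℝ}
    (hf : C11 K f f' L) (hg : C11 K g g' L) :
    C11 K (fun x => f x - g x) (fun x => f' x - g' x) (2 * L) := by
  refine ⟨fun x hx => (hf.1 x hx).sub (hg.1 x hx), fun x hx => ?_, fun x hx y hy => ?_⟩
  · have := norm_sub_le (f' x) (g' x)
    linarith [hf.2.1 x hx, hg.2.1 x hx]
  · have : f' x - g' x - (f' y - g' y) = (f' x - f' y) - (g' x - g' y) := by abel
    rw [this]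
    have := norm_sub_le (f' x - f' y) (g' x - g' y)
    linarith [hf.2.2 x hx y hy, hg.2.2 x hx y hy]

lemma C11.mv {K : Set (Pt n)} (hK : Convex ℝ K) {f : Pt n → ℝ} {f' : Pt n → (Pt n →L[ℝ] ℝ)} {L : ℝ}
    (hL : 0 ≤ L) (hf : C11 K f f' L) {x y z : Pt n} {r : ℝ} (hx : x ∈ K) (hy : y ∈ K) (hz : z ∈ K)
    (hxz : ‖x - z‖ ≤ r) (hyz : ‖y - z‖ ≤ r) :
    |f x - f y - f' z (x - y)| ≤ L * r * ‖x - y‖ := by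
  have := Convex.norm_image_sub_le_of_norm_hasFDerivWithin_le' (f := f) (f' := f')
    (s := K ∩ closedBall z r) (C := L * r) (φ := f' z) (x := y) (y := x)
    (fun w hw => (hf.1 w hw.1).mono inter_subset_left)
    (fun w hw => (hf.2.2 w hw.1 z hz).trans (by
      have := mem_closedBall_iff_norm.1 hw.2
      gcongr)) (hK.inter (convex_closedBall z r))
    ⟨hy, mem_closedBall_iff_norm.2 hyz⟩ ⟨hx, mem_closedBall_iff_norm.2 hxz⟩
  exact this

lemma C11.lip {K : Set (Pt n)} (hK : Convex ℝ K) {f : Pt n → ℝ} {f' : Pt n → (Pt n →L[ℝ] ℝ)} {L : ℝ}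
    (hf : C11 K f f' L) {x y : Pt n} (hx : x ∈ K) (hy : y ∈ K) :
    |f x - f y| ≤ L * ‖x - y‖ :=
  hK.norm_image_sub_le_of_norm_hasFDerivWithin_le hf.1 hf.2.1 hy hx

lemma cover_lemma (E : Set (Pt n)) (hE : MeasurableSet E) (s Rad : ℝ) (hs : 0 < s)
    (κ : ENNReal) (hsub : E ⊆ closedBall 0 Rad)
    (h : ∀ y, volume (E ∩ closedBall y s) ≤ κ * volume (closedBall (0 : Pt n) s)) :
    volume E ≤ κ * volume (closedBall (0 : Pt n) (Rad + s)) := by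
  set P : Set (Pt n × Pt n) := {q | q.1 ∈ E ∧ dist q.1 q.2 ≤ s} with hP
  have hPm : MeasurableSet P := by
    apply MeasurableSet.inter
    · exact measurable_fst hE
    · exact (isClosed_le (f := fun q : Pt n × Pt n => dist q.1 q.2) (g := fun _ => s)
        (by fun_prop) (by fun_prop)).measurableSet
  have h1 : (volume.prod volume) P = volume E * volume (closedBall (0 : Pt n) s) := by
    rw [Measure.prod_apply hPm]
    have : ∀ x : Pt n, volume (Prod.mk x ⁻¹' P)
        = E.indicator (fun _ => volume (closedBall (0 : Pt n) s)) x := by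
      intro x
      by_cases hx : x ∈ E
      · rw [indicator_of_mem hx, ← Measure.addHaar_closedBall_center volume x s]
        congr 1
        ext y
        simp [hP, hx, dist_comm]
      · rw [indicator_of_notMem hx]
        have : Prod.mk x ⁻¹' P = ∅ := by
          ext y; simp [hP, hx]
        rw [this]; simp
    simp_rw [this]
    rw [lintegral_indicator hE, lintegral_const, Measure.restrict_apply_univ, mul_comm]
  have h2 : (volume.prod volume) P
      ≤ κ * volume (closedBall (0 : Pt n) s) * volume (closedBall (0 : Pt n) (Rad + s)) := by
    rw [Measure.prod_apply_symm hPm]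
    calc ∫⁻ y : Pt n, volume ((fun x => (x, y)) ⁻¹' P)
        ≤ ∫⁻ y : Pt n, (closedBall (0 : Pt n) (Rad + s)).indicator
            (fun _ => κ * volume (closedBall (0 : Pt n) s)) y := by
          apply lintegral_mono
          intro y
          by_cases hy : y ∈ closedBall (0 : Pt n) (Rad + s)
          · rw [indicator_of_mem hy]
            refine le_trans (measure_mono ?_) (h y)
            rintro x ⟨hx1, hx2⟩
            exact ⟨hx1, hx2⟩
          · rw [indicator_of_notMem hy]
            have : (fun x => (x, y)) ⁻¹' P = ∅ := by
              ext x
              simp only [mem_preimage, mem_empty_iff_false, iff_false]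
              rintro ⟨hx1, hx2⟩
              apply hy
              have := hsub hx1
              rw [mem_closedBall] at *
              simp only at hx1 hx2
              calc dist y 0 ≤ dist y x + dist x 0 := dist_triangle _ _ _
                _ ≤ Rad + s := by rw [dist_comm y x]; linarith
            simp only [this]; simp
      _ = _ := by
          rw [lintegral_indicator measurableSet_closedBall, lintegral_const,
            Measure.restrict_apply_univ]
  have h0 : volume (closedBall (0 : Pt n) s) ≠ 0 := (measure_closedBall_pos volume 0 hs).ne'
  have ht : volume (closedBall (0 : Pt n) s) ≠ ⊤ := measure_closedBall_lt_top.ne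
  rw [h1] at h2
  have : volume E * volume (closedBall (0 : Pt n) s)
      ≤ (κ * volume (closedBall (0 : Pt n) (Rad + s))) * volume (closedBall (0 : Pt n) s) := by
    refine h2.trans (le_of_eq (by ring))
  exact (ENNReal.mul_le_mul_iff_left h0 ht).1 this

lemma pack_lemma {ι : Type*} (I : Finset ι) (v : ι → Pt n) (E : Set (Pt n)) (hE : MeasurableSet E)
    (y : Pt n) (s : ℝ) (hs : 0 < s) (hEs : E ⊆ closedBall y s) (hv : ∀ a ∈ I, ‖v a‖ ≤ s)
    (hd : ∀ a ∈ I, ∀ b ∈ I, ∀ x ∈ E, ∀ x' ∈ E, x + v a = x' + v b → a = b) :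
    (I.card : ENNReal) * volume E ≤ 2 ^ n * volume (closedBall (0 : Pt n) s) := by
  have h1 : volume (⋃ a ∈ I, (fun x => x + v a) '' E) = ∑ a ∈ I, volume ((fun x => x + v a) '' E) := by
    apply measure_biUnion_finset
    · intro a ha b hb hab
      rw [Function.onFun, Set.disjoint_left]
      rintro _ ⟨x, hx, rfl⟩ ⟨x', hx', he⟩
      exact hab (hd a ha b hb x hx x' hx' he.symm)
    · intro a _
      exact (measurableEmbedding_addRight (v a)).measurableSet_image' hE
  have h2 : ∀ a, volume ((fun x => x + v a) '' E) = volume E := by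
    intro a
    rw [Set.image_add_right]
    exact measure_preimage_add_right _ _ _
  simp_rw [h2] at h1
  rw [Finset.sum_const, nsmul_eq_mul] at h1
  rw [← h1]
  calc volume (⋃ a ∈ I, (fun x => x + v a) '' E) ≤ volume (closedBall y (2 * s)) := by
        apply measure_mono
        intro z hz
        simp only [mem_iUnion, mem_image] at hz
        obtain ⟨a, ha, x, hx, rfl⟩ := hz
        have h3 := mem_closedBall_iff_norm.1 (hEs hx)
        rw [mem_closedBall_iff_norm]
        calc ‖x + v a - y‖ = ‖(x - y) + v a‖ := by congr 1; abel
          _ ≤ ‖x - y‖ + ‖v a‖ := norm_add_le _ _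
          _ ≤ 2 * s := by linarith [hv a ha]
    _ = 2 ^ n * volume (closedBall (0 : Pt n) s) := by
        rw [Measure.addHaar_closedBall volume y (by positivity),
          Measure.addHaar_closedBall volume 0 hs.le, ← mul_assoc, mul_pow,
          ENNReal.ofReal_mul (by positivity)]
        simp [ENNReal.ofReal_pow]

/-- counting to volume -/
lemma vol_of_card {M : ℕ} {q : ℝ} {V W : ENNReal} (hq : 0 < q) (hM : q ≤ M)
    (h : (M : ENNReal) * V ≤ 2 ^ n * W) :
    V ≤ ENNReal.ofReal (2 ^ n / q) * W := by
  have h1 : ENNReal.ofReal q * V ≤ 2 ^ n * W := by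
    refine le_trans ?_ h
    gcongr
    rw [← ENNReal.ofReal_natCast]
    exact ENNReal.ofReal_le_ofReal hM
  have h2 : ENNReal.ofReal (2 ^ n / q) = (ENNReal.ofReal q)⁻¹ * 2 ^ n := by
    rw [div_eq_inv_mul, ENNReal.ofReal_mul (by positivity), ENNReal.ofReal_inv_of_pos hq,
      ENNReal.ofReal_pow (by positivity)]
    simp
  rw [h2, mul_assoc]
  have h0 : ENNReal.ofReal q ≠ 0 := by simpa using hq
  calc V = (ENNReal.ofReal q)⁻¹ * (ENNReal.ofReal q * V) := by
        rw [← mul_assoc, ENNReal.inv_mul_cancel h0 ENNReal.ofReal_ne_top, one_mul]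
    _ ≤ _ := by gcongr

lemma slab_arith {A B : ℤ} {σ t : ℝ} (hσ : 0 < σ) (ht : 0 < t)
    (h1 : 2 * (|(A : ℝ)| * σ) < σ + (|(A : ℝ)| * σ + |(B : ℝ)| * t) / 8)
    (h2 : 2 * (|(B : ℝ)| * t) < t + (|(A : ℝ)| * σ + |(B : ℝ)| * t) / 8) : A = 0 ∧ B = 0 := by
  have key : ∀ C : ℤ, C ≠ 0 → (1 : ℝ) ≤ |(C : ℝ)| := by
    intro C hC
    rw [← Int.cast_abs]
    exact_mod_cast Int.one_le_abs hC
  by_cases hA : A = 0 <;> by_cases hB : B = 0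
  · exact ⟨hA, hB⟩
  · have := mul_le_mul_of_nonneg_right (key B hB) ht.le
    subst hA; simp at h2; linarith
  · have := mul_le_mul_of_nonneg_right (key A hA) hσ.le
    subst hB; simp at h1; linarith
  · have := mul_le_mul_of_nonneg_right (key B hB) ht.le
    have := mul_le_mul_of_nonneg_right (key A hA) hσ.le
    linarith

/-- Volume of the intersection of two transversal slabs. -/
lemma double_slab {K : Set (Pt n)} (hK : Convex ℝ K) {f g : Pt n → ℝ}
    {f' g' : Pt n → (Pt n →L[ℝ] ℝ)} {L B Rad : ℝ} (hL : 1 ≤ L) (hB : 1 ≤ B)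
    (hf : C11 K f f' L) (hg : C11 K g g' L) (hR : K ⊆ closedBall 0 Rad)
    (E : Set (Pt n)) (hE : MeasurableSet E) (hEK : E ⊆ K) {a b σ t : ℝ} (hσ : 0 < σ) (ht : 0 < t)
    (hEf : ∀ x ∈ E, a < f x ∧ f x ≤ a + σ) (hEg : ∀ x ∈ E, b < g x ∧ g x ≤ b + t)
    (hpq : ∀ x ∈ E, ∃ p q : Pt n, ‖p‖ ≤ B ∧ ‖q‖ ≤ B ∧ f' x p = 1 ∧ g' x p = 0 ∧
      f' x q = 0 ∧ g' x q = 1) :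
    volume E ≤ ENNReal.ofReal (2 ^ n * 2 ^ 14 * L ^ 2 * B ^ 4 * σ * t) *
      volume (closedBall (0 : Pt n) (Rad + 1)) := by
  set s : ℝ := 1 / (32 * L * B) with hs
  have hs0 : 0 < s := by positivity
  have hs1 : s ≤ 1 := by
    rw [hs, div_le_one (by positivity)]
    nlinarith
  have hLBs : 32 * L * B * s = 1 := by rw [hs]; field_simp
  have main : volume E ≤ ENNReal.ofReal (2 ^ n / (s / (4 * σ * B) * (s / (4 * t * B)))) *
      volume (closedBall (0 : Pt n) (Rad + s)) := by
    apply cover_lemma E hE s Rad hs0 _ (hEK.trans hR)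
    intro y
    rcases (E ∩ closedBall y s).eq_empty_or_nonempty with h0 | ⟨x0, hx0, hx0y⟩
    · rw [h0]; simp
    obtain ⟨p, q, hp, hq, hfp, hgp, hfq, hgq⟩ := hpq x0 hx0
    set Na := ⌊s / (4 * σ * B)⌋₊ + 1
    set Nb := ⌊s / (4 * t * B)⌋₊ + 1
    have hNa : s / (4 * σ * B) ≤ (Na : ℝ) := by
      push_cast [Na]; exact (Nat.lt_floor_add_one _).le
    have hNb : s / (4 * t * B) ≤ (Nb : ℝ) := by
      push_cast [Nb]; exact (Nat.lt_floor_add_one _).le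
    have bound : ∀ τ : ℝ, 0 < τ → ∀ c : ℕ, c ∈ Finset.range (⌊s / (4 * τ * B)⌋₊ + 1) →
        2 * c * τ * B ≤ s / 2 := by
      intro τ hτ c hc
      have h1 : c ≤ ⌊s / (4 * τ * B)⌋₊ := by
        rw [Finset.mem_range] at hc; omega
      have h2 : (c : ℝ) ≤ s / (4 * τ * B) :=
        (Nat.cast_le.2 h1).trans (Nat.floor_le (by positivity))
      rw [le_div_iff₀ (by positivity)] at h2
      linarith
    have := pack_lemma (Finset.range Na ×ˢ Finset.range Nb)
      (fun ab => (2 * ab.1 * σ : ℝ) • p + (2 * ab.2 * t : ℝ) • q) (E ∩ closedBall y s)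
      (hE.inter measurableSet_closedBall) y s hs0 inter_subset_right ?_ ?_
    · rw [Finset.card_product, Finset.card_range, Finset.card_range] at this
      refine vol_of_card (by positivity) ?_ this
      push_cast
      gcongr
    · rintro ⟨a', b'⟩ hab
      rw [Finset.mem_product] at hab
      have h1 := bound σ hσ a' hab.1
      have h2 := bound t ht b' hab.2
      refine (norm_add_le _ _).trans ?_
      rw [norm_smul, norm_smul, Real.norm_of_nonneg (by positivity),
        Real.norm_of_nonneg (by positivity)]
      have h3 : 2 * (a' : ℝ) * σ * ‖p‖ ≤ 2 * a' * σ * B := by gcongr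
      have h4 : 2 * (b' : ℝ) * t * ‖q‖ ≤ 2 * b' * t * B := by gcongr
      simp only
      linarith
    · rintro ⟨a1, b1⟩ _ ⟨a2, b2⟩ _ x ⟨hx, hxy⟩ x' ⟨hx', hxy'⟩ heq
      simp only at heq
      set A : ℤ := (a2 : ℤ) - a1 with hA
      set C : ℤ := (b2 : ℤ) - b1 with hC
      have hdiff : x - x' = (2 * (A : ℝ) * σ) • p + (2 * (C : ℝ) * t) • q := by
        have : x - x' = ((2 * a2 * σ : ℝ) • p + (2 * b2 * t : ℝ) • q)
          - ((2 * a1 * σ : ℝ) • p + (2 * b1 * t : ℝ) • q) := by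
          rw [sub_eq_sub_iff_add_eq_add, heq, add_comm]
        rw [this, hA, hC]
        push_cast
        module
      have hnorm : ‖x - x'‖ ≤ 2 * B * (|(A : ℝ)| * σ + |(C : ℝ)| * t) := by
        rw [hdiff]
        refine (norm_add_le _ _).trans ?_
        rw [norm_smul, norm_smul, Real.norm_eq_abs, Real.norm_eq_abs, abs_mul, abs_mul, abs_mul,
          abs_mul, abs_of_pos hσ, abs_of_pos ht, abs_two]
        have h3 : 2 * |(A : ℝ)| * σ * ‖p‖ ≤ 2 * |(A : ℝ)| * σ * B := by gcongr
        have h4 : 2 * |(C : ℝ)| * t * ‖q‖ ≤ 2 * |(C : ℝ)| * t * B := by gcongr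
        linarith
      have d1 : ∀ w ∈ closedBall y s, ‖w - x0‖ ≤ 2 * s := by
        intro w hw
        rw [mem_closedBall_iff_norm] at hw hx0y
        calc ‖w - x0‖ = ‖(w - y) - (x0 - y)‖ := by congr 1; abel
          _ ≤ _ := norm_sub_le _ _
          _ ≤ 2 * s := by linarith
      have e1 := hf.mv hK (by linarith) (hEK hx) (hEK hx') (hEK hx0) (d1 x hxy) (d1 x' hxy')
      have e2 := hg.mv hK (by linarith) (hEK hx) (hEK hx') (hEK hx0) (d1 x hxy) (d1 x' hxy')
      have e3 : L * (2 * s) * ‖x - x'‖ ≤ (|(A : ℝ)| * σ + |(C : ℝ)| * t) / 8 := by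
        calc L * (2 * s) * ‖x - x'‖ ≤ L * (2 * s) * (2 * B * (|(A : ℝ)| * σ + |(C : ℝ)| * t)) := by
              gcongr
          _ = (32 * L * B * s) * (|(A : ℝ)| * σ + |(C : ℝ)| * t) / 8 := by ring
          _ = _ := by rw [hLBs, one_mul]
      have v1 : f' x0 (x - x') = 2 * A * σ := by
        rw [hdiff]; simp [hfp, hfq]
      have v2 : g' x0 (x - x') = 2 * C * t := by
        rw [hdiff]; simp [hgp, hgq]
      rw [v1] at e1
      rw [v2] at e2
      have k1 : |f x - f x'| < σ := by
        rw [abs_lt]; have := hEf x hx; have := hEf x' hx'; constructor <;> linarith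
      have k2 : |g x - g x'| < t := by
        rw [abs_lt]; have := hEg x hx; have := hEg x' hx'; constructor <;> linarith
      have m1 : 2 * (|(A : ℝ)| * σ) = |2 * A * σ| := by
        rw [abs_mul, abs_mul, abs_of_pos hσ, abs_two]; ring
      have m2 : 2 * (|(C : ℝ)| * t) = |2 * C * t| := by
        rw [abs_mul, abs_mul, abs_of_pos ht, abs_two]; ring
      have n1 : |2 * A * σ| ≤ |f x - f x'| + |f x - f x' - 2 * A * σ| := by
        have := abs_sub (f x - f x') (f x - f x' - 2 * A * σ)
        rwa [sub_sub_cancel] at this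
      have n2 : |2 * C * t| ≤ |g x - g x'| + |g x - g x' - 2 * C * t| := by
        have := abs_sub (g x - g x') (g x - g x' - 2 * C * t)
        rwa [sub_sub_cancel] at this
      obtain ⟨hA0, hC0⟩ := slab_arith (A := A) (B := C) hσ ht (by linarith) (by linarith)
      ext <;> simp <;> omega
  refine main.trans ?_
  gcongr
  · apply le_of_eq
    rw [hs]
    field_simp
    ring

/-- Volume of a slab. -/
lemma single_slab {K : Set (Pt n)} (hK : Convex ℝ K) {f : Pt n → ℝ}
    {f' : Pt n → (Pt n →L[ℝ] ℝ)} {L B Rad : ℝ} (hL : 1 ≤ L) (hB : 1 ≤ B)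
    (hf : C11 K f f' L) (hR : K ⊆ closedBall 0 Rad)
    (E : Set (Pt n)) (hE : MeasurableSet E) (hEK : E ⊆ K) {a σ : ℝ} (hσ : 0 < σ)
    (hEf : ∀ x ∈ E, a < f x ∧ f x ≤ a + σ)
    (hpq : ∀ x ∈ E, ∃ p : Pt n, ‖p‖ ≤ B ∧ f' x p = 1) :
    volume E ≤ ENNReal.ofReal (2 ^ n * 2 ^ 7 * L * B ^ 2 * σ) *
      volume (closedBall (0 : Pt n) (Rad + 1)) := by
  set s : ℝ := 1 / (32 * L * B) with hs
  have hs0 : 0 < s := by positivity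
  have hs1 : s ≤ 1 := by
    rw [hs, div_le_one (by positivity)]
    nlinarith
  have hLBs : 32 * L * B * s = 1 := by rw [hs]; field_simp
  have main : volume E ≤ ENNReal.ofReal (2 ^ n / (s / (4 * σ * B))) *
      volume (closedBall (0 : Pt n) (Rad + s)) := by
    apply cover_lemma E hE s Rad hs0 _ (hEK.trans hR)
    intro y
    rcases (E ∩ closedBall y s).eq_empty_or_nonempty with h0 | ⟨x0, hx0, hx0y⟩
    · rw [h0]; simp
    obtain ⟨p, hp, hfp⟩ := hpq x0 hx0
    set Na := ⌊s / (4 * σ * B)⌋₊ + 1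
    have hNa : s / (4 * σ * B) ≤ (Na : ℝ) := by
      push_cast [Na]; exact (Nat.lt_floor_add_one _).le
    have := pack_lemma (Finset.range Na)
      (fun ab => (2 * ab * σ : ℝ) • p) (E ∩ closedBall y s)
      (hE.inter measurableSet_closedBall) y s hs0 inter_subset_right ?_ ?_
    · rw [Finset.card_range] at this
      exact vol_of_card (by positivity) hNa this
    · intro a' hc
      have h1 : a' ≤ ⌊s / (4 * σ * B)⌋₊ := by
        rw [Finset.mem_range] at hc; omega
      have h2 : (a' : ℝ) ≤ s / (4 * σ * B) :=
        (Nat.cast_le.2 h1).trans (Nat.floor_le (by positivity))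
      rw [le_div_iff₀ (by positivity)] at h2
      rw [norm_smul, Real.norm_of_nonneg (by positivity)]
      have h3 : 2 * (a' : ℝ) * σ * ‖p‖ ≤ 2 * a' * σ * B := by gcongr
      linarith
    · rintro a1 _ a2 _ x ⟨hx, hxy⟩ x' ⟨hx', hxy'⟩ heq
      set A : ℤ := (a2 : ℤ) - a1 with hA
      have hdiff : x - x' = (2 * (A : ℝ) * σ) • p := by
        have : x - x' = ((2 * a2 * σ : ℝ) • p) - ((2 * a1 * σ : ℝ) • p) := by
          rw [sub_eq_sub_iff_add_eq_add, heq, add_comm]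
        rw [this, hA]
        push_cast
        module
      have hnorm : ‖x - x'‖ ≤ 2 * B * (|(A : ℝ)| * σ) := by
        rw [hdiff]
        rw [norm_smul, Real.norm_eq_abs, abs_mul, abs_mul, abs_of_pos hσ, abs_two]
        have h3 : 2 * |(A : ℝ)| * σ * ‖p‖ ≤ 2 * |(A : ℝ)| * σ * B := by gcongr
        linarith
      have d1 : ∀ w ∈ closedBall y s, ‖w - x0‖ ≤ 2 * s := by
        intro w hw
        rw [mem_closedBall_iff_norm] at hw hx0y
        calc ‖w - x0‖ = ‖(w - y) - (x0 - y)‖ := by congr 1; abel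
          _ ≤ _ := norm_sub_le _ _
          _ ≤ 2 * s := by linarith
      have e1 := hf.mv hK (by linarith) (hEK hx) (hEK hx') (hEK hx0) (d1 x hxy) (d1 x' hxy')
      have e3 : L * (2 * s) * ‖x - x'‖ ≤ (|(A : ℝ)| * σ) / 8 := by
        calc L * (2 * s) * ‖x - x'‖ ≤ L * (2 * s) * (2 * B * (|(A : ℝ)| * σ)) := by
              gcongr
          _ = (32 * L * B * s) * (|(A : ℝ)| * σ) / 8 := by ring
          _ = _ := by rw [hLBs, one_mul]
      have v1 : f' x0 (x - x') = 2 * A * σ := by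
        rw [hdiff]; simp [hfp]
      rw [v1] at e1
      have k1 : |f x - f x'| < σ := by
        rw [abs_lt]; have := hEf x hx; have := hEf x' hx'; constructor <;> linarith
      have m1 : 2 * (|(A : ℝ)| * σ) = |2 * A * σ| := by
        rw [abs_mul, abs_mul, abs_of_pos hσ, abs_two]; ring
      have n1 : |2 * A * σ| ≤ |f x - f x'| + |f x - f x' - 2 * A * σ| := by
        have := abs_sub (f x - f x') (f x - f x' - 2 * A * σ)
        rwa [sub_sub_cancel] at this
      obtain ⟨hA0, _⟩ := slab_arith (A := A) (B := 0) (t := 1) hσ one_pos (by simp; linarith)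
        (by simp; positivity)
      omega
  refine main.trans ?_
  gcongr
  · apply le_of_eq
    rw [hs]
    field_simp
    ring

/-- Abstract chart data extracted from the hypotheses. -/
structure CD (n N : ℕ) where
  K : Fin N → Set (Pt n)
  F : Fin N → Fin N → Pt n → ℝ
  F' : Fin N → Fin N → Pt n → (Pt n →L[ℝ] ℝ)
  R : Fin N → Pt n → ℝ
  ν : Measure (Fin N → ℝ)
  o : Fin N → Pt n
  L : ℝ
  Rad : ℝ
  r0 : ℝ
  δ : ℝ
  α : ℝ
  hL : 1 ≤ L
  hRad : 1 ≤ Rad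
  hr0 : 0 < r0
  hr1 : r0 ≤ 1
  hδ : 0 < δ
  hδ1 : δ ≤ 1
  hα : 0 < α
  hα1 : α ≤ 1
  Kconv : ∀ j, Convex ℝ (K j)
  Kcomp : ∀ j, IsCompact (K j)
  Kball : ∀ j, closedBall (o j) r0 ⊆ K j
  Krad : ∀ j, K j ⊆ closedBall 0 Rad
  FC : ∀ j m, C11 (K j) (F j m) (F' j m) L
  quasi : ∀ j m t, Convex ℝ {p ∈ K j | F j j p - F j m p ≤ t}
  twist : ∀ j i m, i ≠ m → ∀ p ∈ K j, δ ≤ ‖F' j i p - F' j m p‖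
  R0 : ∀ j p, 0 ≤ R j p
  RL : ∀ j, ∀ p ∈ K j, R j p ≤ L
  RH : ∀ j, ∀ p ∈ K j, ∀ q ∈ K j, |R j p - R j q| ≤ L * ‖p - q‖ ^ α
  νprob : IsProbabilityMeasure ν
  νeq : ∀ j S, MeasurableSet S →
    ν S = ∫⁻ p in {p ∈ K j | (fun m => F j m p) ∈ S}, ENNReal.ofReal (R j p)
  trans : ∀ i j, ∀ p ∈ K j, ∃ p' ∈ K i, ∃ A : Pt n →L[ℝ] Pt n, ‖A‖ ≤ L ∧
    ∀ m, F i m p' = F j m p ∧ F' i m p' = (F' j m p).comp A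

attribute [instance] CD.νprob

/-- Cells in cost coordinates. -/
def cell (ψ : Fin N → ℝ) (j : Fin N) : Set (Fin N → ℝ) := {v | ∀ m, v j + ψ j ≤ v m + ψ m}

lemma cell_meas (ψ : Fin N → ℝ) (j : Fin N) : MeasurableSet (cell ψ j) := by
  have : cell ψ j = ⋂ m, {v | v j + ψ j ≤ v m + ψ m} := by ext v; simp [cell]
  rw [this]
  exact MeasurableSet.iInter fun m => measurableSet_le (by fun_prop) (by fun_prop)

/-- Slabs in cost coordinates. -/
def slab (i m : Fin N) (a σ : ℝ) : Set (Fin N → ℝ) := {v | a < v i - v m ∧ v i - v m ≤ a + σ}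

lemma slab_meas (i m : Fin N) (a σ : ℝ) : MeasurableSet (slab i m a σ) := by
  have h : Measurable fun v : Fin N → ℝ => v i - v m := by fun_prop
  exact h measurableSet_Ioc

lemma dual_vec {φ : Pt n →L[ℝ] ℝ} {δ : ℝ} (hδ : 0 < δ) (h : δ ≤ ‖φ‖) :
    ∃ p : Pt n, ‖p‖ ≤ 1 / δ ∧ φ p = 1 := by
  set v := (InnerProductSpace.toDual ℝ (Pt n)).symm φ with hv
  have hn : ‖v‖ = ‖φ‖ := by rw [hv]; simp
  have hpos : 0 < ‖v‖ := by rw [hn]; linarith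
  have hφ : φ v = ‖v‖ ^ 2 := by
    have := InnerProductSpace.toDual_symm_apply (𝕜 := ℝ) (x := v) (y := φ)
    rw [← this, ← hv, real_inner_self_eq_norm_sq]
  refine ⟨(‖v‖ ^ 2)⁻¹ • v, ?_, ?_⟩
  · rw [norm_smul, norm_inv, norm_pow, norm_norm]
    have : (‖v‖ ^ 2)⁻¹ * ‖v‖ = 1 / ‖v‖ := by field_simp
    rw [this]
    exact one_div_le_one_div_of_le hδ (by linarith)
  · rw [map_smul, hφ, smul_eq_mul, inv_mul_cancel₀ (by positivity)]

namespace CD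
variable (D : CD n N)

lemma Fcont (j m : Fin N) : ContinuousOn (D.F j m) (D.K j) :=
  fun x hx => ((D.FC j m).1 x hx).continuousWithinAt

lemma pre_meas (j : Fin N) {S : Set (Fin N → ℝ)} (hS : MeasurableSet S) :
    MeasurableSet {p ∈ D.K j | (fun m => D.F j m p) ∈ S} := by
  have hc : ContinuousOn (fun p => (fun m => D.F j m p)) (D.K j) :=
    continuousOn_pi.2 fun m => D.Fcont j m
  have hK := (D.Kcomp j).isClosed.measurableSet
  have := (hc.domRestrict).measurable hS
  have h2 := (MeasurableEmbedding.subtype_coe hK).measurableSet_image.2 this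
  convert h2 using 1
  ext p
  simp [and_comm]

/-- Slab constant. -/
def S0 : ℝ := max 1 (2 ^ n * 2 ^ 7 * (2 * D.L) * (1 / D.δ) ^ 2 *
  (volume (closedBall (0 : Pt n) (D.Rad + 1))).toReal)

lemma S0_one : 1 ≤ D.S0 := le_max_left _ _

lemma slab_vol (j i m : Fin N) (him : i ≠ m) {a σ : ℝ} (hσ : 0 < σ) (E : Set (Pt n))
    (hE : MeasurableSet E) (hEK : E ⊆ D.K j)
    (hEf : ∀ x ∈ E, a < D.F j i x - D.F j m x ∧ D.F j i x - D.F j m x ≤ a + σ) :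
    volume E ≤ ENNReal.ofReal (D.S0 * σ) := by
  have hL := D.hL
  have hδ := D.hδ
  have h := single_slab (D.Kconv j) (L := 2 * D.L) (B := 1 / D.δ) (by linarith)
    (by rw [le_div_iff₀ hδ]; linarith [D.hδ1]) ((D.FC j i).sub (D.FC j m)) (D.Krad j) E hE hEK hσ
    hEf (fun x hx => dual_vec hδ (D.twist j i m him x (hEK hx)))
  refine h.trans ?_
  have hfin : volume (closedBall (0 : Pt n) (D.Rad + 1)) ≠ ⊤ := measure_closedBall_lt_top.ne
  rw [← ENNReal.ofReal_toReal hfin, ← ENNReal.ofReal_mul (by positivity)]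
  apply ENNReal.ofReal_le_ofReal
  have := mul_le_mul_of_nonneg_right (le_max_right (1:ℝ) (2 ^ n * 2 ^ 7 * (2 * D.L) * (1 / D.δ) ^ 2 *
    (volume (closedBall (0 : Pt n) (D.Rad + 1))).toReal)) hσ.le
  calc _ = _ := by ring
    _ ≤ _ := this

lemma ν_le (j : Fin N) {S : Set (Fin N → ℝ)} (hS : MeasurableSet S) :
    D.ν S ≤ ENNReal.ofReal D.L * volume {p ∈ D.K j | (fun m => D.F j m p) ∈ S} := by
  rw [D.νeq j S hS]
  refine (setLIntegral_mono' (D.pre_meas j hS) (g := fun _ => ENNReal.ofReal D.L)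
    fun p hp => ENNReal.ofReal_le_ofReal (D.RL j p hp.1)).trans ?_
  rw [setLIntegral_const]

lemma ν_slab (i m : Fin N) (him : i ≠ m) {a σ : ℝ} (hσ : 0 < σ) (S : Set (Fin N → ℝ))
    (hS : MeasurableSet S) (h : ∀ v ∈ S, a < v i - v m ∧ v i - v m ≤ a + σ) :
    D.ν S ≤ ENNReal.ofReal (D.L * D.S0 * σ) := by
  refine (D.ν_le i hS).trans ?_
  rw [mul_assoc, ENNReal.ofReal_mul (by linarith [D.hL])]
  gcongr
  exact D.slab_vol i i m him hσ _ (D.pre_meas i hS) (fun x hx => hx.1) (fun x hx => h _ hx.2)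

lemma deriv_nonpos (j : Fin N) {f : Pt n → ℝ} {f' : Pt n → (Pt n →L[ℝ] ℝ)} {L : ℝ} (hL : 0 ≤ L)
    (hf : C11 (D.K j) f f' L) {x y : Pt n} (hx : x ∈ D.K j) (hy : y ∈ D.K j)
    (h : ∀ θ ∈ Icc (0:ℝ) 1, f (x + θ • (y - x)) ≤ f x) : f' x (y - x) ≤ 0 := by
  by_contra hc
  push Not at hc
  set d := f' x (y - x) with hd
  set q := L * ‖y - x‖ ^ 2 with hq
  have hq0 : 0 ≤ q := by positivity
  have key : ∀ θ ∈ Ioc (0:ℝ) 1, d ≤ q * θ := by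
    intro θ hθ
    have hmem : x + θ • (y - x) ∈ D.K j := (D.Kconv j).add_smul_sub_mem hx hy ⟨hθ.1.le, hθ.2⟩
    have hn : ‖x + θ • (y - x) - x‖ = θ * ‖y - x‖ := by
      rw [add_sub_cancel_left, norm_smul, Real.norm_of_nonneg hθ.1.le]
    have := hf.mv (D.Kconv j) hL hmem hx hx (r := θ * ‖y - x‖) hn.le
      (by simp; exact mul_nonneg hθ.1.le (norm_nonneg _))
    rw [hn, add_sub_cancel_left, map_smul, smul_eq_mul, ← hd] at this
    have h1 := (abs_le.1 this).1
    have h2 := h θ ⟨hθ.1.le, hθ.2⟩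
    have h3 : θ * d ≤ θ * (q * θ) := by rw [hq]; nlinarith
    exact le_of_mul_le_mul_left h3 hθ.1
  have := key (min 1 (d / (2 * (q + 1)))) ⟨by positivity, min_le_left _ _⟩
  have h2 : q * min 1 (d / (2 * (q + 1))) ≤ q * (d / (2 * (q + 1))) := by
    gcongr; exact min_le_right _ _
  have h3 : q * (d / (2 * (q + 1))) ≤ d / 2 := by
    rw [← sub_nonneg]
    have : d / 2 - q * (d / (2 * (q + 1))) = d / (2 * (q + 1)) := by field_simp; ring
    rw [this]; positivity
  linarith

lemma center : ∃ c > 0, c ≤ 1 ∧ ∀ ε, 0 < ε → ε ≤ 1 → ∀ (ψ : Fin N → ℝ) (j : Fin N),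
    ENNReal.ofReal ε < D.ν (cell ψ j) → ∃ z ∈ D.K j, ∀ m, m ≠ j → ∀ x ∈ D.K j,
    ψ m - ψ j - c * ε ≤ D.F j j x - D.F j m x →
    (D.F' j j x - D.F' j m x) (z - x) ≤ - (c * ε) := by
  rcases Nat.eq_zero_or_pos N with rfl | hN
  · exact ⟨1, one_pos, le_rfl, fun _ _ _ _ j => j.elim0⟩
  have hL := D.hL
  have hδ := D.hδ
  have hr0 := D.hr0
  have hr1 := D.hr1
  have hS0 := D.S0_one
  have hRad := D.hRad
  have hN' : (1:ℝ) ≤ N := by exact_mod_cast hN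
  set c1 : ℝ := 1 / (2 * D.L * D.S0 * N) with hc1
  have hc1p : 0 < c1 := by positivity
  have hc11 : c1 ≤ 1 := by
    rw [hc1, div_le_one (by positivity)]
    nlinarith [mul_le_mul hL hS0 zero_le_one (by linarith), mul_pos (by linarith : 0 < D.L) (by linarith : 0 < D.S0)]
  set c2 : ℝ := c1 / (4 * D.L * (2 * D.Rad + 1)) with hc2
  have hc2p : 0 < c2 := by positivity
  refine ⟨min (c1 / 2) (c2 * D.r0 * D.δ), by positivity, (min_le_left _ _).trans (by linarith), ?_⟩
  intro ε hε hε1 ψ j hcell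
  set s := c1 * ε with hs
  have hsp : 0 < s := by positivity
  have hs1 : s ≤ 1 := by nlinarith
  set Q : Set (Pt n) := {p ∈ D.K j | (fun m => D.F j m p) ∈ cell ψ j} with hQ
  have hQm : MeasurableSet Q := D.pre_meas j (cell_meas ψ j)
  set Sl : Fin N → Set (Pt n) := fun m => if m = j then ∅ else
    {p ∈ D.K j | (fun m => D.F j m p) ∈ slab j m (ψ m - ψ j - s) s} with hSl
  have hvolQ : ENNReal.ofReal (ε / D.L) < volume Q := by
    by_contra hcon
    push Not at hcon
    have h1 := D.ν_le j (cell_meas ψ j)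
    have h2 : D.ν (cell ψ j) ≤ ENNReal.ofReal ε := by
      refine h1.trans ((mul_le_mul_right hcon _).trans ?_)
      rw [← ENNReal.ofReal_mul (by linarith)]
      apply ENNReal.ofReal_le_ofReal
      exact (mul_div_cancel₀ _ (by linarith)).le
    exact absurd hcell (not_lt.2 h2)
  have hvolS : volume (⋃ m, Sl m) ≤ ENNReal.ofReal (ε / D.L) := by
    calc volume (⋃ m, Sl m) ≤ ∑ m, volume (Sl m) := measure_iUnion_fintype_le _ _
      _ ≤ ∑ m : Fin N, ENNReal.ofReal (D.S0 * s) := by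
          apply Finset.sum_le_sum
          intro m _
          simp only [hSl]
          split_ifs with hm
          · simp
          · refine D.slab_vol j j m (Ne.symm hm) hsp _ (D.pre_meas j (slab_meas _ _ _ _)) (fun x hx => hx.1) (fun x hx => hx.2)
      _ = ENNReal.ofReal (N * (D.S0 * s)) := by
          rw [Finset.sum_const, Finset.card_univ, Fintype.card_fin, nsmul_eq_mul, ENNReal.ofReal_mul (p := (N:ℝ)) (by positivity), ENNReal.ofReal_natCast]
      _ ≤ ENNReal.ofReal (ε / D.L) := by
          apply ENNReal.ofReal_le_ofReal
          have : (N:ℝ) * (D.S0 * s) = ε / D.L / 2 := by rw [hs, hc1]; field_simp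
          rw [this]
          have : 0 < ε / D.L := by positivity
          linarith
  obtain ⟨z0, hz0Q, hz0S⟩ : ∃ z0 ∈ Q, z0 ∉ ⋃ m, Sl m := by
    by_contra hcon
    push Not at hcon
    exact absurd (hvolQ.trans_le ((measure_mono hcon).trans hvolS)) (lt_irrefl _)
  have hz0 : z0 ∈ D.K j := hz0Q.1
  have hz0f : ∀ m, m ≠ j → D.F j j z0 - D.F j m z0 ≤ ψ m - ψ j - s := by
    intro m hm
    by_contra hcon
    push Not at hcon
    apply hz0S
    rw [mem_iUnion]
    refine ⟨m, ?_⟩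
    simp only [hSl, if_neg hm]
    refine ⟨hz0, hcon, ?_⟩
    have := hz0Q.2 m
    simp only at this
    linarith
  set τ := c2 * ε with hτ
  have hτp : 0 < τ := by positivity
  have hτs : 4 * D.L * (2 * D.Rad + 1) * τ = s := by
    rw [hτ, hc2, hs]; field_simp
  have hτ1 : τ ≤ 1 := by
    have : 1 ≤ 4 * D.L * (2 * D.Rad + 1) := by nlinarith
    nlinarith
  have ho : D.o j ∈ D.K j := D.Kball j (mem_closedBall_self hr0.le)
  set z := z0 + τ • (D.o j - z0) with hz
  have hball : ∀ b : Pt n, ‖b‖ ≤ τ * D.r0 → z + b ∈ D.K j := by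
    intro b hb
    have h1 : D.o j + τ⁻¹ • b ∈ D.K j := by
      apply D.Kball j
      rw [mem_closedBall_iff_norm, add_sub_cancel_left, norm_smul, norm_inv, Real.norm_of_nonneg hτp.le]
      rw [inv_mul_le_iff₀ hτp]; exact hb
    have h2 := (D.Kconv j).add_smul_sub_mem hz0 h1 ⟨hτp.le, hτ1⟩
    convert h2 using 1
    rw [hz]
    have : τ • τ⁻¹ • b = b := by rw [smul_smul, mul_inv_cancel₀ hτp.ne', one_smul]
    calc _ = z0 + τ • (D.o j - z0) + τ • τ⁻¹ • b := by rw [this]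
      _ = _ := by module
  have hzo : ‖D.o j - z0‖ ≤ 2 * D.Rad := by
    have h1 := mem_closedBall_zero_iff.1 (D.Krad j ho)
    have h2 := mem_closedBall_zero_iff.1 (D.Krad j hz0)
    have := norm_sub_le (D.o j) z0
    linarith
  have hzb : ∀ b : Pt n, ‖b‖ ≤ τ * D.r0 → ∀ m, m ≠ j →
      D.F j j (z + b) - D.F j m (z + b) ≤ ψ m - ψ j - s / 2 := by
    intro b hb m hm
    have h1 := ((D.FC j j).sub (D.FC j m)).lip (D.Kconv j) (hball b hb) hz0
    have h2 : ‖z + b - z0‖ ≤ τ * (2 * D.Rad + 1) := by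
      have : z + b - z0 = τ • (D.o j - z0) + b := by rw [hz]; abel
      rw [this]
      have h3 := norm_add_le (τ • (D.o j - z0)) b
      rw [norm_smul, Real.norm_of_nonneg hτp.le] at h3
      nlinarith
    have h3 := (abs_le.1 h1).2
    have h4 := hz0f m hm
    have h5 : 2 * D.L * ‖z + b - z0‖ ≤ 2 * D.L * (τ * (2 * D.Rad + 1)) := by gcongr
    linarith
  refine ⟨z, by simpa using hball 0 (by simp; positivity), ?_⟩
  intro m hm x hx hfx
  have hfx' : ψ m - ψ j - s / 2 ≤ D.F j j x - D.F j m x := by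
    have : min (c1 / 2) (c2 * D.r0 * D.δ) * ε ≤ c1 / 2 * ε := by
      gcongr; exact min_le_left _ _
    rw [hs]; linarith
  obtain ⟨p, hp, hp1⟩ := dual_vec hδ (D.twist j j m (Ne.symm hm) x hx)
  have hb : ‖(τ * D.r0 * D.δ) • p‖ ≤ τ * D.r0 := by
    rw [norm_smul, Real.norm_of_nonneg (by positivity)]
    calc _ ≤ τ * D.r0 * D.δ * (1 / D.δ) := by gcongr
      _ = _ := by field_simp
  have hmem := hball _ hb
  have hneg := D.deriv_nonpos j (by linarith) ((D.FC j j).sub (D.FC j m)) hx hmem (by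
    intro θ hθ
    have := (D.quasi j m (D.F j j x - D.F j m x)).add_smul_sub_mem (x := x) (y := z + (τ * D.r0 * D.δ) • p)
      ⟨hx, le_rfl⟩ ⟨hmem, (hzb _ hb m hm).trans hfx'⟩ hθ
    exact this.2)
  have hsplit : z + (τ * D.r0 * D.δ) • p - x = (z - x) + (τ * D.r0 * D.δ) • p := by abel
  rw [hsplit, map_add, map_smul, hp1, smul_eq_mul, mul_one] at hneg
  have : min (c1 / 2) (c2 * D.r0 * D.δ) * ε ≤ c2 * D.r0 * D.δ * ε := by
    gcongr; exact min_le_right _ _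
  have h9 : τ * D.r0 * D.δ = c2 * D.r0 * D.δ * ε := by rw [hτ]; ring
  linarith

/-- The constant of `center`. -/
def cc : ℝ := Classical.choose D.center
lemma cc_pos : 0 < D.cc := (Classical.choose_spec D.center).1
lemma cc_le : D.cc ≤ 1 := (Classical.choose_spec D.center).2.1
lemma cc_spec : ∀ ε, 0 < ε → ε ≤ 1 → ∀ (ψ : Fin N → ℝ) (j : Fin N),
    ENNReal.ofReal ε < D.ν (cell ψ j) → ∃ z ∈ D.K j, ∀ m, m ≠ j → ∀ x ∈ D.K j,
    ψ m - ψ j - D.cc * ε ≤ D.F j j x - D.F j m x →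
    (D.F' j j x - D.F' j m x) (z - x) ≤ - (D.cc * ε) := (Classical.choose_spec D.center).2.2

end CD

lemma dual_pair {a b : Pt n →L[ℝ] ℝ} {η : ℝ} (hη : 0 < η) (h : ∀ s : ℝ, η ≤ ‖a - s • b‖) :
    ∃ p : Pt n, ‖p‖ ≤ 1 / η ∧ a p = 1 ∧ b p = 0 := by
  set va := (InnerProductSpace.toDual ℝ (Pt n)).symm a with hva
  set vb := (InnerProductSpace.toDual ℝ (Pt n)).symm b with hvb
  have ha : ∀ y, a y = inner ℝ va y := fun y => by
    rw [hva]; exact (InnerProductSpace.toDual_symm_apply (𝕜 := ℝ)).symm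
  have hb : ∀ y, b y = inner ℝ vb y := fun y => by
    rw [hvb]; exact (InnerProductSpace.toDual_symm_apply (𝕜 := ℝ)).symm
  set s : ℝ := inner ℝ va vb / ‖vb‖ ^ 2 with hs
  set w := va - s • vb with hw
  have hwv : w = (InnerProductSpace.toDual ℝ (Pt n)).symm (a - s • b) := by
    rw [map_sub, hw, hva, hvb]
    congr 1
    simp
  have hwn : η ≤ ‖w‖ := by
    rw [hwv, LinearIsometryEquiv.norm_map]; exact h s
  have hwp : 0 < ‖w‖ := by linarith
  have hbw : b w = 0 := by
    rw [hb, hw, inner_sub_right, inner_smul_right, real_inner_self_eq_norm_sq, hs]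
    by_cases h0 : vb = 0
    · simp [h0]
    · have : ‖vb‖ ≠ 0 := norm_ne_zero_iff.2 h0
      rw [real_inner_comm]
      field_simp; ring
  have haw : a w = ‖w‖ ^ 2 := by
    rw [← real_inner_self_eq_norm_sq, ha]
    conv_rhs => rw [hw, inner_sub_left, inner_smul_left, ← hw, ← hb, hbw]
    simp
  refine ⟨(‖w‖ ^ 2)⁻¹ • w, ?_, ?_, ?_⟩
  · rw [norm_smul, norm_inv, norm_pow, norm_norm]
    have : (‖w‖ ^ 2)⁻¹ * ‖w‖ = 1 / ‖w‖ := by field_simp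
    rw [this]
    exact one_div_le_one_div_of_le hη (by linarith)
  · rw [map_smul, haw, smul_eq_mul, inv_mul_cancel₀ (by positivity)]
  · rw [map_smul, hbw, smul_zero]

lemma trans_alg {gi gk gl : Pt n →L[ℝ] ℝ} {ui uk ul : Pt n} {M κ : ℝ} (hM : 0 < M) (hκ : 0 < κ)
    (hui : ‖ui‖ ≤ M) (huk : ‖uk‖ ≤ M) (hul : ‖ul‖ ≤ M)
    (h1 : κ ≤ gi ui - gk ui) (h2 : κ ≤ gi ui - gl ui)
    (h3 : κ ≤ gk uk - gi uk) (h4 : κ ≤ gk uk - gl uk)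
    (h5 : κ ≤ gl ul - gi ul) (h6 : κ ≤ gl ul - gk ul) :
    ∃ p : Pt n, ‖p‖ ≤ M / κ ∧ (gi - gk) p = 1 ∧ (gi - gl) p = 0 := by
  have := dual_pair (a := gi - gk) (b := gi - gl) (η := κ / M) (by positivity) (fun s => by
    rw [div_le_iff₀ hM]
    have key : ∀ u : Pt n, ‖u‖ ≤ M → κ ≤ |(gi - gk - s • (gi - gl)) u| →
        κ ≤ ‖gi - gk - s • (gi - gl)‖ * M := by
      intro u hu h
      refine h.trans (((gi - gk - s • (gi - gl)).le_opNorm u).trans ?_)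
      gcongr
    have ev : ∀ u, (gi - gk - s • (gi - gl)) u = gi u - gk u - s * (gi u - gl u) := by
      intro u; simp
    rcases le_total s 0 with hs | hs
    · apply key ui hui
      rw [ev]
      refine le_trans ?_ (le_abs_self _)
      nlinarith
    · rcases le_total s 1 with hs1 | hs1
      · apply key uk huk
        rw [ev]
        refine le_trans ?_ (neg_le_abs _)
        nlinarith
      · apply key ul hul
        rw [ev]
        refine le_trans ?_ (le_abs_self _)
        nlinarith)
  rwa [one_div_div] at this

namespace CD
variable (D : CD n N)

/-- all cells have mass more than `ε`. -/
def Big (ε : ℝ) (ψ : Fin N → ℝ) : Prop := ∀ j, ENNReal.ofReal ε < D.ν (cell ψ j)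

lemma center_vec {ε : ℝ} (hε : 0 < ε) (hε1 : ε ≤ 1) {ψ : Fin N → ℝ} (hψ : D.Big ε ψ) (i j : Fin N)
    {p : Pt n} (hp : p ∈ D.K i) : ∃ u : Pt n, ‖u‖ ≤ 2 * D.L * D.Rad ∧
    ∀ m, m ≠ j → ψ m - ψ j - D.cc * ε ≤ D.F i j p - D.F i m p →
      D.cc * ε ≤ D.F' i m p u - D.F' i j p u := by
  obtain ⟨z, hz, hzz⟩ := D.cc_spec ε hε hε1 ψ j (hψ j)
  obtain ⟨p', hp', A, hA, hF⟩ := D.trans j i p hp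
  refine ⟨A (z - p'), ?_, ?_⟩
  · have h1 := mem_closedBall_zero_iff.1 (D.Krad j hz)
    have h2 := mem_closedBall_zero_iff.1 (D.Krad j hp')
    have h3 := norm_sub_le z p'
    have hL := D.hL
    calc _ ≤ ‖A‖ * ‖z - p'‖ := A.le_opNorm _
      _ ≤ D.L * (2 * D.Rad) := by gcongr; linarith
      _ = _ := by ring
  · intro m hm h
    have := hzz m hm p' hp' (by rw [(hF j).1, (hF m).1]; exact h)
    rw [(hF j).2, (hF m).2] at this
    simp only [sub_apply, ContinuousLinearMap.comp_apply] at this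
    linarith

/-- Bound for dual vectors. -/
lemma transverse {ε : ℝ} (hε : 0 < ε) (hε1 : ε ≤ 1) {ψ : Fin N → ℝ} (hψ : D.Big ε ψ)
    {i k l : Fin N} (hik : k ≠ i) (hil : l ≠ i) (hkl : k ≠ l) {x : Pt n} (hx : x ∈ D.K i)
    (h1 : |D.F i i x - D.F i k x - (ψ k - ψ i)| ≤ D.cc / 2 * ε)
    (h2 : |D.F i i x - D.F i l x - (ψ l - ψ i)| ≤ D.cc / 2 * ε) :
    ∃ p : Pt n, ‖p‖ ≤ 2 * D.L * D.Rad / (D.cc * ε) ∧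
      (D.F' i i x - D.F' i k x) p = 1 ∧ (D.F' i i x - D.F' i l x) p = 0 := by
  have hc := D.cc_pos
  have hL := D.hL
  have hR := D.hRad
  obtain ⟨ui, hui, hi⟩ := D.center_vec hε hε1 hψ i i hx
  obtain ⟨uk, huk, hk⟩ := D.center_vec hε hε1 hψ i k hx
  obtain ⟨ul, hul, hl⟩ := D.center_vec hε hε1 hψ i l hx
  rw [abs_le] at h1 h2
  have hce : 0 < D.cc * ε := by positivity
  have := trans_alg (gi := -D.F' i i x) (gk := -D.F' i k x) (gl := -D.F' i l x) (κ := D.cc * ε)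
    (M := 2 * D.L * D.Rad) (by positivity) hce hui huk hul
    (by have := hi k hik (by linarith); simp; linarith)
    (by have := hi l hil (by linarith); simp; linarith)
    (by have := hk i hik.symm (by linarith); simp; linarith)
    (by have := hk l hkl.symm (by linarith); simp; linarith)
    (by have := hl i hil.symm (by linarith); simp; linarith)
    (by have := hl k hkl (by linarith); simp; linarith)
  obtain ⟨p, hp, hp1, hp2⟩ := this
  refine ⟨-p, by rwa [norm_neg], ?_, ?_⟩
  · simp at hp1 ⊢; linarith
  · simp at hp2 ⊢; linarith

lemma double : ∃ C, 0 ≤ C ∧ ∀ ε, 0 < ε → ε ≤ 1 → ∀ ψ : Fin N → ℝ, D.Big ε ψ →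
    ∀ i k l : Fin N, k ≠ i → l ≠ i → k ≠ l → ∀ (S : Set (Fin N → ℝ)), MeasurableSet S →
    ∀ a b σ t : ℝ, 0 < σ → 0 < t → S ⊆ slab i k a σ → S ⊆ slab i l b t →
    (∀ v ∈ S, |v i - v k - (ψ k - ψ i)| ≤ D.cc / 2 * ε ∧ |v i - v l - (ψ l - ψ i)| ≤ D.cc / 2 * ε) →
    D.ν S ≤ ENNReal.ofReal (C * σ * t / ε ^ 4) := by
  have hc := D.cc_pos
  have hc1 := D.cc_le
  have hL := D.hL
  have hR := D.hRad
  set V := (volume (closedBall (0 : Pt n) (D.Rad + 1))).toReal with hV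
  have hV0 : 0 ≤ V := ENNReal.toReal_nonneg
  refine ⟨D.L * (2 ^ n * 2 ^ 14 * (2 * D.L) ^ 2 * (2 * D.L * D.Rad / D.cc) ^ 4) * V, by positivity, ?_⟩
  intro ε hε hε1 ψ hψ i k l hki hli hkl S hS a b σ t hσ ht hSk hSl hw
  have hB : 1 ≤ 2 * D.L * D.Rad / (D.cc * ε) := by
    rw [le_div_iff₀ (by positivity)]
    have : D.cc * ε ≤ 1 := by nlinarith
    nlinarith
  have h := double_slab (D.Kconv i) (L := 2 * D.L) (B := 2 * D.L * D.Rad / (D.cc * ε)) (by linarith)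
    hB ((D.FC i i).sub (D.FC i k)) ((D.FC i i).sub (D.FC i l)) (D.Krad i)
    {p ∈ D.K i | (fun m => D.F i m p) ∈ S} (D.pre_meas i hS) (fun x hx => hx.1) hσ ht
    (fun x hx => hSk hx.2) (fun x hx => hSl hx.2) (fun x hx => by
      have h12 := hw _ hx.2
      obtain ⟨p, hp, hp1, hp2⟩ := D.transverse hε hε1 hψ hki hli hkl hx.1 h12.1 h12.2
      obtain ⟨q, hq, hq1, hq2⟩ := D.transverse hε hε1 hψ hli hki hkl.symm hx.1 h12.2 h12.1
      exact ⟨p, q, hp, hq, hp1, hp2, hq2, hq1⟩)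
  refine (D.ν_le i hS).trans ((mul_le_mul_right h _).trans ?_)
  have hfin : volume (closedBall (0 : Pt n) (D.Rad + 1)) ≠ ⊤ := measure_closedBall_lt_top.ne
  rw [← ENNReal.ofReal_toReal hfin, ← ENNReal.ofReal_mul (by positivity),
    ← ENNReal.ofReal_mul (by positivity)]
  apply ENNReal.ofReal_le_ofReal
  rw [← hV]
  apply le_of_eq
  field_simp

end CD

lemma lip_vol {K : NNReal} {f : Pt n → Pt n} {s : Set (Pt n)} (h : LipschitzOnWith K f s) :
    volume (f '' s) ≤ (K : ENNReal) ^ n * volume s := by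
  rw [← EuclideanSpace.euclideanHausdorffMeasure_eq_volume,
    MeasureTheory.Measure.euclideanHausdorffMeasure_def]
  have := h.hausdorffMeasure_image_le (d := n) (by positivity)
  rw [ENNReal.rpow_natCast] at this
  simp only [Measure.smul_apply, ENNReal.smul_def, smul_eq_mul]
  rw [mul_left_comm]
  gcongr

lemma pow_one_add_le (n : ℕ) {y : ℝ} (hy : 0 ≤ y) (hy1 : y ≤ 1) : (1 + y) ^ n ≤ 1 + (2 ^ n - 1) * y := by
  induction n with
  | zero => simp
  | succ k ih =>
    have h2 : (1:ℝ) ≤ 2 ^ k := one_le_pow₀ (by norm_num)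
    calc (1 + y) ^ (k + 1) = (1 + y) ^ k * (1 + y) := pow_succ _ _
      _ ≤ (1 + (2 ^ k - 1) * y) * (1 + y) := by gcongr
      _ ≤ _ := by rw [pow_succ]; nlinarith [mul_nonneg (mul_nonneg (sub_nonneg.2 h2) hy) (sub_nonneg.2 hy1)]

section
variable {B : Set (Pt n)} {T : Pt n → Pt n} {η : ℝ}

lemma near_lip (hη : 0 ≤ η)
    (hT : ∀ x ∈ B, ∀ y ∈ B, ‖T x - T y - (x - y)‖ ≤ η * ‖x - y‖) :
    LipschitzOnWith (1 + η).toNNReal T B := by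
  refine LipschitzOnWith.of_dist_le_mul fun x hx y hy => ?_
  rw [Real.coe_toNNReal _ (by linarith), dist_eq_norm, dist_eq_norm]
  have := norm_add_le (T x - T y - (x - y)) (x - y)
  rw [sub_add_cancel] at this
  linarith [hT x hx y hy]

lemma near_anti (hT : ∀ x ∈ B, ∀ y ∈ B, ‖T x - T y - (x - y)‖ ≤ η * ‖x - y‖) :
    ∀ x ∈ B, ∀ y ∈ B, (1 - η) * ‖x - y‖ ≤ ‖T x - T y‖ := by
  intro x hx y hy
  have := norm_sub_le (T x - T y) (T x - T y - (x - y))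
  rw [sub_sub_cancel] at this
  linarith [hT x hx y hy]

lemma near_inj (hη1 : η ≤ 1 / 2)
    (hT : ∀ x ∈ B, ∀ y ∈ B, ‖T x - T y - (x - y)‖ ≤ η * ‖x - y‖) : InjOn T B := by
  intro x hx y hy h
  have := near_anti hT x hx y hy
  rw [h, sub_self, norm_zero] at this
  have h2 : ‖x - y‖ ≤ 0 := by nlinarith [norm_nonneg (x - y)]
  exact sub_eq_zero.1 (norm_le_zero_iff.1 h2)

lemma near_vol (hη : 0 ≤ η) (hη1 : η ≤ 1 / 2)
    (hT : ∀ x ∈ B, ∀ y ∈ B, ‖T x - T y - (x - y)‖ ≤ η * ‖x - y‖) {E : Set (Pt n)} (hE : E ⊆ B) :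
    volume E ≤ ENNReal.ofReal ((1 + 2 * η) ^ n) * volume (T '' E) := by
  have hinj := (near_inj hη1 hT).mono hE
  have hl : LipschitzOnWith (1 + 2 * η).toNNReal (Function.invFunOn T E) (T '' E) := by
    refine LipschitzOnWith.of_dist_le_mul ?_
    rintro _ ⟨x, hx, rfl⟩ _ ⟨y, hy, rfl⟩
    rw [hinj.leftInvOn_invFunOn hx, hinj.leftInvOn_invFunOn hy, Real.coe_toNNReal _ (by linarith), dist_eq_norm, dist_eq_norm]
    have h1 := near_anti hT x (hE hx) y (hE hy)
    have h2 : 1 ≤ (1 + 2 * η) * (1 - η) := by nlinarith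
    calc ‖x - y‖ ≤ ((1 + 2 * η) * (1 - η)) * ‖x - y‖ := by nlinarith [norm_nonneg (x - y)]
      _ = (1 + 2 * η) * ((1 - η) * ‖x - y‖) := by ring
      _ ≤ _ := by gcongr
  have := lip_vol hl
  rw [hinj.leftInvOn_invFunOn.image_image] at this
  rw [ENNReal.ofReal_pow (by linarith)]
  exact this

lemma near_int (hB : MeasurableSet B) (hη : 0 ≤ η) (hη1 : η ≤ 1 / 2)
    (hT : ∀ x ∈ B, ∀ y ∈ B, ‖T x - T y - (x - y)‖ ≤ η * ‖x - y‖)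
    {f : Pt n → ENNReal} (hf : Measurable f) {L : ℝ} (hL : 0 ≤ L)
    (hfL : ∀ x, f x ≤ ENNReal.ofReal L) :
    ∫⁻ x in B, f (T x) ≤ (∫⁻ y in T '' B, f y) + ENNReal.ofReal (2 ^ (2 * n + 1) * η * L) * volume B := by
  have hlip := near_lip hη hT
  have hTm : MeasurableSet (T '' B) := hB.image_of_continuousOn_injOn hlip.continuousOn (near_inj hη1 hT)
  have hae : AEMeasurable T (volume.restrict B) := hlip.continuousOn.aemeasurable hB
  have hmap : Measure.map T (volume.restrict B) ≤ ENNReal.ofReal ((1 + 2 * η) ^ n) • volume.restrict (T '' B) := by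
    refine Measure.le_iff.2 fun A hA => ?_
    rw [Measure.map_apply_of_aemeasurable hae hA, Measure.smul_apply, Measure.restrict_apply hA,
      Measure.restrict_apply' hB, smul_eq_mul]
    refine (near_vol hη hη1 hT (E := T ⁻¹' A ∩ B) inter_subset_right).trans ?_
    gcongr
    rintro _ ⟨x, hx, rfl⟩
    exact ⟨hx.1, x, hx.2, rfl⟩
  rw [← lintegral_map' hf.aemeasurable hae]
  refine (lintegral_mono' hmap le_rfl).trans ?_
  rw [lintegral_smul_measure, smul_eq_mul]
  have hK : (1 + 2 * η) ^ n ≤ 1 + 2 ^ n * (2 * η) := by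
    refine (pow_one_add_le n (y := 2 * η) (by linarith) (by linarith)).trans ?_
    nlinarith
  have h2 : ∫⁻ y in T '' B, f y ≤ ENNReal.ofReal L * (ENNReal.ofReal (2 ^ n) * volume B) := by
    calc _ ≤ ∫⁻ y in T '' B, ENNReal.ofReal L := lintegral_mono hfL
      _ = ENNReal.ofReal L * volume (T '' B) := by rw [setLIntegral_const]
      _ ≤ _ := by
        gcongr
        refine (lip_vol hlip).trans ?_
        gcongr
        rw [ENNReal.ofReal_pow (by norm_num)]
        gcongr
        exact ENNReal.ofReal_le_ofReal (by linarith)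
  calc ENNReal.ofReal ((1 + 2 * η) ^ n) * ∫⁻ y in T '' B, f y
      ≤ ENNReal.ofReal (1 + 2 ^ n * (2 * η)) * ∫⁻ y in T '' B, f y := by gcongr
    _ = (∫⁻ y in T '' B, f y) + ENNReal.ofReal (2 ^ n * (2 * η)) * ∫⁻ y in T '' B, f y := by
        rw [ENNReal.ofReal_add (by norm_num) (by positivity), add_mul, ENNReal.ofReal_one, one_mul]
    _ ≤ (∫⁻ y in T '' B, f y) + ENNReal.ofReal (2 ^ n * (2 * η)) * (ENNReal.ofReal L * (ENNReal.ofReal (2 ^ n) * volume B)) := by gcongr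
    _ = _ := by
        rw [← mul_assoc, ← mul_assoc, ← ENNReal.ofReal_mul (by positivity), ← ENNReal.ofReal_mul (by positivity)]
        congr 3
        ring
end

section
variable {K : Set (Pt n)} {f : Pt n → ℝ} {f' : Pt n → (Pt n →L[ℝ] ℝ)} {L M κ t : ℝ} {z : Pt n}

lemma flow_slope (hK : Convex ℝ K) (hL : 1 ≤ L) (hf : C11 K f f' L) (hM : 1 ≤ M) {x : Pt n}
    (hx : x ∈ K) (hz : z ∈ K) (hd : ‖z - x‖ ≤ M) (hκ : 0 < κ) (hκ1 : κ ≤ 1) (h : f' x (z - x) ≤ -κ)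
    {a b : ℝ} (ha : 0 ≤ a) (hab : a ≤ b) (hb : b ≤ κ / (2 * L * M ^ 2)) :
    f (x + b • (z - x)) - f (x + a • (z - x)) ≤ -(κ / 2) * (b - a) := by
  have hθ1 : κ / (2 * L * M ^ 2) ≤ 1 := by
    rw [div_le_one (by positivity)]
    have : 1 ≤ M ^ 2 := one_le_pow₀ hM
    nlinarith
  have mem : ∀ s, 0 ≤ s → s ≤ b → x + s • (z - x) ∈ K := fun s h0 h1 =>
    hK.add_smul_sub_mem hx hz ⟨h0, by linarith⟩
  have nm : ∀ s, 0 ≤ s → s ≤ b → ‖x + s • (z - x) - x‖ ≤ κ / (2 * L * M) := fun s h0 h1 => by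
    rw [add_sub_cancel_left, norm_smul, Real.norm_of_nonneg h0]
    calc s * ‖z - x‖ ≤ κ / (2 * L * M ^ 2) * M := by gcongr; linarith
      _ = _ := by field_simp
  have hmv := hf.mv hK (by linarith) (mem b (by linarith) le_rfl) (mem a ha hab) hx
    (nm b (by linarith) le_rfl) (nm a ha hab)
  have e : x + b • (z - x) - (x + a • (z - x)) = (b - a) • (z - x) := by module
  rw [e, map_smul, smul_eq_mul, norm_smul, Real.norm_of_nonneg (by linarith)] at hmv
  have h1 := (abs_le.1 hmv).2
  have h2 : L * (κ / (2 * L * M)) * ((b - a) * ‖z - x‖) ≤ L * (κ / (2 * L * M)) * ((b - a) * M) := by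
    have : 0 ≤ b - a := by linarith
    gcongr
  have h3 : L * (κ / (2 * L * M)) * ((b - a) * M) = κ / 2 * (b - a) := by field_simp
  have h4 : (b - a) * f' x (z - x) ≤ (b - a) * (-κ) := by
    have : 0 ≤ b - a := by linarith
    gcongr
  linarith

lemma flow_diff (hK : Convex ℝ K) (hL : 1 ≤ L) (hf : C11 K f f' L) {x y : Pt n}
    (hx : x ∈ K) (hy : y ∈ K) (hz : z ∈ K) (hdx : ‖z - x‖ ≤ M) {θ : ℝ} (h0 : 0 ≤ θ) (h1 : θ ≤ 1) :
    |(f (x + θ • (z - x)) - f x) - (f (y + θ • (z - y)) - f y)| ≤ L * (M + 1) * ‖x - y‖ * θ := by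
  have hder : ∀ u ∈ K, ∀ s ∈ Icc (0:ℝ) 1, HasDerivWithinAt (fun s : ℝ => f (u + s • (z - u)))
      (f' (u + s • (z - u)) (z - u)) (Icc 0 1) s := by
    intro u hu s hs
    have hc : HasDerivWithinAt (fun s : ℝ => u + s • (z - u)) (z - u) (Icc 0 1) s := by
      have := ((hasDerivWithinAt_id s (Icc (0:ℝ) 1)).smul_const (z - u)).const_add u
      simpa using this
    exact (hf.1 _ (hK.add_smul_sub_mem hu hz hs)).comp_hasDerivWithinAt s hc
      (fun s hs => hK.add_smul_sub_mem hu hz hs)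
  have := (convex_Icc (0:ℝ) 1).norm_image_sub_le_of_norm_hasDerivWithin_le
    (f := fun s : ℝ => f (x + s • (z - x)) - f (y + s • (z - y)))
    (fun s hs => (hder x hx s hs).sub (hder y hy s hs)) (C := L * (M + 1) * ‖x - y‖) (fun s hs => ?_)
    (⟨le_rfl, zero_le_one⟩ : (0:ℝ) ∈ Icc (0:ℝ) 1) ⟨h0, h1⟩
  · simp only [zero_smul, add_zero, sub_zero, Real.norm_eq_abs, abs_of_nonneg h0] at this
    convert this using 2
    ring
  · have e : f' (x + s • (z - x)) (z - x) - f' (y + s • (z - y)) (z - y)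
        = (f' (x + s • (z - x)) - f' (y + s • (z - y))) (z - x) - f' (y + s • (z - y)) (x - y) := by
      have : z - y = (z - x) + (x - y) := by abel
      conv_lhs => rw [this, map_add, ← this]
      simp only [sub_apply]; ring
    rw [e]
    have hm1 := hK.add_smul_sub_mem hx hz hs
    have hm2 := hK.add_smul_sub_mem hy hz hs
    have a1 : ‖(f' (x + s • (z - x)) - f' (y + s • (z - y))) (z - x)‖ ≤ L * ‖x - y‖ * M := by
      refine (ContinuousLinearMap.le_opNorm _ _).trans ?_
      have : ‖f' (x + s • (z - x)) - f' (y + s • (z - y))‖ ≤ L * ‖x - y‖ := by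
        refine (hf.2.2 _ hm1 _ hm2).trans ?_
        have e2 : x + s • (z - x) - (y + s • (z - y)) = (1 - s) • (x - y) := by module
        rw [e2, norm_smul, Real.norm_of_nonneg (by linarith [hs.2])]
        have : (1 - s) * ‖x - y‖ ≤ 1 * ‖x - y‖ := by gcongr; linarith [hs.1]
        nlinarith
      gcongr
    have a2 : ‖f' (y + s • (z - y)) (x - y)‖ ≤ L * ‖x - y‖ := by
      refine (ContinuousLinearMap.le_opNorm _ _).trans ?_
      gcongr
      exact hf.2.1 _ hm2
    calc _ ≤ _ := norm_sub_le _ _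
      _ ≤ L * ‖x - y‖ * M + L * ‖x - y‖ := add_le_add a1 a2
      _ = _ := by ring

lemma flow_exists (hK : Convex ℝ K) (hL : 1 ≤ L) (hf : C11 K f f' L) (hM : 1 ≤ M)
    (hz : z ∈ K) (hκ : 0 < κ) (hκ1 : κ ≤ 1) {B : Set (Pt n)} (hBK : B ⊆ K)
    (hd : ∀ x ∈ B, ‖z - x‖ ≤ M) (h : ∀ x ∈ B, f' x (z - x) ≤ -κ)
    (ht : 0 < t) (ht1 : t ≤ κ ^ 2 / (4 * L * M ^ 2)) :
    ∃ T : Pt n → Pt n, (∀ x ∈ B, T x ∈ K ∧ f (T x) = f x - t ∧ ‖T x - x‖ ≤ 2 * M * t / κ) ∧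
      ∀ x ∈ B, ∀ y ∈ B, ‖T x - T y - (x - y)‖ ≤ (4 * L * (M + 1) * M + 2) * t / κ ^ 2 * ‖x - y‖ := by
  set θ0 := κ / (2 * L * M ^ 2) with hθ0
  have hθ0p : 0 < θ0 := by positivity
  have hθ1 : θ0 ≤ 1 := by
    rw [hθ0, div_le_one (by positivity)]
    have : 1 ≤ M ^ 2 := one_le_pow₀ hM
    nlinarith
  have hex : ∀ x : Pt n, ∃ θ : ℝ, x ∈ B → θ ∈ Icc 0 θ0 ∧ f (x + θ • (z - x)) = f x - t ∧ θ ≤ 2 * t / κ := by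
    intro x
    by_cases hx : x ∈ B
    · have hcont : ContinuousOn (fun θ : ℝ => f (x + θ • (z - x))) (Icc 0 θ0) := by
        have hfc : ContinuousOn f K := fun y hy => (hf.1 y hy).continuousWithinAt
        refine hfc.comp (by fun_prop) fun s hs => hK.add_smul_sub_mem (hBK hx) hz ⟨hs.1, hs.2.trans hθ1⟩
      have hs0 := flow_slope hK hL hf hM (hBK hx) hz (hd x hx) hκ hκ1 (h x hx) le_rfl hθ0p.le le_rfl
      have hiv := intermediate_value_Icc' hθ0p.le hcont
      obtain ⟨θ, hθ, hθe⟩ := hiv (show f x - t ∈ _ by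
        simp only [zero_smul, add_zero] at hs0 ⊢
        refine ⟨?_, by linarith⟩
        have : κ / 2 * (θ0 - 0) = κ ^ 2 / (4 * L * M ^ 2) := by rw [hθ0]; field_simp; ring
        linarith)
      refine ⟨θ, fun _ => ⟨hθ, hθe, ?_⟩⟩
      have := flow_slope hK hL hf hM (hBK hx) hz (hd x hx) hκ hκ1 (h x hx) le_rfl hθ.1 hθ.2
      simp only [zero_smul, add_zero, sub_zero] at this hθe
      rw [le_div_iff₀ hκ]
      linarith
    · exact ⟨0, fun h => absurd h hx⟩
  choose θ hθ using hex
  refine ⟨fun x => x + θ x • (z - x), ?_, ?_⟩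
  · intro x hx
    obtain ⟨h1, h2, h3⟩ := hθ x hx
    refine ⟨hK.add_smul_sub_mem (hBK hx) hz ⟨h1.1, h1.2.trans hθ1⟩, h2, ?_⟩
    rw [add_sub_cancel_left, norm_smul, Real.norm_of_nonneg h1.1]
    calc θ x * ‖z - x‖ ≤ 2 * t / κ * M := by gcongr; exact hd x hx
      _ = _ := by ring
  · intro x hx y hy
    obtain ⟨h1, h2, h3⟩ := hθ x hx
    obtain ⟨k1, k2, k3⟩ := hθ y hy
    have hdiff := flow_diff hK hL hf (hBK hx) (hBK hy) hz (hd x hx) k1.1 (k1.2.trans hθ1)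
    have hkey : κ / 2 * |θ x - θ y| ≤ L * (M + 1) * ‖x - y‖ * θ y := by
      refine le_trans ?_ hdiff
      rw [k2]
      rcases le_total (θ x) (θ y) with hle | hle
      · have := flow_slope hK hL hf hM (hBK hx) hz (hd x hx) hκ hκ1 (h x hx) h1.1 hle k1.2
        rw [abs_of_nonpos (by linarith)]
        refine le_trans ?_ (neg_le_abs _)
        linarith
      · have := flow_slope hK hL hf hM (hBK hx) hz (hd x hx) hκ hκ1 (h x hx) k1.1 hle h1.2
        rw [abs_of_nonneg (by linarith)]
        refine le_trans ?_ (le_abs_self _)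
        linarith
    have hkey2 : |θ x - θ y| ≤ 4 * L * (M + 1) * t / κ ^ 2 * ‖x - y‖ := by
      have : L * (M + 1) * ‖x - y‖ * θ y ≤ L * (M + 1) * ‖x - y‖ * (2 * t / κ) := by gcongr
      have h5 : |θ x - θ y| ≤ (L * (M + 1) * ‖x - y‖ * (2 * t / κ)) / (κ / 2) := by
        rw [le_div_iff₀ (by positivity)]; linarith
      refine h5.trans (le_of_eq ?_)
      field_simp; ring
    have e : x + θ x • (z - x) - (y + θ y • (z - y)) - (x - y) = (θ x - θ y) • (z - x) - θ y • (x - y) := by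
      module
    simp only
    rw [e]
    have b1 : ‖(θ x - θ y) • (z - x)‖ ≤ 4 * L * (M + 1) * t / κ ^ 2 * ‖x - y‖ * M := by
      rw [norm_smul, Real.norm_eq_abs]
      gcongr
      exact hd x hx
    have b2 : ‖θ y • (x - y)‖ ≤ 2 * t / κ ^ 2 * ‖x - y‖ := by
      rw [norm_smul, Real.norm_of_nonneg k1.1]
      gcongr
      refine k3.trans ?_
      gcongr
      nlinarith
    calc _ ≤ _ := norm_sub_le _ _
      _ ≤ _ := add_le_add b1 b2
      _ = _ := by ring
end

namespace CD
variable (D : CD n N)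

lemma Rcont (j : Fin N) : ContinuousOn (D.R j) (D.K j) := by
  intro x hx
  rw [ContinuousWithinAt, tendsto_iff_dist_tendsto_zero]
  have h1 : Tendsto (fun y : Pt n => D.L * ‖y - x‖ ^ D.α) (nhdsWithin x (D.K j)) (nhds 0) := by
    have : Continuous fun y : Pt n => D.L * ‖y - x‖ ^ D.α := by
      have := D.hα.le
      fun_prop (disch := assumption)
    have h2 := this.tendsto x
    simp only [sub_self, norm_zero, Real.zero_rpow D.hα.ne', mul_zero] at h2
    exact h2.mono_left nhdsWithin_le_nhds
  refine squeeze_zero' (Eventually.of_forall fun _ => dist_nonneg) ?_ h1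
  filter_upwards [self_mem_nhdsWithin] with y hy
  rw [Real.dist_eq]
  exact D.RH j y hy x hx

lemma transport : ∃ C, 1 ≤ C ∧ ∃ c, 0 < c ∧ c ≤ 1 ∧ ∀ ε, 0 < ε → ε ≤ 1 → ∀ (ψ : Fin N → ℝ) (j m : Fin N),
    m ≠ j → ENNReal.ofReal ε < D.ν (cell ψ j) → ∀ S S' : Set (Fin N → ℝ), MeasurableSet S →
    MeasurableSet S' → (∀ v ∈ S, ψ m - ψ j - D.cc * ε ≤ v j - v m) → ∀ σ t : ℝ, 0 < σ → 0 < t →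
    t ≤ c * ε ^ 2 → volume {p ∈ D.K j | (fun l => D.F j l p) ∈ S} ≤ ENNReal.ofReal (D.S0 * σ) →
    (∀ v ∈ S, ∀ v' : Fin N → ℝ, v' j - v' m = v j - v m - t → (∀ l, |v' l - v l| ≤ C * t / ε) → v' ∈ S') →
    D.ν S ≤ D.ν S' + ENNReal.ofReal (C * σ * t ^ D.α / ε ^ 2) := by
  have hc := D.cc_pos
  have hc1 := D.cc_le
  have hL := D.hL
  have hR := D.hRad
  have hS0 := D.S0_one
  have hα := D.hα
  have hα1 := D.hα1
  set M := 2 * D.Rad with hM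
  have hM1 : 1 ≤ M := by linarith
  set Q := 4 * (2 * D.L) * (M + 1) * M + 2 with hQ
  have hQ1 : 1 ≤ Q := by rw [hQ]; nlinarith [mul_pos (mul_pos (by linarith : 0 < D.L) (by linarith : 0 < M + 1)) (by linarith : 0 < M)]
  set C1 := 2 * M * D.L / D.cc with hC1
  set C2 := (2 ^ (2 * n + 1) * Q * D.L + 2 * M * D.L) * D.S0 / D.cc ^ 2 with hC2
  have hC1p : 0 < C1 := by positivity
  have hC2p : 0 < C2 := by positivity
  refine ⟨1 + C1 + C2, by linarith, D.cc ^ 2 / (2 * Q), by positivity, ?_, ?_⟩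
  · rw [div_le_one (by positivity)]; nlinarith
  intro ε hε hε1 ψ j m hmj hcell S S' hS hS' hlow σ t hσ ht htc hvol hSS'
  set κ := D.cc * ε with hκ
  have hκp : 0 < κ := by positivity
  have hκ1 : κ ≤ 1 := by rw [hκ]; nlinarith
  obtain ⟨z, hz, hzz⟩ := D.cc_spec ε hε hε1 ψ j hcell
  set B := {p ∈ D.K j | (fun l => D.F j l p) ∈ S} with hB
  have hBm : MeasurableSet B := D.pre_meas j hS
  have htQ : t ≤ κ ^ 2 / (2 * Q) := by
    refine htc.trans (le_of_eq ?_); rw [hκ]; ring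
  have ht1 : t ≤ κ ^ 2 / (4 * (2 * D.L) * M ^ 2) := by
    refine htQ.trans (div_le_div_of_nonneg_left (by positivity) (by positivity) ?_)
    rw [hQ]; nlinarith [mul_pos (by linarith : 0 < D.L) (by linarith : 0 < M)]
  have hdist : ∀ x ∈ D.K j, ‖z - x‖ ≤ M := by
    intro x hx
    have h1 := mem_closedBall_zero_iff.1 (D.Krad j hz)
    have h2 := mem_closedBall_zero_iff.1 (D.Krad j hx)
    have h3 := norm_sub_le z x
    linarith
  obtain ⟨T, hT1, hT2⟩ := flow_exists (D.Kconv j) (by linarith : 1 ≤ 2 * D.L) ((D.FC j j).sub (D.FC j m)) hM1 hz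
    hκp hκ1 (B := B) (fun x hx => hx.1) (fun x hx => hdist x hx.1)
    (fun x hx => hzz m hmj x hx.1 (hlow _ hx.2)) ht ht1
  rw [← hQ] at hT2
  have hη : Q * t / κ ^ 2 ≤ 1 / 2 := by
    rw [div_le_iff₀ (by positivity)]
    rw [le_div_iff₀ (by positivity)] at htQ
    linarith
  have hKm : MeasurableSet (D.K j) := (D.Kcomp j).isClosed.measurableSet
  set f0 : Pt n → ENNReal := (D.K j).piecewise (fun p => ENNReal.ofReal (D.R j p)) 0 with hf0
  have hf0m : Measurable f0 :=
    ContinuousOn.measurable_piecewise (ENNReal.continuous_ofReal.comp_continuousOn (D.Rcont j))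
      continuousOn_const hKm
  have hf0K : ∀ x ∈ D.K j, f0 x = ENNReal.ofReal (D.R j x) := fun x hx => piecewise_eq_of_mem _ _ _ hx
  have hf0L : ∀ x, f0 x ≤ ENNReal.ofReal D.L := by
    intro x
    by_cases hx : x ∈ D.K j
    · rw [hf0K x hx]; exact ENNReal.ofReal_le_ofReal (D.RL j x hx)
    · rw [hf0, piecewise_eq_of_notMem _ _ _ hx]; simp
  have hint := near_int hBm (by positivity) hη hT2 hf0m (by linarith : 0 ≤ D.L) hf0L
  have hTB : T '' B ⊆ {p ∈ D.K j | (fun l => D.F j l p) ∈ S'} := by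
    rintro _ ⟨x, hx, rfl⟩
    obtain ⟨h1, h2, h3⟩ := hT1 x hx
    refine ⟨h1, hSS' _ hx.2 _ h2 fun l => ?_⟩
    refine ((D.FC j l).lip (D.Kconv j) h1 hx.1).trans ?_
    calc D.L * ‖T x - x‖ ≤ D.L * (2 * M * t / κ) := by gcongr
      _ = C1 * t / ε := by rw [hC1, hκ]; field_simp
      _ ≤ _ := by gcongr; linarith
  have hstep : D.ν S ≤ (∫⁻ x in B, f0 (T x)) + ENNReal.ofReal (D.L * (2 * M * t / κ) ^ D.α) * volume B := by
    rw [D.νeq j S hS, ← hB, ← setLIntegral_const, ← lintegral_add_right _ measurable_const]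
    refine setLIntegral_mono' hBm fun x hx => ?_
    obtain ⟨h1, h2, h3⟩ := hT1 x hx
    rw [hf0K _ h1, ← ENNReal.ofReal_add (D.R0 _ _) (by positivity)]
    apply ENNReal.ofReal_le_ofReal
    have h4 := (abs_le.1 (D.RH j x hx.1 _ h1)).2
    have h5 : D.L * ‖x - T x‖ ^ D.α ≤ D.L * (2 * M * t / κ) ^ D.α := by
      rw [norm_sub_rev]
      gcongr
    linarith
  have hS'le : ∫⁻ y in T '' B, f0 y ≤ D.ν S' := by
    rw [D.νeq j S' hS']
    refine (lintegral_mono_set hTB).trans ?_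
    refine setLIntegral_mono' (D.pre_meas j hS') fun x hx => ?_
    rw [hf0K x hx.1]
  have ht1' : t ≤ 1 := by
    refine htQ.trans ?_
    rw [div_le_one (by positivity)]
    nlinarith
  have htα : t ≤ t ^ D.α := by
    conv_lhs => rw [← Real.rpow_one t]
    exact Real.rpow_le_rpow_of_exponent_ge ht ht1' hα1
  have hMκ : (2 * M * t / κ) ^ D.α ≤ 2 * M / κ ^ 2 * t ^ D.α := by
    have e : 2 * M * t / κ = (2 * M / κ) * t := by ring
    have h1 : 1 ≤ 2 * M / κ := by rw [le_div_iff₀ hκp]; linarith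
    rw [e, Real.mul_rpow (by positivity) ht.le]
    gcongr
    calc (2 * M / κ) ^ D.α ≤ (2 * M / κ) ^ (1:ℝ) := Real.rpow_le_rpow_of_exponent_le h1 hα1
      _ = 2 * M / κ := Real.rpow_one _
      _ ≤ _ := by gcongr; nlinarith
  calc D.ν S ≤ _ := hstep
    _ ≤ (D.ν S' + ENNReal.ofReal (2 ^ (2 * n + 1) * (Q * t / κ ^ 2) * D.L) * volume B) +
        ENNReal.ofReal (D.L * (2 * M * t / κ) ^ D.α) * volume B := by
        gcongr
        exact hint.trans (by gcongr)
    _ = D.ν S' + (ENNReal.ofReal (2 ^ (2 * n + 1) * (Q * t / κ ^ 2) * D.L + D.L * (2 * M * t / κ) ^ D.α)) * volume B := by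
        rw [ENNReal.ofReal_add (by positivity) (by positivity)]; ring
    _ ≤ D.ν S' + (ENNReal.ofReal (2 ^ (2 * n + 1) * (Q * t / κ ^ 2) * D.L + D.L * (2 * M * t / κ) ^ D.α)) * ENNReal.ofReal (D.S0 * σ) := by
        gcongr
    _ ≤ _ := by
        rw [← ENNReal.ofReal_mul (by positivity)]
        gcongr
        have a1 : 2 ^ (2 * n + 1) * (Q * t / κ ^ 2) * D.L ≤ 2 ^ (2 * n + 1) * (Q * t ^ D.α / κ ^ 2) * D.L := by gcongr
        have a2 : D.L * (2 * M * t / κ) ^ D.α ≤ D.L * (2 * M / κ ^ 2 * t ^ D.α) := by gcongr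
        calc _ ≤ (2 ^ (2 * n + 1) * (Q * t ^ D.α / κ ^ 2) * D.L + D.L * (2 * M / κ ^ 2 * t ^ D.α)) * (D.S0 * σ) := by
              gcongr
          _ = C2 * σ * t ^ D.α / ε ^ 2 := by rw [hC2, hκ]; field_simp
          _ ≤ _ := by gcongr; linarith

end CD

/-- Relaxed strips between cells. -/
def strip (i k : Fin N) (ψ : Fin N → ℝ) (a σ τ : ℝ) : Set (Fin N → ℝ) :=
  slab i k a σ ∩ {v | ∀ m, m ≠ k → v i + ψ i ≤ v m + ψ m + τ}

lemma strip_meas (i k : Fin N) (ψ : Fin N → ℝ) (a σ τ : ℝ) : MeasurableSet (strip i k ψ a σ τ) := by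
  refine (slab_meas i k a σ).inter ?_
  have : {v : Fin N → ℝ | ∀ m, m ≠ k → v i + ψ i ≤ v m + ψ m + τ} =
    ⋂ m, ⋂ (_ : m ≠ k), {v | v i + ψ i ≤ v m + ψ m + τ} := by ext v; simp
  rw [this]
  exact MeasurableSet.iInter fun m => MeasurableSet.iInter fun _ =>
    measurableSet_le (by fun_prop) (by fun_prop)

namespace CD
variable (D : CD n N)

/-- The masses of the cells. -/
def G (i : Fin N) (ψ : Fin N → ℝ) : ℝ := (D.ν (cell ψ i)).toReal

lemma strip_relax {C : ℝ} (hC0 : 0 ≤ C) (hC : ∀ ε, 0 < ε → ε ≤ 1 → ∀ ψ : Fin N → ℝ, D.Big ε ψ →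
    ∀ i k l : Fin N, k ≠ i → l ≠ i → k ≠ l → ∀ (S : Set (Fin N → ℝ)), MeasurableSet S →
    ∀ a b σ t : ℝ, 0 < σ → 0 < t → S ⊆ slab i k a σ → S ⊆ slab i l b t →
    (∀ v ∈ S, |v i - v k - (ψ k - ψ i)| ≤ D.cc / 2 * ε ∧ |v i - v l - (ψ l - ψ i)| ≤ D.cc / 2 * ε) →
    D.ν S ≤ ENNReal.ofReal (C * σ * t / ε ^ 4))
    {ε : ℝ} (hε : 0 < ε) (hε1 : ε ≤ 1) {ψ : Fin N → ℝ} (hψ : D.Big ε ψ) {i k : Fin N} (hki : k ≠ i)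
    {a σ τ : ℝ} (hσ : 0 < σ) (hτ : 0 < τ) (ha : ψ k - ψ i ≤ a) (haσ : a + σ ≤ ψ k - ψ i + D.cc / 2 * ε)
    (hτε : τ ≤ D.cc / 2 * ε) :
    D.ν (strip i k ψ a σ τ) ≤ D.ν (strip i k ψ a σ 0) + ENNReal.ofReal (N * (C * σ * τ / ε ^ 4)) := by
  set Dm : Fin N → Set (Fin N → ℝ) := fun m => if m = i ∨ m = k then ∅ else
    slab i k a σ ∩ slab i m (ψ m - ψ i) τ with hDm
  have hsub : strip i k ψ a σ τ ⊆ strip i k ψ a σ 0 ∪ ⋃ m, Dm m := by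
    intro v hv
    by_cases h : ∃ m, m ≠ k ∧ v m + ψ m < v i + ψ i
    · right
      obtain ⟨m, hmk, hm⟩ := h
      have hmi : m ≠ i := by rintro rfl; exact lt_irrefl _ hm
      rw [mem_iUnion]
      refine ⟨m, ?_⟩
      simp only [hDm, if_neg (not_or.2 ⟨hmi, hmk⟩)]
      have := hv.2 m hmk
      exact ⟨hv.1, by linarith, by linarith⟩
    · left
      push Not at h
      exact ⟨hv.1, fun m hm => by have := h m hm; linarith⟩
  refine (measure_mono hsub).trans ((measure_union_le _ _).trans ?_)
  gcongr
  calc D.ν (⋃ m, Dm m) ≤ ∑ m, D.ν (Dm m) := measure_iUnion_fintype_le _ _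
    _ ≤ ∑ m : Fin N, ENNReal.ofReal (C * σ * τ / ε ^ 4) := by
        apply Finset.sum_le_sum
        intro m _
        simp only [hDm]
        split_ifs with hm
        · simp
        · rw [not_or] at hm
          refine hC ε hε hε1 ψ hψ i k m hki hm.1 (Ne.symm hm.2) _
            ((slab_meas _ _ _ _).inter (slab_meas _ _ _ _)) _ _ σ τ hσ hτ inter_subset_left inter_subset_right ?_
          rintro v ⟨h1, h2⟩
          have hc := D.cc_pos
          have := h1.1; have := h1.2; have := h2.1; have := h2.2
          exact ⟨abs_le.2 ⟨by nlinarith, by linarith⟩, abs_le.2 ⟨by nlinarith, by linarith⟩⟩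
    _ = _ := by
        rw [Finset.sum_const, Finset.card_univ, Fintype.card_fin, nsmul_eq_mul,
          ENNReal.ofReal_mul (p := (N:ℝ)) (by positivity), ENNReal.ofReal_natCast]

lemma G_diff {i k : Fin N} (hki : k ≠ i) (ψ : Fin N → ℝ) {σ : ℝ} (hσ : 0 ≤ σ) :
    D.G i (ψ + Pi.single k σ) - D.G i ψ = (D.ν (strip i k ψ (ψ k - ψ i) σ 0)).toReal := by
  have e : cell (ψ + Pi.single k σ) i = cell ψ i ∪ strip i k ψ (ψ k - ψ i) σ 0 := by
    ext v
    constructor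
    · intro h
      have h' : ∀ m, m ≠ k → v i + ψ i ≤ v m + ψ m := fun m hm => by
        have := h m
        simpa [hki.symm, hm] using this
      have hk : v i + ψ i ≤ v k + (ψ k + σ) := by
        have := h k
        simpa [hki.symm] using this
      by_cases hc : v i + ψ i ≤ v k + ψ k
      · left
        intro m
        by_cases hm : m = k
        · rw [hm]; exact hc
        · exact h' m hm
      · right
        exact ⟨⟨by linarith, by linarith⟩, fun m hm => by linarith [h' m hm]⟩
    · rintro (h | h)
      · intro m
        have := h m
        by_cases hm : m = k
        · subst hm; simp [hki.symm]; linarith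
        · simp [hki.symm, hm]; exact this
      · intro m
        by_cases hm : m = k
        · subst hm; simp [hki.symm]; linarith [h.1.2]
        · simp [hki.symm, hm]; linarith [h.2 m hm]
  have hd : Disjoint (cell ψ i) (strip i k ψ (ψ k - ψ i) σ 0) := by
    rw [Set.disjoint_left]
    intro v h1 h2
    have := h1 k
    have := h2.1.1
    linarith
  rw [G, G, e, measure_union hd (strip_meas _ _ _ _ _ _), ENNReal.toReal_add (measure_ne_top _ _) (measure_ne_top _ _)]
  ring

lemma strip_shift {i k l : Fin N} (hli : l ≠ i) (ψ : Fin N → ℝ) (t a σ : ℝ) (hkl : k = l) :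
    strip i k (ψ + Pi.single l t) a σ 0 = strip i k ψ a σ 0 := by
  subst hkl
  ext v
  refine and_congr_right fun _ => forall_congr' fun m => ?_
  refine forall_congr' fun hm => ?_
  simp [hli.symm, hm]

lemma second_diff : ∃ H, 1 ≤ H ∧ ∃ c, 0 < c ∧ c ≤ 1 ∧ ∀ ε, 0 < ε → ε ≤ 1 → ∀ ψ : Fin N → ℝ, D.Big ε ψ →
    ∀ i k l : Fin N, k ≠ i → l ≠ i → ∀ σ t : ℝ, 0 ≤ σ → 0 ≤ t → σ ≤ c * ε ^ 2 → t ≤ c * ε ^ 2 →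
    |(D.G i (ψ + Pi.single l t + Pi.single k σ) - D.G i (ψ + Pi.single l t)) -
      (D.G i (ψ + Pi.single k σ) - D.G i ψ)| ≤ H * σ * t ^ D.α / ε ^ 5 := by
  obtain ⟨C1, hC1, c1, hc1p, hc11, htr⟩ := D.transport
  obtain ⟨C2, hC2, hdb⟩ := D.double
  have hc := D.cc_pos
  have hcl := D.cc_le
  have hα := D.hα
  have hα1 := D.hα1
  refine ⟨1 + C1 + N * (C2 * (2 * C1)) + C2, by linarith [show 0 ≤ N * (C2 * (2 * C1)) by positivity], min c1 (D.cc / (4 * C1)), by positivity,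
    (min_le_left _ _).trans hc11, ?_⟩
  intro ε hε hε1 ψ hψ i k l hki hli σ t hσ0 ht0 hσc htc
  rcases hσ0.eq_or_lt with rfl | hσ
  · simp
  rcases ht0.eq_or_lt with rfl | ht
  · simp [Real.zero_rpow hα.ne']
  have htc1 : t ≤ c1 * ε ^ 2 := htc.trans (by gcongr; exact min_le_left _ _)
  have htc2 : t ≤ D.cc / (4 * C1) * ε ^ 2 := htc.trans (by gcongr; exact min_le_right _ _)
  have hσc2 : σ ≤ D.cc / (4 * C1) * ε ^ 2 := hσc.trans (by gcongr; exact min_le_right _ _)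
  have hε2 : ε ^ 2 ≤ ε := by nlinarith
  have hsmall : D.cc / (4 * C1) * ε ^ 2 ≤ D.cc / 4 * ε := by
    have : D.cc / (4 * C1) ≤ D.cc / 4 := div_le_div_of_nonneg_left hc.le (by norm_num) (by linarith)
    gcongr
  have ht1 : t ≤ 1 := by nlinarith
  have htα : t ≤ t ^ D.α := by
    conv_lhs => rw [← Real.rpow_one t]
    exact Real.rpow_le_rpow_of_exponent_ge ht ht1 hα1
  have htα0 : 0 < t ^ D.α := by positivity
  have hε52 : 1 / ε ^ 2 ≤ 1 / ε ^ 5 := one_div_le_one_div_of_le (by positivity) (pow_le_pow_of_le_one hε.le hε1 (by norm_num))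
  have hε54 : 1 / ε ^ 4 ≤ 1 / ε ^ 5 := one_div_le_one_div_of_le (by positivity) (pow_le_pow_of_le_one hε.le hε1 (by norm_num))
  rw [D.G_diff hki _ hσ.le, D.G_diff hki _ hσ.le]
  have toR : ∀ (A B : Set (Fin N → ℝ)) (E : ℝ), 0 ≤ E → D.ν A ≤ D.ν B + ENNReal.ofReal E →
      (D.ν A).toReal - (D.ν B).toReal ≤ E := by
    intro A B E hE h
    have h2 := ENNReal.toReal_mono (by finiteness) h
    rw [ENNReal.toReal_add (measure_ne_top _ _) ENNReal.ofReal_ne_top, ENNReal.toReal_ofReal hE] at h2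
    linarith
  by_cases hkl : k = l
  · rw [strip_shift hli ψ t _ σ hkl]
    subst hkl
    have ea : (ψ + Pi.single k t : Fin N → ℝ) k - (ψ + Pi.single k t : Fin N → ℝ) i = ψ k - ψ i + t := by
      simp [hki.symm]; ring
    rw [ea]
    set τ := 2 * (C1 * t / ε) with hτ
    have hτp : 0 < τ := by positivity
    have hτε : τ ≤ D.cc / 2 * ε := by
      calc τ ≤ 2 * (C1 * (D.cc / (4 * C1) * ε ^ 2) / ε) := by rw [hτ]; gcongr
        _ = _ := by field_simp; ring
    have hτE : N * (C2 * σ * τ / ε ^ 4) ≤ N * (C2 * (2 * C1)) * σ * t ^ D.α / ε ^ 5 := by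
      calc _ = N * (C2 * (2 * C1)) * σ * t / ε ^ 5 := by rw [hτ]; field_simp
        _ ≤ _ := by gcongr
    have hE2 : C1 * σ * t ^ D.α / ε ^ 2 ≤ C1 * σ * t ^ D.α / ε ^ 5 := by
      rw [div_eq_mul_one_div, div_eq_mul_one_div _ (ε ^ 5)]; gcongr
    have hE : N * (C2 * σ * τ / ε ^ 4) + C1 * σ * t ^ D.α / ε ^ 2 ≤
        (1 + C1 + N * (C2 * (2 * C1)) + C2) * σ * t ^ D.α / ε ^ 5 := by
      have e : (1 + C1 + N * (C2 * (2 * C1)) + C2) * σ * t ^ D.α / ε ^ 5 =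
        N * (C2 * (2 * C1)) * σ * t ^ D.α / ε ^ 5 + C1 * σ * t ^ D.α / ε ^ 5 + (1 + C2) * σ * t ^ D.α / ε ^ 5 := by ring
      rw [e]
      have : 0 ≤ (1 + C2) * σ * t ^ D.α / ε ^ 5 := by positivity
      linarith
    have A1 : D.ν (strip i k ψ (ψ k - ψ i + t) σ 0) ≤ D.ν (strip i k ψ (ψ k - ψ i) σ 0) +
        ENNReal.ofReal (N * (C2 * σ * τ / ε ^ 4) + C1 * σ * t ^ D.α / ε ^ 2) := by
      have h1 := htr ε hε hε1 ψ i k hki (hψ i) (strip i k ψ (ψ k - ψ i + t) σ 0) (strip i k ψ (ψ k - ψ i) σ τ)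
        (strip_meas _ _ _ _ _ _) (strip_meas _ _ _ _ _ _) (fun v hv => by
          have := hv.1.1; nlinarith) σ t hσ ht htc1
        (D.slab_vol i i k hki.symm hσ _ (D.pre_meas i (strip_meas _ _ _ _ _ _)) (fun x hx => hx.1) (fun x hx => hx.2.1))
        (fun v hv v' h1 h2 => by
          have h3 := hv.1.1
          have h4 := hv.1.2
          refine ⟨⟨by linarith, by linarith⟩, fun m hm => ?_⟩
          have h5 := hv.2 m hm
          have h6 := (abs_le.1 (h2 i)).2
          have h7 := (abs_le.1 (h2 m)).1
          linarith)
      have h2 := D.strip_relax hC2 hdb hε hε1 hψ hki (a := ψ k - ψ i) (σ := σ) (τ := τ) hσ hτp le_rfl (by nlinarith) hτε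
      refine h1.trans ((add_le_add_left h2 _).trans ?_)
      rw [add_assoc, ← ENNReal.ofReal_add (by positivity) (by positivity)]
    have A2 : D.ν (strip i k ψ (ψ k - ψ i) σ 0) ≤ D.ν (strip i k ψ (ψ k - ψ i + t) σ 0) +
        ENNReal.ofReal (N * (C2 * σ * τ / ε ^ 4) + C1 * σ * t ^ D.α / ε ^ 2) := by
      have h1 := htr ε hε hε1 ψ k i hki.symm (hψ k) (strip i k ψ (ψ k - ψ i) σ 0) (strip i k ψ (ψ k - ψ i + t) σ τ)
        (strip_meas _ _ _ _ _ _) (strip_meas _ _ _ _ _ _) (fun v hv => by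
          have := hv.1.2; nlinarith) σ t hσ ht htc1
        (D.slab_vol k i k hki.symm hσ _ (D.pre_meas k (strip_meas _ _ _ _ _ _)) (fun x hx => hx.1) (fun x hx => hx.2.1))
        (fun v hv v' h1 h2 => by
          have h3 := hv.1.1
          have h4 := hv.1.2
          refine ⟨⟨by linarith, by linarith⟩, fun m hm => ?_⟩
          have h5 := hv.2 m hm
          have h6 := (abs_le.1 (h2 i)).2
          have h7 := (abs_le.1 (h2 m)).1
          linarith)
      have h2 := D.strip_relax hC2 hdb hε hε1 hψ hki (a := ψ k - ψ i + t) (σ := σ) (τ := τ) hσ hτp (by linarith) (by linarith) hτε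
      refine h1.trans ((add_le_add_left h2 _).trans ?_)
      rw [add_assoc, ← ENNReal.ofReal_add (by positivity) (by positivity)]
    have B1 := toR _ _ _ (by positivity) A1
    have B2 := toR _ _ _ (by positivity) A2
    rw [abs_le]
    constructor <;> linarith
  · have ea : (ψ + Pi.single l t : Fin N → ℝ) k - (ψ + Pi.single l t : Fin N → ℝ) i = ψ k - ψ i := by
      simp [hli.symm, hkl]
    rw [ea]
    set S2 := slab i k (ψ k - ψ i) σ ∩ slab i l (ψ l - ψ i) t with hS2
    have hE : C2 * σ * t / ε ^ 4 ≤ (1 + C1 + N * (C2 * (2 * C1)) + C2) * σ * t ^ D.α / ε ^ 5 := by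
      calc C2 * σ * t / ε ^ 4 ≤ C2 * σ * t ^ D.α / ε ^ 4 := by gcongr
        _ ≤ C2 * σ * t ^ D.α / ε ^ 5 := by
          rw [div_eq_mul_one_div, div_eq_mul_one_div _ (ε ^ 5)]; gcongr
        _ ≤ _ := by
          gcongr
          linarith [show 0 ≤ N * (C2 * (2 * C1)) by positivity]
    have m1 : strip i k ψ (ψ k - ψ i) σ 0 ⊆ strip i k (ψ + Pi.single l t) (ψ k - ψ i) σ 0 := by
      intro v hv
      refine ⟨hv.1, fun m hm => ?_⟩
      have := hv.2 m hm
      by_cases hml : m = l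
      · subst hml; simp [hli.symm]; linarith
      · simp [hli.symm, hml]; linarith
    have m2 : strip i k (ψ + Pi.single l t) (ψ k - ψ i) σ 0 ⊆ strip i k ψ (ψ k - ψ i) σ 0 ∪ S2 := by
      intro v hv
      have hv' : ∀ m, m ≠ k → m ≠ l → v i + ψ i ≤ v m + ψ m := fun m hm hml => by
        have := hv.2 m hm
        simpa [hli.symm, hml] using this
      have hvl : v i + ψ i ≤ v l + (ψ l + t) := by
        have := hv.2 l (Ne.symm hkl)
        simpa [hli.symm] using this
      by_cases hc : v i + ψ i ≤ v l + ψ l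
      · left
        refine ⟨hv.1, fun m hm => ?_⟩
        by_cases hml : m = l
        · subst hml; linarith
        · linarith [hv' m hm hml]
      · right
        exact ⟨hv.1, by linarith, by linarith⟩
    have hν2 : D.ν S2 ≤ ENNReal.ofReal (C2 * σ * t / ε ^ 4) := by
      refine hdb ε hε hε1 ψ hψ i k l hki hli hkl S2 ((slab_meas _ _ _ _).inter (slab_meas _ _ _ _)) _ _ σ t hσ ht
        inter_subset_left inter_subset_right ?_
      rintro v ⟨h1, h2⟩
      have := h1.1; have := h1.2; have := h2.1; have := h2.2
      have : 0 < D.cc / 4 * ε := by positivity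
      exact ⟨abs_le.2 ⟨by linarith, by linarith⟩, abs_le.2 ⟨by linarith, by linarith⟩⟩
    have B1 := toR _ _ _ (by positivity) ((measure_mono m2).trans ((measure_union_le _ _).trans (add_le_add_right hν2 _)))
    have B2 := ENNReal.toReal_mono (measure_ne_top _ _) (measure_mono (μ := D.ν) m1)
    rw [abs_le]
    constructor <;> linarith [show 0 ≤ C2 * σ * t / ε ^ 4 by positivity]

end CD

lemma tele (E : (Fin N → ℝ) → ℝ) (x s : Fin N → ℝ) {b : ℝ}
    (hE : ∀ y k, (∀ m, |y m - x m| ≤ |s m|) → |E (y + Pi.single k (s k)) - E y| ≤ b) :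
    |E (x + s) - E x| ≤ N * b := by
  have key : ∀ T : Finset (Fin N),
      |E (x + ∑ k ∈ T, Pi.single k (s k)) - E x| ≤ T.card * b := by
    intro T
    induction T using Finset.induction_on with
    | empty => simp
    | insert k T hk ih =>
      have h := hE (x + ∑ k ∈ T, Pi.single k (s k)) k (by
        intro m
        simp only [Pi.add_apply, Finset.sum_apply, Pi.single_apply, add_sub_cancel_left]
        rw [Finset.sum_ite_eq]
        split_ifs <;> simp)
      rw [Finset.sum_insert hk, Finset.card_insert_of_notMem hk]
      have e : x + (Pi.single k (s k) + ∑ k ∈ T, Pi.single k (s k)) =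
        x + ∑ k ∈ T, Pi.single k (s k) + Pi.single k (s k) := by abel
      rw [e]
      push_cast
      rw [abs_le] at *
      constructor <;> linarith
  have := key Finset.univ
  rw [Finset.univ_sum_single] at this
  simpa using this

namespace CD
variable (D : CD n N)

lemma cell_add (ψ : Fin N → ℝ) (a : ℝ) (i : Fin N) : cell (ψ + fun _ => a) i = cell ψ i := by
  ext v
  simp only [cell, mem_ofPred_eq, Pi.add_apply]
  constructor <;> intro h m <;> have := h m <;> linarith

lemma G_add (i : Fin N) (ψ : Fin N → ℝ) (a : ℝ) : D.G i (ψ + fun _ => a) = D.G i ψ := by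
  unfold G; rw [cell_add]

lemma G_sub (i : Fin N) (ψ s : Fin N → ℝ) : D.G i (ψ + s) = D.G i (ψ + (s - fun _ => s i)) := by
  rw [← D.G_add i (ψ + (s - fun _ => s i)) (s i)]
  congr 1
  ext m; simp only [Pi.add_apply, Pi.sub_apply]; ring

lemma red_norm (s : Fin N → ℝ) (i : Fin N) : ‖s - fun _ => s i‖ ≤ 2 * ‖s‖ := by
  rw [pi_norm_le_iff_of_nonneg (by positivity)]
  intro m
  have h1 := norm_le_pi_norm s m
  have h2 := norm_le_pi_norm s i
  calc ‖s m - s i‖ ≤ ‖s m‖ + ‖s i‖ := norm_sub_le _ _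
    _ ≤ _ := by linarith

/-- Lipschitz constant. -/
def Lam : ℝ := N * (D.L * D.S0 * 2)

lemma LS_pos : 0 < D.L * D.S0 := mul_pos (by linarith [D.hL]) (by linarith [D.S0_one])

lemma Lam_nonneg : 0 ≤ D.Lam := by have := D.LS_pos; unfold Lam; positivity

lemma G_step {i k : Fin N} (hki : k ≠ i) (ψ : Fin N → ℝ) (σ : ℝ) :
    |D.G i (ψ + Pi.single k σ) - D.G i ψ| ≤ D.L * D.S0 * |σ| := by
  have key : ∀ ψ : Fin N → ℝ, ∀ σ, 0 < σ → |D.G i (ψ + Pi.single k σ) - D.G i ψ| ≤ D.L * D.S0 * |σ| := by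
    intro ψ σ h
    rw [D.G_diff hki ψ h.le, abs_of_nonneg ENNReal.toReal_nonneg, abs_of_pos h]
    refine ENNReal.toReal_le_of_le_ofReal (by have := D.LS_pos; positivity) ?_
    exact D.ν_slab i k hki.symm h _ (strip_meas _ _ _ _ _ _) (fun v hv => hv.1)
  rcases lt_trichotomy σ 0 with h | h | h
  · have := key (ψ + Pi.single k σ) (-σ) (by linarith)
    rw [add_assoc, ← Pi.single_add, add_neg_cancel, Pi.single_zero, add_zero, abs_neg] at this
    rwa [abs_sub_comm]
  · subst h; simp
  · exact key ψ σ h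

lemma G_lip (i : Fin N) (ψ s : Fin N → ℝ) : |D.G i (ψ + s) - D.G i ψ| ≤ D.Lam * ‖s‖ := by
  rw [D.G_sub]
  have h := tele (D.G i) ψ (s - fun _ => s i) (b := D.L * D.S0 * (2 * ‖s‖)) (by
    intro y k _
    by_cases hk : k = i
    · subst hk
      have := D.LS_pos
      simp; positivity
    · refine (D.G_step hk _ _).trans ?_
      have := D.LS_pos
      gcongr
      exact (norm_le_pi_norm _ k).trans (red_norm s i))
  refine h.trans (le_of_eq ?_)
  unfold Lam; ring

lemma G_lip' (i : Fin N) (x y : Fin N → ℝ) : |D.G i x - D.G i y| ≤ D.Lam * ‖x - y‖ := by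
  have := D.G_lip i y (x - y)
  rwa [add_sub_cancel] at this

lemma big_iff {ε : ℝ} (hε : 0 ≤ ε) (ψ : Fin N → ℝ) : D.Big ε ψ ↔ ∀ i, ε < D.G i ψ := by
  unfold Big G
  refine forall_congr' fun i => ?_
  rw [ENNReal.ofReal_lt_iff_lt_toReal hε (measure_ne_top _ _)]

lemma big_near {ε : ℝ} (hε : 0 < ε) {ψ y : Fin N → ℝ} (hψ : D.Big ε ψ)
    (hy : D.Lam * ‖y - ψ‖ ≤ ε / 2) : D.Big (ε / 2) y := by
  rw [D.big_iff (by positivity)]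
  rw [D.big_iff hε.le] at hψ
  intro i
  have := hψ i
  have h2 := D.G_lip' i y ψ
  rw [abs_le] at h2
  linarith [h2.1]

lemma G_sum (hN : 1 ≤ N) (ψ : Fin N → ℝ) : ∑ i, D.G i ψ = 1 := by
  have hU : (⋃ i, cell ψ i) = univ := by
    rw [eq_univ_iff_forall]
    intro v
    have : Nonempty (Fin N) := ⟨⟨0, hN⟩⟩
    obtain ⟨j, hj⟩ := Finite.exists_min (fun m => v m + ψ m)
    exact mem_iUnion.2 ⟨j, hj⟩
  have hd : Pairwise (Function.onFun (AEDisjoint D.ν) (fun i => cell ψ i)) := by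
    intro i k hik
    show D.ν (cell ψ i ∩ cell ψ k) = 0
    have hle : ∀ σ : ℝ, 0 < σ → D.ν (cell ψ i ∩ cell ψ k) ≤ ENNReal.ofReal (D.L * D.S0 * σ) := by
      intro σ hσ
      refine D.ν_slab i k hik (a := ψ k - ψ i - σ) hσ _ ((cell_meas _ _).inter (cell_meas _ _)) ?_
      rintro v ⟨h1, h2⟩
      have := h1 k; have := h2 i
      exact ⟨by linarith, by linarith⟩
    have hp := D.LS_pos
    have ht : Tendsto (fun σ : ℝ => ENNReal.ofReal (D.L * D.S0 * σ)) (nhdsWithin 0 (Ioi 0)) (nhds 0) := by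
      have : Tendsto (fun σ : ℝ => ENNReal.ofReal (D.L * D.S0 * σ)) (nhds 0) (nhds 0) := by
        have hc : Continuous (fun σ : ℝ => ENNReal.ofReal (D.L * D.S0 * σ)) :=
          ENNReal.continuous_ofReal.comp (by fun_prop)
        simpa using hc.tendsto 0
      exact this.mono_left nhdsWithin_le_nhds
    exact le_antisymm (ge_of_tendsto ht (eventually_nhdsWithin_of_forall fun σ hσ => hle σ hσ)) bot_le
  have h := measure_iUnion₀ (μ := D.ν) hd (fun i => (cell_meas ψ i).nullMeasurableSet)
  rw [hU, measure_univ, tsum_fintype] at h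
  unfold G
  rw [← ENNReal.toReal_sum (fun _ _ => measure_ne_top _ _), ← h]
  simp

lemma diam_bound : ∃ M, 1 ≤ M ∧ ∀ ψ : Fin N → ℝ, (∀ i, 0 < D.G i ψ) → ∀ i j, ψ i - ψ j ≤ M := by
  have hb : ∀ j m, ∃ B, ∀ p ∈ D.K j, |D.F j m p| ≤ B := by
    intro j m
    obtain ⟨B, hB⟩ := (D.Kcomp j).exists_bound_of_continuousOn (D.Fcont j m)
    exact ⟨B, fun p hp => by simpa using hB p hp⟩
  choose B hB using hb
  refine ⟨1 + ∑ j, ∑ m, (|B j m| + |B j j|), ?_, ?_⟩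
  · have : 0 ≤ ∑ j, ∑ m, (|B j m| + |B j j|) := by positivity
    linarith
  intro ψ hψ i j
  have hne : D.ν (cell ψ i) ≠ 0 := by
    intro h0
    have := hψ i
    unfold G at this
    rw [h0] at this; simp at this
  rw [D.νeq i _ (cell_meas ψ i)] at hne
  have : ({p ∈ D.K i | (fun m => D.F i m p) ∈ cell ψ i}).Nonempty := by
    by_contra hc
    rw [not_nonempty_iff_eq_empty] at hc
    rw [hc] at hne; simp at hne
  obtain ⟨p, hp, hc⟩ := this
  have h1 := hc j
  simp only at h1
  have h2 := abs_le.1 (hB i j p hp)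
  have h3 := abs_le.1 (hB i i p hp)
  have h4 : |B i j| + |B i i| ≤ ∑ m, (|B i m| + |B i i|) :=
    Finset.single_le_sum (f := fun m => |B i m| + |B i i|) (fun m _ => by positivity) (Finset.mem_univ j)
  have h5 : ∑ m, (|B i m| + |B i i|) ≤ ∑ j, ∑ m, (|B j m| + |B j j|) :=
    Finset.single_le_sum (f := fun j => ∑ m, (|B j m| + |B j j|)) (fun m _ => by positivity) (Finset.mem_univ i)
  linarith [le_abs_self (B i j), le_abs_self (B i i)]

end CD

lemma single_norm (k : Fin N) (σ : ℝ) : ‖(Pi.single k σ : Fin N → ℝ)‖ = |σ| := by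
  rw [Pi.norm_single]; rfl

namespace CD
variable (D : CD n N)

lemma second_signed {H c ε : ℝ} {i : Fin N} (hε : 0 < ε)
    (hpos : ∀ ψ : Fin N → ℝ, D.Big ε ψ → ∀ k l : Fin N, k ≠ i → l ≠ i →
      ∀ σ t, 0 ≤ σ → 0 ≤ t → σ ≤ c → t ≤ c →
      |(D.G i (ψ + Pi.single l t + Pi.single k σ) - D.G i (ψ + Pi.single l t))
        - (D.G i (ψ + Pi.single k σ) - D.G i ψ)| ≤ H * σ * t ^ D.α / ε ^ 5)
    {ψ : Fin N → ℝ} (hψ : ∀ y, ‖y - ψ‖ ≤ 2 * c → D.Big ε y) {k l : Fin N} (hk : k ≠ i) (hl : l ≠ i)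
    {σ t : ℝ} (hσ : |σ| ≤ c) (ht : |t| ≤ c) :
    |(D.G i (ψ + Pi.single l t + Pi.single k σ) - D.G i (ψ + Pi.single l t))
        - (D.G i (ψ + Pi.single k σ) - D.G i ψ)| ≤ H * |σ| * |t| ^ D.α / ε ^ 5 := by
  have hc : 0 ≤ c := (abs_nonneg _).trans hσ
  rcases le_total 0 σ with h1 | h1 <;> rcases le_total 0 t with h2 | h2
  · rw [abs_of_nonneg h1] at *
    rw [abs_of_nonneg h2] at *
    exact hpos ψ (hψ ψ (by simp; exact hc)) k l hk hl σ t h1 h2 hσ ht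
  · rw [abs_of_nonneg h1] at *
    rw [abs_of_nonpos h2] at *
    have := hpos (ψ + Pi.single l t) (hψ _ (by
      rw [add_sub_cancel_left, single_norm, abs_of_nonpos h2]; linarith)) k l hk hl σ (-t) h1 (by linarith) hσ ht
    have e : ψ + Pi.single l t + Pi.single l (-t) = ψ := by
      rw [add_assoc, ← Pi.single_add]; simp
    rw [e, abs_sub_comm] at this
    exact this
  · rw [abs_of_nonpos h1] at *
    rw [abs_of_nonneg h2] at *
    have := hpos (ψ + Pi.single k σ) (hψ _ (by
      rw [add_sub_cancel_left, single_norm, abs_of_nonpos h1]; linarith)) k l hk hl (-σ) t (by linarith) h2 hσ ht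
    have e : ψ + Pi.single k σ + Pi.single l t + Pi.single k (-σ) = ψ + Pi.single l t := by
      rw [Pi.single_neg]; abel
    have e1 : ψ + Pi.single k σ + Pi.single k (-σ) = ψ := by
      rw [Pi.single_neg]; abel
    have e2 : ψ + Pi.single k σ + Pi.single l t = ψ + Pi.single l t + Pi.single k σ := by abel
    rw [e, e1, e2, abs_sub_comm] at this
    convert this using 2
    ring
  · rw [abs_of_nonpos h1] at *
    rw [abs_of_nonpos h2] at *
    have := hpos (ψ + Pi.single l t + Pi.single k σ) (hψ _ (by
      rw [add_assoc, add_sub_cancel_left]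
      refine (norm_add_le _ _).trans ?_
      rw [single_norm, single_norm, abs_of_nonpos h1, abs_of_nonpos h2]
      linarith)) k l hk hl (-σ) (-t) (by linarith) (by linarith) hσ ht
    have e : ψ + Pi.single l t + Pi.single k σ + Pi.single l (-t) + Pi.single k (-σ) = ψ := by
      rw [Pi.single_neg, Pi.single_neg]; abel
    have e1 : ψ + Pi.single l t + Pi.single k σ + Pi.single k (-σ) = ψ + Pi.single l t := by
      rw [Pi.single_neg]; abel
    have e2 : ψ + Pi.single l t + Pi.single k σ + Pi.single l (-t) = ψ + Pi.single k σ := by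
      rw [Pi.single_neg]; abel
    rw [e, e1, e2] at this
    convert this using 2
    ring

lemma norm_of_le {x y s : Fin N → ℝ} (h : ∀ m, |y m - x m| ≤ |s m|) : ‖y - x‖ ≤ ‖s‖ := by
  rw [pi_norm_le_iff_of_nonneg (norm_nonneg _)]
  exact fun m => (h m).trans (norm_le_pi_norm s m)

lemma second_vec {H c ε : ℝ} {i : Fin N} (hε : 0 < ε) (hH : 0 ≤ H)
    (hpos : ∀ ψ : Fin N → ℝ, D.Big ε ψ → ∀ k l : Fin N, k ≠ i → l ≠ i →
      ∀ σ t, 0 ≤ σ → 0 ≤ t → σ ≤ c → t ≤ c →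
      |(D.G i (ψ + Pi.single l t + Pi.single k σ) - D.G i (ψ + Pi.single l t))
        - (D.G i (ψ + Pi.single k σ) - D.G i ψ)| ≤ H * σ * t ^ D.α / ε ^ 5)
    {ψ : Fin N → ℝ} (hψ : ∀ y, ‖y - ψ‖ ≤ 4 * c → D.Big ε y) {s t : Fin N → ℝ}
    (hs : 2 * ‖s‖ ≤ c) (ht : 2 * ‖t‖ ≤ c) :
    |(D.G i (ψ + t + s) - D.G i (ψ + t)) - (D.G i (ψ + s) - D.G i ψ)|
      ≤ N * (N * (H * (2 * ‖s‖) * (2 * ‖t‖) ^ D.α / ε ^ 5)) := by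
  have hα := D.hα
  set s' := s - fun _ => s i with hs'
  set t' := t - fun _ => t i with ht'
  have hsn : ‖s'‖ ≤ 2 * ‖s‖ := red_norm s i
  have htn : ‖t'‖ ≤ 2 * ‖t‖ := red_norm t i
  have e1 : D.G i (ψ + t + s) = D.G i (ψ + t' + s') := by
    rw [D.G_sub, ← hs', add_right_comm, D.G_sub, ← ht', add_right_comm]
  rw [e1, D.G_sub i ψ t, D.G_sub i ψ s, ← hs', ← ht']
  have hB : 0 ≤ H * (2 * ‖s‖) * (2 * ‖t‖) ^ D.α / ε ^ 5 := by positivity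
  -- telescope in t
  have h1 := tele (fun y => D.G i (y + s') - D.G i y) ψ t' (b := N * (H * (2 * ‖s‖) * (2 * ‖t‖) ^ D.α / ε ^ 5)) (by
    intro y l hy
    have hy' := norm_of_le hy
    by_cases hl : l = i
    · subst hl
      have : t' l = 0 := by simp [ht']
      rw [this]; simp; positivity
    have h2 := tele (fun z => D.G i (z + Pi.single l (t' l)) - D.G i z) y s'
      (b := H * (2 * ‖s‖) * (2 * ‖t‖) ^ D.α / ε ^ 5) (by
      intro z k hz
      have hz' := norm_of_le hz
      by_cases hk : k = i
      · subst hk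
        have : s' k = 0 := by simp [hs']
        rw [this]; simpa using hB
      have hsk : |s' k| ≤ 2 * ‖s‖ := (norm_le_pi_norm s' k).trans hsn
      have htl : |t' l| ≤ 2 * ‖t‖ := (norm_le_pi_norm t' l).trans htn
      have h3 := D.second_signed hε hpos (ψ := z) (fun w hw => hψ w (by
        have : w - ψ = (w - z) + (z - y) + (y - ψ) := by abel
        rw [this]
        refine (norm_add₃_le).trans ?_
        linarith)) hk hl (σ := s' k) (t := t' l) (by linarith) (by linarith)
      have e : z + Pi.single k (s' k) + Pi.single l (t' l) = z + Pi.single l (t' l) + Pi.single k (s' k) := by abel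
      simp only [e]
      calc _ = _ := by congr 1; ring
        _ ≤ _ := h3
        _ ≤ _ := by gcongr)
    calc _ = _ := by congr 1; rw [add_right_comm]; ring
        _ ≤ _ := h2)
  exact h1

lemma second_final : ∃ H, 1 ≤ H ∧ ∃ c, 0 < c ∧ c ≤ 1 ∧ ∀ ε, 0 < ε → ε ≤ 1 → ∀ ψ : Fin N → ℝ, D.Big ε ψ →
    ∀ x, ‖x - ψ‖ ≤ c * ε ^ 2 → ∀ i s t, ‖s‖ ≤ c * ε ^ 2 → ‖t‖ ≤ c * ε ^ 2 →
    |(D.G i (x + t + s) - D.G i (x + t)) - (D.G i (x + s) - D.G i x)| ≤ H / ε ^ 5 * ‖s‖ * ‖t‖ ^ D.α := by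
  obtain ⟨H, hH, c, hc, hc1, h⟩ := D.second_diff
  have hl := D.Lam_nonneg
  set c' := c / (40 * (1 + D.Lam)) with hc'
  have hc'0 : 0 < c' := by positivity
  have hc'c : c' * (40 * (1 + D.Lam)) = c := by rw [hc']; field_simp
  have hc'l : c' * 40 ≤ c := by nlinarith
  have hcl : D.Lam * c' * 40 ≤ c := by nlinarith
  set H' := (1 + N * N * 2 * 2 * 32) * H with hH'
  refine ⟨H', ?_, c', hc'0, ?_, ?_⟩
  · have : (0:ℝ) ≤ N * N * 2 * 2 * 32 := by positivity
    nlinarith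
  · linarith
  intro ε hε hε1 ψ hψ x hx i s t hs ht
  have h2 := fun y (hy : ‖y - ψ‖ ≤ 20 * (c' * ε ^ 2)) => D.big_near (y := y) hε hψ (by
    calc D.Lam * ‖y - ψ‖ ≤ D.Lam * (20 * (c' * ε ^ 2)) := by gcongr
      _ = D.Lam * c' * 40 * ε ^ 2 / 2 := by ring
      _ ≤ 1 * ε / 2 := by
        have : D.Lam * c' * 40 * ε ^ 2 ≤ 1 * ε := by
          have : D.Lam * c' * 40 ≤ 1 := by linarith
          have h4 : ε ^ 2 ≤ ε := by nlinarith
          gcongr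
        linarith
      _ = ε / 2 := by ring)
  have h3 := D.second_vec (H := H) (c := 4 * (c' * ε ^ 2)) (ε := ε / 2) (i := i) (by positivity) (by linarith)
    (fun y hy k l hk hl σ t h0 h1 h5 h6 => h (ε / 2) (by positivity) (by linarith) y hy i k l hk hl σ t h0 h1
      (by nlinarith [sq_nonneg ε]) (by nlinarith [sq_nonneg ε])) (ψ := x) (fun y hy => h2 y (by
        have : y - ψ = (y - x) + (x - ψ) := by abel
        rw [this]
        refine (norm_add_le _ _).trans ?_
        have : 0 ≤ c' * ε ^ 2 := by positivity
        linarith)) (s := s) (t := t) (by nlinarith [sq_nonneg ε]) (by nlinarith [sq_nonneg ε])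
  refine h3.trans ?_
  have h7 : (2 * ‖t‖) ^ D.α ≤ 2 * ‖t‖ ^ D.α := by
    rw [Real.mul_rpow (by norm_num) (norm_nonneg _)]
    gcongr
    calc (2:ℝ) ^ D.α ≤ 2 ^ (1:ℝ) := Real.rpow_le_rpow_of_exponent_le (by norm_num) D.hα1
      _ = 2 := by simp
  calc (N:ℝ) * (N * (H * (2 * ‖s‖) * (2 * ‖t‖) ^ D.α / (ε / 2) ^ 5))
      ≤ N * (N * (H * (2 * ‖s‖) * (2 * ‖t‖ ^ D.α) / (ε / 2) ^ 5)) := by gcongr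
    _ = (N * N * 2 * 2 * 32) * H / ε ^ 5 * ‖s‖ * ‖t‖ ^ D.α := by field_simp; ring
    _ ≤ _ := by
      gcongr
      rw [hH']
      nlinarith

end CD

/-- Differentiability from second differences. -/
lemma diff_of_second {f : (Fin N → ℝ) → ℝ} {Λ H α η : ℝ} (hΛ : 0 ≤ Λ) (hH : 0 ≤ H) (hα : 0 < α)
    (hη : 0 < η)
    (hl : ∀ x y, |f x - f y| ≤ Λ * ‖x - y‖) {ψ : Fin N → ℝ}
    (h2 : ∀ x, ‖x - ψ‖ ≤ η → ∀ s t, ‖s‖ ≤ η → ‖t‖ ≤ η →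
      |(f (x + t + s) - f (x + t)) - (f (x + s) - f x)| ≤ H * ‖s‖ * ‖t‖ ^ α) :
    DifferentiableAt ℝ f ψ := by
  have hL : LipschitzWith Λ.toNNReal f := LipschitzWith.of_dist_le' (fun x y => by
    rw [Real.dist_eq, dist_eq_norm]; exact hl x y)
  -- at differentiability points
  have hdiff : ∀ x, ‖x - ψ‖ ≤ η → DifferentiableAt ℝ f x → ∀ s, ‖s‖ ≤ η →
      |f (x + s) - f x - fderiv ℝ f x s| ≤ H * ‖s‖ * ‖s‖ ^ α := by
    intro x hx hd s hs
    have hm : ∀ m : ℕ, |f (x + s) - f x - ((m:ℝ) + 1) * (f (x + ((m:ℝ) + 1)⁻¹ • s) - f x)| ≤ H * ‖s‖ * ‖s‖ ^ α := by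
      intro m
      set u := ((m:ℝ) + 1)⁻¹ • s with hu
      have hm1 : (0:ℝ) < (m:ℝ) + 1 := by positivity
      have hun : ‖u‖ = ‖s‖ / (m + 1) := by
        rw [hu, norm_smul, norm_inv, Real.norm_of_nonneg hm1.le]; field_simp
      have hus : ‖u‖ ≤ ‖s‖ := by
        rw [hun]; exact div_le_self (norm_nonneg _) (by linarith [Nat.cast_nonneg (α := ℝ) m])
      have key : ∀ j : ℕ, j ≤ m + 1 → |f (x + (j:ℝ) • u) - f x - j * (f (x + u) - f x)| ≤ j * (H * ‖u‖ * ‖s‖ ^ α) := by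
        intro j
        induction j with
        | zero => simp
        | succ j ih =>
          intro hj
          have ih := ih (by omega)
          have hjs : ‖(j:ℝ) • u‖ ≤ ‖s‖ := by
            rw [norm_smul, hun, Real.norm_of_nonneg (Nat.cast_nonneg _)]
            have : (j:ℝ) ≤ m + 1 := by exact_mod_cast (by omega : j ≤ m + 1)
            rw [mul_div_assoc', div_le_iff₀ hm1]
            nlinarith [norm_nonneg s]
          have h3 := h2 x hx u ((j:ℝ) • u) (by linarith) (by linarith)
          have h4 : H * ‖u‖ * ‖(j:ℝ) • u‖ ^ α ≤ H * ‖u‖ * ‖s‖ ^ α := by gcongr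
          have e : x + ((j + 1 : ℕ) : ℝ) • u = x + (j:ℝ) • u + u := by
            push_cast; rw [add_smul, one_smul, add_assoc]
          rw [e]
          push_cast
          have h3 := h3.trans h4
          rw [abs_le] at *
          constructor <;> linarith
      have := key (m + 1) le_rfl
      have e : ((m + 1 : ℕ) : ℝ) • u = s := by
        rw [hu, smul_smul]; push_cast; rw [mul_inv_cancel₀ hm1.ne', one_smul]
      rw [e] at this
      push_cast at this
      calc _ ≤ _ := this
        _ = _ := by rw [hun]; field_simp
    have ht : Tendsto (fun m : ℕ => ((m:ℝ) + 1) * (f (x + ((m:ℝ) + 1)⁻¹ • s) - f x)) atTop (nhds (fderiv ℝ f x s)) := by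
      have := hd.hasFDerivAt.lim s (c := fun m : ℕ => (m:ℝ) + 1) (l := atTop)
        (tendsto_norm_atTop_atTop.comp (tendsto_atTop_add_const_right _ _ tendsto_natCast_atTop_atTop))
      simpa using this
    have := (tendsto_const_nhds (x := f (x + s) - f x)).sub ht
    exact le_of_tendsto this.abs (Eventually.of_forall hm)
  -- approximate ψ
  have hdense : Dense {x | DifferentiableAt ℝ f x} := by
    have hae : ∀ᵐ x, DifferentiableAt ℝ f x := hL.ae_differentiableAt
    exact Measure.dense_of_ae hae
  obtain ⟨u, hu, hut⟩ := mem_closure_iff_seq_limit.1 (hdense ψ)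
  have hbd : ∀ j, fderiv ℝ f (u j) ∈ closedBall (0 : (Fin N → ℝ) →L[ℝ] ℝ) Λ := by
    intro j
    rw [mem_closedBall_zero_iff]
    have := norm_fderiv_le_of_lipschitz ℝ hL (x₀ := u j)
    rwa [Real.coe_toNNReal _ hΛ] at this
  obtain ⟨A, _, φ, hφ, hA⟩ := (isCompact_closedBall (0 : (Fin N → ℝ) →L[ℝ] ℝ) Λ).tendsto_subseq hbd
  have hut' := hut.comp hφ.tendsto_atTop
  have hev : ∀ᶠ j in atTop, ‖u (φ j) - ψ‖ ≤ η := by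
    have : ∀ᶠ y in nhds ψ, y ∈ closedBall ψ η := closedBall_mem_nhds ψ hη
    filter_upwards [hut'.eventually this] with j hj
    rwa [mem_closedBall, dist_eq_norm] at hj
  have hfin : ∀ s, ‖s‖ ≤ η → |f (ψ + s) - f ψ - A s| ≤ H * ‖s‖ * ‖s‖ ^ α := by
    intro s hs
    have hc := hL.continuous
    have ht : Tendsto (fun j => f (u (φ j) + s) - f (u (φ j)) - fderiv ℝ f (u (φ j)) s) atTop
        (nhds (f (ψ + s) - f ψ - A s)) := by
      refine Tendsto.sub (Tendsto.sub ?_ ?_) ?_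
      · exact (hc.tendsto _).comp (hut'.add_const s)
      · exact (hc.tendsto _).comp hut'
      · exact ((ContinuousLinearMap.apply ℝ ℝ s).continuous.tendsto A).comp hA
    refine le_of_tendsto ht.abs ?_
    filter_upwards [hev] with j hj
    exact hdiff _ hj (hu _) s hs
  have : HasFDerivAt f A ψ := by
    rw [hasFDerivAt_iff_isLittleO_nhds_zero, Asymptotics.isLittleO_iff]
    intro ε hε
    have ht : Tendsto (fun s : Fin N → ℝ => H * ‖s‖ ^ α) (nhds 0) (nhds 0) := by
      have : Continuous (fun s : Fin N → ℝ => H * ‖s‖ ^ α) :=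
        continuous_const.mul (continuous_norm.rpow_const (fun _ => Or.inr hα.le))
      simpa [Real.zero_rpow hα.ne'] using this.tendsto 0
    filter_upwards [ht.eventually (gt_mem_nhds hε), closedBall_mem_nhds (0 : Fin N → ℝ) hη] with s h1 h3
    rw [mem_closedBall_zero_iff] at h3
    rw [Real.norm_eq_abs]
    refine (hfin s h3).trans ?_
    nlinarith [norm_nonneg s]
  exact this.differentiableAt

lemma hol_of_second {f : (Fin N → ℝ) → ℝ} {H α η : ℝ} (hH : 0 ≤ H) (hη : 0 < η) {ψ t : Fin N → ℝ}
    (hd : DifferentiableAt ℝ f ψ) (hd' : DifferentiableAt ℝ f (ψ + t))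
    (h2 : ∀ s, ‖s‖ ≤ η →
      |(f (ψ + t + s) - f (ψ + t)) - (f (ψ + s) - f ψ)| ≤ H * ‖s‖ * ‖t‖ ^ α) :
    ‖fderiv ℝ f (ψ + t) - fderiv ℝ f ψ‖ ≤ H * ‖t‖ ^ α := by
  have hf : HasFDerivAt (fun s => f (ψ + t + s) - f (ψ + s)) (fderiv ℝ f (ψ + t) - fderiv ℝ f ψ) 0 := by
    apply HasFDerivAt.sub
    · exact (hasFDerivAt_comp_add_left (ψ + t)).2 (by simpa using hd'.hasFDerivAt)
    · exact (hasFDerivAt_comp_add_left ψ).2 (by simpa using hd.hasFDerivAt)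
  refine hf.le_of_lip' (by positivity) ?_
  filter_upwards [closedBall_mem_nhds (0 : Fin N → ℝ) hη] with s hs
  rw [mem_closedBall_zero_iff] at hs
  have := h2 s hs
  simp only [add_zero, sub_zero]
  rw [Real.norm_eq_abs]
  calc _ = _ := by congr 1; ring
    _ ≤ _ := this
    _ = _ := by ring

namespace CD
variable (D : CD n N)

lemma G_C1 : ∃ H, 1 ≤ H ∧ ∀ ε, 0 < ε → ε ≤ 1 →
    (∀ ψ : Fin N → ℝ, D.Big ε ψ → ∀ i, DifferentiableAt ℝ (D.G i) ψ) ∧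
    ∀ ψ φ : Fin N → ℝ, D.Big ε ψ → D.Big ε φ → ∀ i,
      ‖fderiv ℝ (D.G i) ψ - fderiv ℝ (D.G i) φ‖ ≤ H / ε ^ 5 * ‖ψ - φ‖ ^ D.α := by
  obtain ⟨H, hH, c, hc, hc1, h⟩ := D.second_final
  have hl := D.Lam_nonneg
  have hα := D.hα
  refine ⟨H + 2 * D.Lam / c, by have : 0 ≤ 2 * D.Lam / c := by positivity
                                linarith, ?_⟩
  intro ε hε hε1
  have hcε : 0 < c * ε ^ 2 := by positivity
  have hd : ∀ ψ : Fin N → ℝ, D.Big ε ψ → ∀ i, DifferentiableAt ℝ (D.G i) ψ := by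
    intro ψ hψ i
    exact diff_of_second hl (H := H / ε ^ 5) (by positivity) hα hcε (D.G_lip' i)
      (fun x hx s t hs ht => h ε hε hε1 ψ hψ x hx i s t hs ht)
  refine ⟨hd, ?_⟩
  intro ψ φ hψ hφ i
  by_cases hn : ‖ψ - φ‖ ≤ c * ε ^ 2
  · have e : ψ = φ + (ψ - φ) := by abel
    have := hol_of_second (α := D.α) (f := D.G i) (H := H / ε ^ 5) (by positivity) hcε (ψ := φ) (t := ψ - φ) (hd φ hφ i)
      (by rw [← e]; exact hd ψ hψ i)
      (fun s hs => h ε hε hε1 φ hφ φ (by simpa using hcε.le) i s (ψ - φ) hs hn)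
    rw [← e] at this
    refine this.trans ?_
    have : 0 ≤ 2 * D.Lam / c := by positivity
    gcongr
    linarith
  · push Not at hn
    have hL : LipschitzWith D.Lam.toNNReal (D.G i) := LipschitzWith.of_dist_le' (fun x y => by
      rw [Real.dist_eq, dist_eq_norm]; exact D.G_lip' i x y)
    have hb : ∀ x, ‖fderiv ℝ (D.G i) x‖ ≤ D.Lam := fun x => by
      have := norm_fderiv_le_of_lipschitz ℝ hL (x₀ := x)
      rwa [Real.coe_toNNReal _ hl] at this
    have h1 : c * ε ^ 2 ≤ ‖ψ - φ‖ ^ D.α := by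
      have h2 : c * ε ^ 2 ≤ 1 := by nlinarith
      calc c * ε ^ 2 = (c * ε ^ 2) ^ (1:ℝ) := by simp
        _ ≤ (c * ε ^ 2) ^ D.α := Real.rpow_le_rpow_of_exponent_ge hcε h2 D.hα1
        _ ≤ _ := by gcongr
    calc ‖fderiv ℝ (D.G i) ψ - fderiv ℝ (D.G i) φ‖ ≤ ‖fderiv ℝ (D.G i) ψ‖ + ‖fderiv ℝ (D.G i) φ‖ := norm_sub_le _ _
      _ ≤ 2 * D.Lam := by linarith [hb ψ, hb φ]
      _ = 2 * D.Lam / c / ε ^ 2 * (c * ε ^ 2) := by field_simp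
      _ ≤ 2 * D.Lam / c / ε ^ 5 * ‖ψ - φ‖ ^ D.α := by
        have h9 : ε ^ 5 ≤ ε ^ 2 := pow_le_pow_of_le_one hε.le hε1 (by norm_num)
        gcongr
      _ ≤ _ := by
        gcongr
        linarith

lemma G_fderiv_le (i : Fin N) (x : Fin N → ℝ) : ‖fderiv ℝ (D.G i) x‖ ≤ D.Lam := by
  have hl := D.Lam_nonneg
  have hL : LipschitzWith D.Lam.toNNReal (D.G i) := LipschitzWith.of_dist_le' (fun x y => by
      rw [Real.dist_eq, dist_eq_norm]; exact D.G_lip' i x y)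
  have := norm_fderiv_le_of_lipschitz ℝ hL (x₀ := x)
  rwa [Real.coe_toNNReal _ hl] at this

end CD

/-- `√(1+u²)`. -/
def sf (u : ℝ) : ℝ := Real.sqrt (1 + u ^ 2)
/-- `√(1+u²) - u`. -/
def qf (u : ℝ) : ℝ := sf u - u
/-- derivative of `gfun`. -/
def gd (u : ℝ) : ℝ := -2 * qf u ^ 2 / sf u

lemma sf_sq (u : ℝ) : sf u ^ 2 = 1 + u ^ 2 := Real.sq_sqrt (by positivity)
lemma sf_nonneg (u : ℝ) : 0 ≤ sf u := Real.sqrt_nonneg _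
lemma sf_one (u : ℝ) : 1 ≤ sf u := by nlinarith [sf_sq u, sf_nonneg u, sq_nonneg u]
lemma sf_abs (u : ℝ) : |u| ≤ sf u := by
  apply abs_le_of_sq_le_sq _ (sf_nonneg u)
  rw [sf_sq]; linarith
lemma sf_le (u : ℝ) : sf u ≤ 1 + |u| := by
  apply le_of_sq_le_sq _ (by positivity)
  rw [sf_sq]; nlinarith [sq_abs u, abs_nonneg u]
lemma qf_mul (u : ℝ) : qf u * (sf u + u) = 1 := by unfold qf; nlinarith [sf_sq u]
lemma qf_pos (u : ℝ) : 0 < qf u := by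
  have h := qf_mul u
  have h1 := sf_abs u
  have h2 := abs_le.1 h1
  have h3 : 0 ≤ sf u + u := by linarith
  by_contra hc
  push Not at hc
  nlinarith
lemma qf_le (u : ℝ) : qf u ≤ 2 * sf u := by
  have := abs_le.1 (sf_abs u); unfold qf; linarith
lemma gfun_eq (u : ℝ) : gfun u = 1 + qf u ^ 2 := by
  unfold gfun qf; have := sf_sq u; change 2 * (1 + u ^ 2 - u * sf u) = _; nlinarith
lemma gd_neg (u : ℝ) : gd u < 0 := by
  unfold gd
  have := qf_pos u; have := sf_one u
  rw [neg_mul, neg_div, neg_neg_iff_pos]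
  positivity
lemma gd_le (u : ℝ) : -gd u ≤ 4 * qf u := by
  unfold gd
  have := qf_pos u; have h := sf_one u; have := qf_le u
  rw [neg_mul, neg_div, neg_neg, div_le_iff₀ (by linarith)]
  nlinarith
lemma sf_deriv (u : ℝ) : HasDerivAt sf (u / sf u) u := by
  have h1 : HasDerivAt (fun u : ℝ => 1 + u ^ 2) (2 * u) u := by
    simpa using (hasDerivAt_pow 2 u).const_add 1
  have := h1.sqrt (by positivity)
  refine HasDerivAt.congr_deriv (f := sf) this ?_
  unfold sf
  rw [mul_div_mul_left _ _ two_ne_zero]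
lemma qf_deriv (u : ℝ) : HasDerivAt qf (-qf u / sf u) u := by
  have := (sf_deriv u).sub (hasDerivAt_id u)
  refine HasDerivAt.congr_deriv (f := qf) this ?_
  have := sf_one u
  unfold qf; field_simp; ring
lemma gfun_deriv (u : ℝ) : HasDerivAt gfun (gd u) u := by
  have := ((qf_deriv u).pow 2).const_add 1
  have e : gfun = fun u => 1 + (qf ^ 2) u := by ext u; simp [gfun_eq]
  rw [e]
  refine this.congr_deriv ?_
  unfold gd; simp; ring
lemma gd_deriv (u : ℝ) : HasDerivAt gd (2 * qf u ^ 2 * (2 * sf u + u) / sf u ^ 3) u := by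
  have h0 := sf_one u
  have := (((qf_deriv u).pow 2).const_mul (-2)).div (sf_deriv u) (by linarith)
  refine HasDerivAt.congr_deriv (f := gd) this ?_
  simp
  field_simp
lemma gd_mono : Monotone gd := by
  apply monotone_of_deriv_nonneg (fun u => (gd_deriv u).differentiableAt)
  intro u
  rw [(gd_deriv u).deriv]
  have := sf_one u
  have := abs_le.1 (sf_abs u)
  have : 0 ≤ 2 * sf u + u := by linarith
  positivity
lemma gd_lip (u v : ℝ) : |gd u - gd v| ≤ 24 * |u - v| := by
  have := Convex.norm_image_sub_le_of_norm_hasDerivWithin_le (f := gd) (s := univ) (C := 24) (x := v) (y := u)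
    (fun x _ => (gd_deriv x).hasDerivWithinAt) ?_ convex_univ (mem_univ _) (mem_univ _)
  · simpa using this
  · intro x _
    have h1 := sf_one x
    have h2 := abs_le.1 (sf_abs x)
    have h3 := qf_le x
    have h4 := qf_pos x
    rw [Real.norm_of_nonneg (by have : 0 ≤ 2 * sf x + x := by linarith
                                positivity), div_le_iff₀ (by positivity)]
    calc 2 * qf x ^ 2 * (2 * sf x + x) ≤ 2 * (2 * sf x) ^ 2 * (2 * sf x + sf x) := by gcongr <;> linarith
      _ = _ := by ring
lemma gfun_mv (u v : ℝ) : ∃ ξ ∈ uIcc u v, gfun v - gfun u = gd ξ * (v - u) := by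
  rcases lt_trichotomy u v with h | h | h
  · obtain ⟨ξ, hξ, e⟩ := exists_hasDerivAt_eq_slope gfun gd h
      (fun x _ => (gfun_deriv x).continuousAt.continuousWithinAt) (fun x _ => gfun_deriv x)
    refine ⟨ξ, by rw [uIcc_of_le h.le]; exact Ioo_subset_Icc_self hξ, ?_⟩
    rw [e]; field_simp [sub_ne_zero.2 h.ne']
  · subst h; exact ⟨u, by simp, by simp⟩
  · obtain ⟨ξ, hξ, e⟩ := exists_hasDerivAt_eq_slope gfun gd h
      (fun x _ => (gfun_deriv x).continuousAt.continuousWithinAt) (fun x _ => gfun_deriv x)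
    refine ⟨ξ, by rw [uIcc_of_ge h.le]; exact Ioo_subset_Icc_self hξ, ?_⟩
    rw [e]
    have : u - v ≠ 0 := sub_ne_zero.2 h.ne'
    field_simp
    ring
lemma gfun_tangent (u v : ℝ) : gfun u + gd u * (v - u) ≤ gfun v := by
  obtain ⟨ξ, hξ, e⟩ := gfun_mv u v
  rcases le_total u v with h | h
  · rw [uIcc_of_le h] at hξ
    have := gd_mono hξ.1
    nlinarith
  · rw [uIcc_of_ge h] at hξ
    have := gd_mono hξ.2
    nlinarith
lemma gfun_anti : StrictAnti gfun :=
  strictAnti_of_deriv_neg (fun u => by rw [(gfun_deriv u).deriv]; exact gd_neg u)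
lemma gfun_cont : Continuous gfun :=
  continuous_iff_continuousAt.2 fun u => (gfun_deriv u).continuousAt
/-- Lipschitz bound in terms of endpoint slopes. -/
lemma gfun_lip {u v B : ℝ} (hu : -gd u ≤ B) (hv : -gd v ≤ B) : |gfun u - gfun v| ≤ B * |u - v| := by
  have h1 := gfun_tangent u v
  have h2 := gfun_tangent v u
  have hu' := gd_neg u
  have hv' := gd_neg v
  have e : |gd u| ≤ B := by rw [abs_of_neg hu']; exact hu
  have e' : |gd v| ≤ B := by rw [abs_of_neg hv']; exact hv
  have k1 : |gd u * (v - u)| ≤ B * |u - v| := by rw [abs_mul, abs_sub_comm v u]; gcongr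
  have k2 : |gd v * (u - v)| ≤ B * |u - v| := by rw [abs_mul]; gcongr
  rw [abs_le] at *
  constructor <;> linarith
/-- `q` at negative-bounded arguments. -/
lemma qf_ub {u b : ℝ} (hb : 0 ≤ b) (h : -b ≤ u) : qf u ≤ 1 + 2 * b := by
  rcases le_total 0 u with h0 | h0
  · have := sf_le u; rw [abs_of_nonneg h0] at this; unfold qf; linarith
  · have := sf_le u; rw [abs_of_nonpos h0] at this; unfold qf; linarith
lemma qf_lb (u : ℝ) : -u ≤ qf u := by unfold qf; linarith [sf_one u]
lemma qf_large {u : ℝ} (hu : 0 < u) : qf u * (2 * u) ≤ 1 := by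
  have := qf_mul u
  have h := abs_le.1 (sf_abs u)
  nlinarith [qf_pos u]

namespace CD
variable (D : CD n N)

/-- The function whose level set defines `r`. -/
def HH (h ε : ℝ) (ψ : Fin N → ℝ) (s : ℝ) : ℝ := ∑ i, (D.G i ψ - ε) * gfun ((ψ i - s) / h)

/-- The `s`-derivative of `HH`. -/
def DD (h ε : ℝ) (ψ : Fin N → ℝ) (s : ℝ) : ℝ := ∑ i, (D.G i ψ - ε) * (-gd ((ψ i - s) / h)) / h

lemma a_sum (hN : 1 ≤ N) (ε : ℝ) (ψ : Fin N → ℝ) : ∑ i, (D.G i ψ - ε) = 1 - N * ε := by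
  rw [Finset.sum_sub_distrib, D.G_sum hN]; simp

lemma HH_eq (hN : 1 ≤ N) (h ε : ℝ) (ψ : Fin N → ℝ) (s : ℝ) :
    D.HH h ε ψ s = 1 - N * ε + ∑ i, (D.G i ψ - ε) * qf ((ψ i - s) / h) ^ 2 := by
  unfold HH
  rw [← D.a_sum hN, ← Finset.sum_add_distrib]
  refine Finset.sum_congr rfl fun i _ => ?_
  rw [gfun_eq]; ring

lemma HH_mono {h ε : ℝ} (hh : 0 < h) (hN : 1 ≤ N) {ψ : Fin N → ℝ} (hψ : ∀ i, ε < D.G i ψ) :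
    StrictMono (D.HH h ε ψ) := by
  intro s t hst
  unfold HH
  have : (Finset.univ : Finset (Fin N)).Nonempty := ⟨⟨0, hN⟩, Finset.mem_univ _⟩
  refine Finset.sum_lt_sum_of_nonempty this fun i _ => ?_
  have := hψ i
  refine mul_lt_mul_of_pos_left (gfun_anti ?_) (by linarith)
  gcongr

lemma HH_exists {h ε W : ℝ} (hh : 0 < h) (hN : 1 ≤ N) (hε : 0 < ε) (hεN : ε * (2 * N) < 1)
    (hW1 : 1 ≤ W) (hWN : W ≤ N) {ψ : Fin N → ℝ} (hψ : ∀ i, ε < D.G i ψ) : ∃ s, D.HH h ε ψ s = W := by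
  have hN' : (1:ℝ) ≤ N := by exact_mod_cast hN
  have hcont : Continuous (D.HH h ε ψ) := by
    unfold HH
    refine continuous_finsetSum _ fun i _ => continuous_const.mul (gfun_cont.comp ?_)
    fun_prop
  have hi : ∀ i, |ψ i| ≤ ‖ψ‖ := fun i => norm_le_pi_norm ψ i
  have h1 : D.HH h ε ψ (-‖ψ‖ - h / ε) ≤ W := by
    rw [D.HH_eq hN]
    have : ∑ i, (D.G i ψ - ε) * qf ((ψ i - (-‖ψ‖ - h / ε)) / h) ^ 2 ≤ ∑ i, (D.G i ψ - ε) * ε := by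
      refine Finset.sum_le_sum fun i _ => ?_
      have := hψ i
      have hu : 1 / ε ≤ (ψ i - (-‖ψ‖ - h / ε)) / h := by
        rw [le_div_iff₀ hh]
        have := (abs_le.1 (hi i)).1
        have e : 1 / ε * h = h / ε := by ring
        rw [e]; linarith
      set u := (ψ i - (-‖ψ‖ - h / ε)) / h
      have hu0 : 0 < u := lt_of_lt_of_le (by positivity) hu
      have hq := qf_large hu0
      have hqp := qf_pos u
      have hq2 : qf u * 2 ≤ ε := by
        have : qf u * (2 * (1 / ε)) ≤ 1 := le_trans (by gcongr) hq
        have e : qf u * 2 = qf u * (2 * (1 / ε)) * ε := by field_simp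
        rw [e]; nlinarith
      have hε1 : ε ≤ 1 := by nlinarith
      have : qf u ^ 2 ≤ ε := by nlinarith
      gcongr
    rw [← Finset.sum_mul, D.a_sum hN] at this
    have k1 : (1 - N * ε) * ε ≤ 1 * ε := by
      gcongr
      have : 0 ≤ N * ε := by positivity
      linarith
    have k2 : 1 * ε ≤ N * ε := by gcongr
    linarith
  have h2 : W ≤ D.HH h ε ψ (‖ψ‖ + 2 * N * h) := by
    rw [D.HH_eq hN]
    have : ∑ i, (D.G i ψ - ε) * (2 * N) ≤ ∑ i, (D.G i ψ - ε) * qf ((ψ i - (‖ψ‖ + 2 * N * h)) / h) ^ 2 := by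
      refine Finset.sum_le_sum fun i _ => ?_
      have := hψ i
      have hu : (ψ i - (‖ψ‖ + 2 * N * h)) / h ≤ - (2 * N) := by
        rw [div_le_iff₀ hh]
        have := (abs_le.1 (hi i)).2
        linarith
      have := qf_lb ((ψ i - (‖ψ‖ + 2 * N * h)) / h)
      have h3 : 2 * (N:ℝ) ≤ qf ((ψ i - (‖ψ‖ + 2 * N * h)) / h) := by linarith
      have : 2 * (N:ℝ) ≤ qf ((ψ i - (‖ψ‖ + 2 * N * h)) / h) ^ 2 := by nlinarith
      gcongr
    rw [← Finset.sum_mul, D.a_sum hN] at this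
    nlinarith
  have := intermediate_value_Icc (f := D.HH h ε ψ) (a := -‖ψ‖ - h / ε) (b := ‖ψ‖ + 2 * N * h) (by
    have := norm_nonneg ψ
    have : 0 ≤ h / ε := by positivity
    have : 0 ≤ 2 * N * h := by positivity
    linarith) hcont.continuousOn
  obtain ⟨s, _, hs⟩ := this ⟨h1, h2⟩
  exact ⟨s, hs⟩

/-- A priori bounds at solutions. -/
lemma bounds {M : ℝ} (hM : 1 ≤ M) {h ε W : ℝ} (hh : 0 < h) (hh1 : h ≤ 1) (hN : 1 ≤ N) (hε : 0 < ε)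
    (hεN : ε * (2 * N) < 1)
    (hW1 : 1 ≤ W) (hWN : W ≤ N) {ψ : Fin N → ℝ} (hψ : ∀ i, ε < D.G i ψ)
    (hd : ∀ i j, ψ i - ψ j ≤ M) {s A : ℝ} (hA : 2 + 4 * N + 2 * M ≤ A) (hs : D.HH h ε ψ s = W) :
    (∀ i, qf ((ψ i - s) / h) ≤ A * h⁻¹) ∧ A⁻¹ * ε ^ 2 ≤ D.DD h ε ψ s := by
  have hN' : (1:ℝ) ≤ N := by exact_mod_cast hN
  have hsum := D.a_sum hN ε ψ
  have hNε : 0 < N * ε := by positivity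
  have hε1 : ε ≤ 1 := by nlinarith
  rw [D.HH_eq hN] at hs
  set u : Fin N → ℝ := fun i => (ψ i - s) / h with hu
  have hud : ∀ i j, u i - u j ≤ M * h⁻¹ := by
    intro i j
    have : u i - u j = (ψ i - ψ j) * h⁻¹ := by simp only [hu]; ring
    rw [this]
    have := hd i j
    gcongr
  have hx : 1 ≤ h⁻¹ := (one_le_inv₀ hh).2 hh1
  have hy : 1 ≤ ε⁻¹ := (one_le_inv₀ hε).2 hε1
  have hap : ∀ i, 0 < D.G i ψ - ε := fun i => by linarith [hψ i]
  have hqs : ∑ i, (D.G i ψ - ε) * qf (u i) ^ 2 = W - 1 + N * ε := by linarith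
  have hqε : ε ≤ ∑ i, (D.G i ψ - ε) * qf (u i) ^ 2 := by rw [hqs]; nlinarith
  -- lower bound
  have hj : ∃ j, 1 ≤ (D.G j ψ - ε) * (2 * N) := by
    by_contra hc
    push Not at hc
    have : ∑ i, (D.G i ψ - ε) * (2 * N) < ∑ i : Fin N, (1:ℝ) :=
      Finset.sum_lt_sum_of_nonempty ⟨⟨0, hN⟩, Finset.mem_univ _⟩ fun i _ => hc i
    rw [← Finset.sum_mul, hsum] at this
    simp at this
    nlinarith
  obtain ⟨j, hj⟩ := hj
  have hqj : qf (u j) ≤ 2 * N := by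
    have h1 : (D.G j ψ - ε) * qf (u j) ^ 2 ≤ ∑ i, (D.G i ψ - ε) * qf (u i) ^ 2 :=
      Finset.single_le_sum (f := fun i => (D.G i ψ - ε) * qf (u i) ^ 2)
        (fun i _ => mul_nonneg (hap i).le (sq_nonneg _)) (Finset.mem_univ j)
    have h2 : (D.G j ψ - ε) * qf (u j) ^ 2 ≤ N := by nlinarith
    have h3 : qf (u j) ^ 2 ≤ 2 * N * N := by
      calc qf (u j) ^ 2 ≤ (D.G j ψ - ε) * (2 * N) * qf (u j) ^ 2 := by nlinarith [sq_nonneg (qf (u j))]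
        _ = 2 * N * ((D.G j ψ - ε) * qf (u j) ^ 2) := by ring
        _ ≤ 2 * N * N := by gcongr
    apply le_of_sq_le_sq _ (by positivity)
    nlinarith
  have hlow : ∀ i, -((2 * N + M) * h⁻¹) ≤ u i := by
    intro i
    have h1 := qf_lb (u j)
    have h2 := hud j i
    nlinarith
  -- upper bound
  have hi : ∃ i, ε ≤ qf (u i) ^ 2 := by
    by_contra hc
    push Not at hc
    have : ∑ i, (D.G i ψ - ε) * qf (u i) ^ 2 < ∑ i : Fin N, (D.G i ψ - ε) * ε :=
      Finset.sum_lt_sum_of_nonempty ⟨⟨0, hN⟩, Finset.mem_univ _⟩ fun i _ =>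
        mul_lt_mul_of_pos_left (hc i) (hap i)
    rw [← Finset.sum_mul, hsum] at this
    nlinarith
  obtain ⟨k, hk⟩ := hi
  have huk : u k ≤ ε⁻¹ := by
    by_contra hc
    push Not at hc
    have h0 : 0 < u k := by linarith
    have h1 := qf_large h0
    have h2 := qf_pos (u k)
    have h3 : ε * u k > 1 := by
      have := mul_lt_mul_of_pos_left hc hε
      rwa [mul_inv_cancel₀ hε.ne'] at this
    have h4 : qf (u k) * 2 < ε := by
      by_contra h5
      push Not at h5
      nlinarith
    nlinarith
  have hxy : h⁻¹ ≤ h⁻¹ * ε⁻¹ := by nlinarith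
  have hxy' : ε⁻¹ ≤ h⁻¹ * ε⁻¹ := by nlinarith
  have hsf : ∀ i, sf (u i) ≤ A * (h⁻¹ * ε⁻¹) := by
    intro i
    have h1 := hud i k
    have h2 := hlow i
    have h3 : |u i| ≤ (2 * N + M + 1) * (h⁻¹ * ε⁻¹) := by
      rw [abs_le]
      constructor
      · have : (2 * N + M) * h⁻¹ ≤ (2 * N + M + 1) * (h⁻¹ * ε⁻¹) := by
          apply mul_le_mul _ hxy (by positivity) (by positivity)
          linarith
        linarith
      · have : M * h⁻¹ ≤ (2 * N + M) * (h⁻¹ * ε⁻¹) := by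
          apply mul_le_mul _ hxy (by positivity) (by positivity)
          linarith
        linarith
    have := sf_le (u i)
    nlinarith
  constructor
  · intro i
    refine (qf_ub (b := (2 * N + M) * h⁻¹) (by positivity) (hlow i)).trans ?_
    nlinarith
  · have hA0 : 0 < A := by linarith
    have hterm : ∀ i, (D.G i ψ - ε) * qf (u i) ^ 2 * (A⁻¹ * ε) ≤ (D.G i ψ - ε) * (-gd (u i)) / h := by
      intro i
      have h1 : 0 < sf (u i) := by linarith [sf_one (u i)]
      have e : (D.G i ψ - ε) * (-gd (u i)) / h = (D.G i ψ - ε) * qf (u i) ^ 2 * (2 / (sf (u i) * h)) := by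
        unfold gd; field_simp
      rw [e]
      have := (hap i).le
      gcongr
      rw [le_div_iff₀ (by positivity)]
      have h2 := hsf i
      calc A⁻¹ * ε * (sf (u i) * h) ≤ A⁻¹ * ε * (A * (h⁻¹ * ε⁻¹) * h) := by gcongr
        _ = 1 := by field_simp
        _ ≤ 2 := by norm_num
    unfold DD
    calc A⁻¹ * ε ^ 2 = ε * (A⁻¹ * ε) := by ring
      _ ≤ (∑ i, (D.G i ψ - ε) * qf (u i) ^ 2) * (A⁻¹ * ε) := by gcongr
      _ = ∑ i, (D.G i ψ - ε) * qf (u i) ^ 2 * (A⁻¹ * ε) := by rw [Finset.sum_mul]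
      _ ≤ _ := Finset.sum_le_sum fun i _ => hterm i

/-- Lipschitz estimate of solutions, one sided. -/
lemma r_lip {h ε W : ℝ} (hh : 0 < h) (hh1 : h ≤ 1) (hN : 1 ≤ N) (hε : 0 < ε)
    {ψ φ : Fin N → ℝ} (hψ : ∀ i, ε < D.G i ψ) (hφ : ∀ i, ε < D.G i φ) {s t A : ℝ} (hA : 24 ≤ A)
    (hAN : N ≤ A) (hAL : D.Lam ≤ A)
    (hs : D.HH h ε ψ s = W) (ht : D.HH h ε φ t = W)
    (hq : ∀ i, qf ((ψ i - s) / h) ≤ A * h⁻¹) (hD : A⁻¹ * ε ^ 2 ≤ D.DD h ε φ t) (hδ : ‖ψ - φ‖ ≤ 1) :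
    s - t ≤ 7 * A ^ 5 * h⁻¹ ^ 2 * ε⁻¹ ^ 2 * ‖ψ - φ‖ := by
  set δ := ‖ψ - φ‖ with hδd
  have hδ0 : 0 ≤ δ := norm_nonneg _
  set x := h⁻¹ with hxd
  have hx : 1 ≤ x := (one_le_inv₀ hh).2 hh1
  have hA0 : 0 < A := by linarith
  have hL0 := D.Lam_nonneg
  have h1 : D.DD h ε φ t * (s - t) ≤ D.HH h ε φ s - W := by
    rw [← ht]
    unfold DD HH
    rw [Finset.sum_mul, ← Finset.sum_sub_distrib]
    refine Finset.sum_le_sum fun i _ => ?_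
    have := gfun_tangent ((φ i - t) / h) ((φ i - s) / h)
    have h2 := hφ i
    have e : (φ i - s) / h - (φ i - t) / h = - (s - t) / h := by ring
    rw [e] at this
    have h3 : (D.G i φ - ε) * (gd ((φ i - t) / h) * (-(s - t) / h)) ≤
      (D.G i φ - ε) * (gfun ((φ i - s) / h) - gfun ((φ i - t) / h)) := by
      apply mul_le_mul_of_nonneg_left _ (by linarith)
      linarith
    calc _ = _ := by ring
      _ ≤ _ := h3
      _ = _ := by ring
  have h2 : D.HH h ε φ s - W ≤ 7 * A ^ 4 * x ^ 2 * δ := by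
    rw [← hs]
    unfold HH
    rw [← Finset.sum_sub_distrib]
    have : ∀ i, (D.G i φ - ε) * gfun ((φ i - s) / h) - (D.G i ψ - ε) * gfun ((ψ i - s) / h)
        ≤ (D.G i φ - ε) * (5 * A * x ^ 2 * δ) + 2 * A ^ 3 * x ^ 2 * δ := by
      intro i
      have k1 := hφ i
      have hi : |φ i - ψ i| ≤ δ := by
        rw [abs_sub_comm]; exact norm_le_pi_norm (ψ - φ) i
      have hd : (ψ i - s) / h - (φ i - s) / h = -(φ i - ψ i) * x := by rw [hxd]; ring
      have hqi := hq i
      set u := (ψ i - s) / h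
      set v := (φ i - s) / h
      have hud : |u - v| ≤ δ * x := by
        rw [hd, abs_mul, abs_neg, abs_of_nonneg (by linarith : 0 ≤ x)]
        gcongr
      have hgu : -gd u ≤ 4 * (A * x) := (gd_le u).trans (by linarith)
      have hgv : -gd v ≤ 5 * (A * x) := by
        have := (abs_le.1 (gd_lip u v)).2
        have h24 : 24 * (δ * x) ≤ A * x := by nlinarith
        linarith
      have hg : |gfun u - gfun v| ≤ 5 * (A * x) * |u - v| := gfun_lip (hgu.trans (by nlinarith)) hgv
      have hg' : gfun v - gfun u ≤ 5 * A * x ^ 2 * δ := by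
        have h4 : 5 * (A * x) * |u - v| ≤ 5 * (A * x) * (δ * x) := by gcongr
        have := (abs_le.1 hg).1
        linarith
      have hgb : gfun u ≤ 2 * A ^ 2 * x ^ 2 := by
        rw [gfun_eq]
        have h4 : qf u ^ 2 ≤ (A * x) ^ 2 := by have := qf_pos u; gcongr
        have h5 : 1 ≤ A * x := by nlinarith
        nlinarith
      have hg0 : 0 ≤ gfun u := by rw [gfun_eq]; positivity
      have hGG := (abs_le.1 (D.G_lip' i ψ φ)).1
      rw [← hδd] at hGG
      have hGG' : D.G i φ - D.G i ψ ≤ A * δ := by nlinarith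
      calc (D.G i φ - ε) * gfun v - (D.G i ψ - ε) * gfun u
          = (D.G i φ - ε) * (gfun v - gfun u) + (D.G i φ - D.G i ψ) * gfun u := by ring
        _ ≤ (D.G i φ - ε) * (5 * A * x ^ 2 * δ) + (A * δ) * (2 * A ^ 2 * x ^ 2) := by
          gcongr
        _ = _ := by ring
    refine (Finset.sum_le_sum fun i _ => this i).trans ?_
    rw [Finset.sum_add_distrib, ← Finset.sum_mul, D.a_sum hN]
    simp only [Finset.sum_const, Finset.card_univ, Fintype.card_fin, nsmul_eq_mul]
    have h3 : (1 - N * ε) * (5 * A * x ^ 2 * δ) ≤ 1 * (5 * A ^ 4 * x ^ 2 * δ) := by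
      gcongr
      · have : 0 ≤ N * ε := by positivity
        linarith
      · exact le_self_pow₀ (by linarith) (by norm_num)
    have h4 : (N:ℝ) * (2 * A ^ 3 * x ^ 2 * δ) ≤ A * (2 * A ^ 3 * x ^ 2 * δ) := by gcongr
    calc _ ≤ _ := add_le_add h3 h4
      _ = _ := by ring
  by_cases hst : s - t ≤ 0
  · exact hst.trans (by positivity)
  push Not at hst
  have h3 : A⁻¹ * ε ^ 2 * (s - t) ≤ 7 * A ^ 4 * x ^ 2 * δ :=
    le_trans (by gcongr) (h1.trans h2)
  calc s - t = A * ε⁻¹ ^ 2 * (A⁻¹ * ε ^ 2 * (s - t)) := by field_simp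
    _ ≤ A * ε⁻¹ ^ 2 * (7 * A ^ 4 * x ^ 2 * δ) := by gcongr
    _ = _ := by ring

end CD

namespace CD
variable (D : CD n N)

/-- coefficients -/
def PP (h ε : ℝ) (ψ : Fin N → ℝ) (s : ℝ) (i : Fin N) : ℝ := (D.G i ψ - ε) * (-gd ((ψ i - s) / h)) / h

/-- The `ψ`-derivative of `HH`. -/
def BB (h ε : ℝ) (ψ : Fin N → ℝ) (s : ℝ) : (Fin N → ℝ) →L[ℝ] ℝ :=
  ∑ i, (gfun ((ψ i - s) / h) • fderiv ℝ (D.G i) ψ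
    - D.PP h ε ψ s i • ContinuousLinearMap.proj (R := ℝ) (φ := fun _ : Fin N => ℝ) i)

lemma HH_deriv {h ε : ℝ} {ψ : Fin N → ℝ} (hd : ∀ i, DifferentiableAt ℝ (D.G i) ψ) (s : ℝ) :
    HasFDerivAt (fun p : (Fin N → ℝ) × ℝ => D.HH h ε p.1 p.2)
      ((D.BB h ε ψ s).comp (ContinuousLinearMap.fst ℝ (Fin N → ℝ) ℝ)
        + D.DD h ε ψ s • ContinuousLinearMap.snd ℝ (Fin N → ℝ) ℝ) (ψ, s) := by
  have hterm : ∀ i, HasFDerivAt (fun p : (Fin N → ℝ) × ℝ => (D.G i p.1 - ε) * gfun ((p.1 i - p.2) / h))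
      ((D.G i ψ - ε) • (gd ((ψ i - s) / h) • (h⁻¹ • ((ContinuousLinearMap.proj (R := ℝ) (φ := fun _ : Fin N => ℝ) i).comp
        (ContinuousLinearMap.fst ℝ (Fin N → ℝ) ℝ) - ContinuousLinearMap.snd ℝ (Fin N → ℝ) ℝ)))
        + gfun ((ψ i - s) / h) • ((fderiv ℝ (D.G i) ψ).comp (ContinuousLinearMap.fst ℝ (Fin N → ℝ) ℝ))) (ψ, s) := by
    intro i
    have h1 : HasFDerivAt (fun p : (Fin N → ℝ) × ℝ => D.G i p.1 - ε)
        ((fderiv ℝ (D.G i) ψ).comp (ContinuousLinearMap.fst ℝ (Fin N → ℝ) ℝ)) (ψ, s) := by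
      have := (hd i).hasFDerivAt.comp ((ψ, s) : (Fin N → ℝ) × ℝ) (f := Prod.fst) hasFDerivAt_fst
      exact this.sub_const ε
    have h2 : HasFDerivAt (fun p : (Fin N → ℝ) × ℝ => (p.1 i - p.2) / h)
        (h⁻¹ • ((ContinuousLinearMap.proj (R := ℝ) (φ := fun _ : Fin N => ℝ) i).comp
        (ContinuousLinearMap.fst ℝ (Fin N → ℝ) ℝ) - ContinuousLinearMap.snd ℝ (Fin N → ℝ) ℝ)) (ψ, s) := by
      have h3 : HasFDerivAt (fun p : (Fin N → ℝ) × ℝ => p.1 i - p.2)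
        ((ContinuousLinearMap.proj (R := ℝ) (φ := fun _ : Fin N => ℝ) i).comp
        (ContinuousLinearMap.fst ℝ (Fin N → ℝ) ℝ) - ContinuousLinearMap.snd ℝ (Fin N → ℝ) ℝ) (ψ, s) :=
        ((ContinuousLinearMap.proj (R := ℝ) (φ := fun _ : Fin N => ℝ) i).comp
        (ContinuousLinearMap.fst ℝ (Fin N → ℝ) ℝ) - ContinuousLinearMap.snd ℝ (Fin N → ℝ) ℝ).hasFDerivAt
      have := h3.mul_const h⁻¹
      simpa only [div_eq_mul_inv] using this
    have h4 := (gfun_deriv ((ψ i - s) / h)).comp_hasFDerivAt ((ψ, s) : (Fin N → ℝ) × ℝ) h2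
    exact h1.mul h4
  have := HasFDerivAt.fun_sum (u := Finset.univ) fun i _ => hterm i
  unfold HH
  refine this.congr_fderiv ?_
  ext v
  · simp [BB, DD, PP, Finset.sum_add_distrib]
    rw [add_comm, sub_eq_add_neg, ← Finset.sum_neg_distrib]
    congr 1
    exact Finset.sum_congr rfl fun i _ => by ring
  · simp [BB, DD, PP]
    rw [← Finset.sum_neg_distrib]
    exact Finset.sum_congr rfl fun i _ => by ring

lemma r_deriv {h ε W K : ℝ} {ψ : Fin N → ℝ} (hd : ∀ i, DifferentiableAt ℝ (D.G i) ψ)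
    {r : (Fin N → ℝ) → ℝ} (hr : ∀ᶠ φ in nhds ψ, D.HH h ε φ (r φ) = W)
    (hl : ∀ᶠ φ in nhds ψ, |r φ - r ψ| ≤ K * ‖φ - ψ‖) (hD : 0 < D.DD h ε ψ (r ψ)) :
    HasFDerivAt r (-((D.DD h ε ψ (r ψ))⁻¹ • D.BB h ε ψ (r ψ))) ψ := by
  have hc : ContinuousAt r ψ := by
    rw [ContinuousAt, tendsto_iff_norm_sub_tendsto_zero]
    have ht : Tendsto (fun φ => K * ‖φ - ψ‖) (nhds ψ) (nhds 0) := by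
      have : Continuous (fun φ => K * ‖φ - ψ‖) := by fun_prop
      simpa using this.tendsto ψ
    exact squeeze_zero' (Eventually.of_forall fun _ => norm_nonneg _) hl ht
  have h1 := D.HH_deriv (h := h) (ε := ε) hd (r ψ)
  rw [hasFDerivAt_iff_isLittleO] at h1
  have hcp : Tendsto (fun φ => (φ, r φ)) (nhds ψ) (nhds (ψ, r ψ)) :=
    tendsto_id.prodMk_nhds hc
  have h2 := h1.comp_tendsto hcp
  have hO : (fun φ => (φ, r φ) - (ψ, r ψ)) =O[nhds ψ] fun φ => φ - ψ := by
    rw [Asymptotics.isBigO_iff]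
    refine ⟨max 1 K, ?_⟩
    filter_upwards [hl] with φ hφ
    rw [Prod.mk_sub_mk, Prod.norm_def]
    apply max_le
    · calc ‖φ - ψ‖ = 1 * ‖φ - ψ‖ := by ring
        _ ≤ _ := by gcongr; exact le_max_left _ _
    · calc _ ≤ K * ‖φ - ψ‖ := hφ
        _ ≤ _ := by gcongr; exact le_max_right _ _
  have h3 := h2.trans_isBigO hO
  rw [hasFDerivAt_iff_isLittleO]
  have h4 := h3.const_mul_left (-(D.DD h ε ψ (r ψ))⁻¹)
  refine h4.congr' ?_ EventuallyEq.rfl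
  filter_upwards [hr] with φ hφ
  have hψ := hr.self_of_nhds
  simp only [Function.comp_apply, hφ, hψ]
  simp
  field_simp
  ring

/-- The Hölder estimate. -/
lemma hol_est {h ε W H : ℝ} (hh : 0 < h) (hh1 : h ≤ 1) (hN : 1 ≤ N) (hε : 0 < ε) (hε1 : ε ≤ 1)
    {ψ φ : Fin N → ℝ} (hψ : ∀ i, ε < D.G i ψ) (hφ : ∀ i, ε < D.G i φ) {s t A : ℝ} (hA : 24 ≤ A)
    (hAN : N ≤ A) (hAL : D.Lam ≤ A) (hAH : H ≤ A)
    (hH : ∀ i, ‖fderiv ℝ (D.G i) ψ - fderiv ℝ (D.G i) φ‖ ≤ H / ε ^ 5 * ‖ψ - φ‖ ^ D.α)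
    (hs : D.HH h ε ψ s = W) (ht : D.HH h ε φ t = W)
    (hq : ∀ i, qf ((ψ i - s) / h) ≤ A * h⁻¹) (hD : A⁻¹ * ε ^ 2 ≤ D.DD h ε ψ s)
    (hq' : ∀ i, qf ((φ i - t) / h) ≤ A * h⁻¹) (hD' : A⁻¹ * ε ^ 2 ≤ D.DD h ε φ t) :
    ‖(D.DD h ε ψ s)⁻¹ • D.BB h ε ψ s‖ ≤ 6 * A ^ 5 * h⁻¹ ^ 6 * ε⁻¹ ^ 7 ∧
    (‖ψ - φ‖ ≤ 1 → ‖(D.DD h ε ψ s)⁻¹ • D.BB h ε ψ s - (D.DD h ε φ t)⁻¹ • D.BB h ε φ t‖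
      ≤ 118 * A ^ 13 * h⁻¹ ^ 6 * ε⁻¹ ^ 7 * ‖ψ - φ‖ ^ D.α) := by
  set δ := ‖ψ - φ‖ with hδd
  have hδ0 : 0 ≤ δ := norm_nonneg _
  set x := h⁻¹ with hxd
  set y := ε⁻¹ with hyd
  have hx : 1 ≤ x := (one_le_inv₀ hh).2 hh1
  have hy : 1 ≤ y := (one_le_inv₀ hε).2 hε1
  have hA0 : 0 < A := by linarith
  have hA1 : 1 ≤ A := by linarith
  have hL0 := D.Lam_nonneg
  -- generic bounds
  have hgb : ∀ u, qf u ≤ A * x → |gfun u| ≤ 2 * A ^ 2 * x ^ 2 ∧ -gd u ≤ 4 * A * x := by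
    intro u hu
    have h0 := qf_pos u
    constructor
    · rw [gfun_eq, abs_of_nonneg (by positivity)]
      have h4 : qf u ^ 2 ≤ (A * x) ^ 2 := by gcongr
      have h5 : 1 ≤ (A * x) ^ 2 := one_le_pow₀ (one_le_mul_of_one_le_of_one_le hA1 hx)
      rw [mul_pow] at h4 h5
      linarith
    · exact (gd_le u).trans (by linarith)
  have hDpos : 0 < A⁻¹ * ε ^ 2 := by positivity
  have hinv : ∀ d : ℝ, A⁻¹ * ε ^ 2 ≤ d → 0 < d ∧ d⁻¹ ≤ A * y ^ 2 := by
    intro d hd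
    refine ⟨lt_of_lt_of_le hDpos hd, ?_⟩
    calc d⁻¹ ≤ (A⁻¹ * ε ^ 2)⁻¹ := inv_anti₀ hDpos hd
      _ = A * y ^ 2 := by rw [hyd]; field_simp
  have hG1 : ∀ (χ : Fin N → ℝ) i, D.G i χ ≤ 1 := by
    intro χ i
    rw [← D.G_sum hN χ]
    exact Finset.single_le_sum (f := fun i => D.G i χ) (fun i _ => ENNReal.toReal_nonneg) (Finset.mem_univ i)
  have hPb : ∀ (χ : Fin N → ℝ) (z : ℝ), (∀ i, ε < D.G i χ) → (∀ i, qf ((χ i - z) / h) ≤ A * x) →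
      ∀ i, |D.PP h ε χ z i| ≤ 4 * A * x ^ 2 := by
    intro χ z hχ hqz i
    have h1 := (hgb _ (hqz i)).2
    have h2 := gd_neg ((χ i - z) / h)
    have h3 := hG1 χ i
    have h4 := hχ i
    have h5 : 0 ≤ D.G i χ - ε := by linarith
    have h6 : 0 ≤ -gd ((χ i - z) / h) := by linarith
    unfold PP
    rw [div_eq_mul_inv, ← hxd, abs_of_nonneg (by positivity)]
    calc (D.G i χ - ε) * -gd ((χ i - z) / h) * x ≤ 1 * (4 * A * x) * x := by
          gcongr; linarith
      _ = _ := by ring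
  have hproj : ∀ i, ‖ContinuousLinearMap.proj (R := ℝ) (φ := fun _ : Fin N => ℝ) i‖ ≤ 1 := by
    intro i
    refine ContinuousLinearMap.opNorm_le_bound _ zero_le_one fun v => ?_
    rw [one_mul]; exact norm_le_pi_norm v i
  have hBb : ∀ (χ : Fin N → ℝ) (z : ℝ), (∀ i, ε < D.G i χ) → (∀ i, qf ((χ i - z) / h) ≤ A * x) →
      ‖D.BB h ε χ z‖ ≤ 6 * A ^ 4 * x ^ 2 := by
    intro χ z hχ hqz
    unfold BB
    refine (norm_sum_le _ _).trans ?_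
    calc _ ≤ ∑ i : Fin N, 6 * A ^ 3 * x ^ 2 := by
          refine Finset.sum_le_sum fun i _ => (norm_sub_le _ _).trans ?_
          rw [norm_smul, norm_smul, Real.norm_eq_abs, Real.norm_eq_abs]
          have h1 := (hgb _ (hqz i)).1
          have h2 := hPb χ z hχ hqz i
          have h3 := (D.G_fderiv_le i χ).trans hAL
          calc _ ≤ 2 * A ^ 2 * x ^ 2 * A + 4 * A * x ^ 2 * 1 := by
                gcongr; exact hproj i
            _ ≤ 2 * A ^ 2 * x ^ 2 * A + 4 * A ^ 3 * x ^ 2 * 1 := by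
                gcongr; exact le_self_pow₀ hA1 (by norm_num)
            _ = _ := by ring
      _ = N * (6 * A ^ 3 * x ^ 2) := by simp
      _ ≤ A * (6 * A ^ 3 * x ^ 2) := by gcongr
      _ = _ := by ring
  obtain ⟨hd0, hdi⟩ := hinv _ hD
  obtain ⟨hd0', hdi'⟩ := hinv _ hD'
  have hB := hBb ψ s hψ hq
  have hB' := hBb φ t hφ hq'
  constructor
  · rw [norm_smul, norm_inv, Real.norm_of_nonneg hd0.le]
    calc _ ≤ (A * y ^ 2) * (6 * A ^ 4 * x ^ 2) := by gcongr
      _ = 6 * A ^ 5 * x ^ 2 * y ^ 2 := by ring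
      _ ≤ _ := by gcongr <;> norm_num
  intro hδ
  have hδα : δ ≤ δ ^ D.α := by
    rcases hδ0.eq_or_lt with h0 | h0
    · rw [← h0, Real.zero_rpow D.hα.ne']
    · calc δ = δ ^ (1:ℝ) := by simp
        _ ≤ _ := Real.rpow_le_rpow_of_exponent_ge h0 hδ D.hα1
  set E := δ ^ D.α with hE
  have hE0 : 0 ≤ E := by positivity
  have hrl : |s - t| ≤ 7 * A ^ 5 * x ^ 2 * y ^ 2 * δ := by
    rw [abs_le]
    constructor
    · have := D.r_lip hh hh1 hN hε hφ hψ hA hAN hAL ht hs hq' hD (by rw [norm_sub_rev]; exact hδ)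
      rw [norm_sub_rev, ← hδd] at this
      linarith
    · exact D.r_lip hh hh1 hN hε hψ hφ hA hAN hAL hs ht hq hD' hδ
  have hud : ∀ i, |(ψ i - s) / h - (φ i - t) / h| ≤ 8 * A ^ 5 * x ^ 3 * y ^ 2 * δ := by
    intro i
    have e : (ψ i - s) / h - (φ i - t) / h = ((ψ i - φ i) - (s - t)) * x := by rw [hxd]; ring
    have hi : |ψ i - φ i| ≤ δ := norm_le_pi_norm (ψ - φ) i
    rw [e, abs_mul, abs_of_nonneg (by linarith : 0 ≤ x)]
    have h1 : 1 ≤ A ^ 5 * x ^ 2 * y ^ 2 := by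
      have := one_le_pow₀ hA1 (n := 5)
      have := one_le_pow₀ hx (n := 2)
      have := one_le_pow₀ hy (n := 2)
      exact one_le_mul_of_one_le_of_one_le (one_le_mul_of_one_le_of_one_le ‹_› ‹_›) ‹_›
    calc |ψ i - φ i - (s - t)| * x ≤ (δ + 7 * A ^ 5 * x ^ 2 * y ^ 2 * δ) * x := by
          gcongr; exact (abs_sub _ _).trans (add_le_add hi hrl)
      _ ≤ (A ^ 5 * x ^ 2 * y ^ 2 * δ + 7 * A ^ 5 * x ^ 2 * y ^ 2 * δ) * x := by
          gcongr; exact le_mul_of_one_le_left hδ0 h1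
      _ = _ := by ring
  have hgd : ∀ i, |gfun ((ψ i - s) / h) - gfun ((φ i - t) / h)| ≤ 32 * A ^ 6 * x ^ 4 * y ^ 2 * δ := by
    intro i
    refine (gfun_lip (hgb _ (hq i)).2 (hgb _ (hq' i)).2).trans ?_
    have := hud i
    calc _ ≤ 4 * A * x * (8 * A ^ 5 * x ^ 3 * y ^ 2 * δ) := by gcongr
      _ = _ := by ring
  have hPd : ∀ i, |D.PP h ε ψ s i - D.PP h ε φ t i| ≤ 12 * A ^ 6 * x ^ 4 * y ^ 2 * δ := by
    intro i
    have h1 := (hgb _ (hq i)).2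
    have h1' := gd_neg ((ψ i - s) / h)
    have h2 := gd_lip ((ψ i - s) / h) ((φ i - t) / h)
    have h3 := hud i
    have h4 := D.G_lip' i ψ φ
    rw [← hδd] at h4
    have h5 := hG1 φ i
    have h6 := hφ i
    unfold PP
    have e : (D.G i ψ - ε) * -gd ((ψ i - s) / h) / h - (D.G i φ - ε) * -gd ((φ i - t) / h) / h
      = ((D.G i ψ - D.G i φ) * (-gd ((ψ i - s) / h)) - (D.G i φ - ε) * (gd ((ψ i - s) / h) - gd ((φ i - t) / h))) * x := by
      rw [hxd]; generalize gd ((ψ i - s) / h) = a1; generalize gd ((φ i - t) / h) = a2; ring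
    rw [e, abs_mul, abs_of_nonneg (by linarith : 0 ≤ x)]
    calc _ ≤ (A * δ * (4 * A * x) + 1 * (24 * (8 * A ^ 5 * x ^ 3 * y ^ 2 * δ))) * x := by
          gcongr
          refine (abs_sub _ _).trans (add_le_add ?_ ?_)
          · rw [abs_mul, abs_of_pos (by linarith : 0 < -gd ((ψ i - s) / h))]
            have h9 : |D.G i ψ - D.G i φ| ≤ A * δ := h4.trans (by gcongr)
            exact mul_le_mul h9 h1 (by linarith) (by positivity)
          · rw [abs_mul, abs_of_pos (by linarith : 0 < D.G i φ - ε)]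
            gcongr
            · linarith
            · exact h2.trans (by gcongr)
      _ = 4 * A ^ 2 * x ^ 2 * 1 * δ + 24 * (8 * A ^ 5 * x ^ 4 * y ^ 2 * δ) := by ring
      _ ≤ 4 * A ^ 6 * x ^ 4 * y ^ 2 * δ + A * (8 * A ^ 5 * x ^ 4 * y ^ 2 * δ) := by
          gcongr <;> first | exact one_le_pow₀ hy | exact hA | norm_num
      _ = _ := by ring
  have hDd : |D.DD h ε ψ s - D.DD h ε φ t| ≤ 12 * A ^ 7 * x ^ 4 * y ^ 2 * δ := by
    have e : D.DD h ε ψ s - D.DD h ε φ t = ∑ i, (D.PP h ε ψ s i - D.PP h ε φ t i) := by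
      rw [Finset.sum_sub_distrib]; rfl
    rw [e]
    refine (Finset.abs_sum_le_sum_abs _ _).trans ((Finset.sum_le_sum fun i _ => hPd i).trans ?_)
    rw [Finset.sum_const, Finset.card_univ, Fintype.card_fin, nsmul_eq_mul]
    calc _ ≤ A * (12 * A ^ 6 * x ^ 4 * y ^ 2 * δ) := by gcongr
      _ = _ := by ring
  have hBd : ‖D.BB h ε ψ s - D.BB h ε φ t‖ ≤ 46 * A ^ 8 * x ^ 4 * y ^ 5 * E := by
    unfold BB
    rw [← Finset.sum_sub_distrib]
    refine (norm_sum_le _ _).trans ?_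
    calc _ ≤ ∑ i : Fin N, 46 * A ^ 7 * x ^ 4 * y ^ 5 * E := by
          refine Finset.sum_le_sum fun i _ => ?_
          have h1 := (hgb _ (hq i)).1
          have h2 := hgd i
          have h3 := hPd i
          have h4 := (D.G_fderiv_le i φ).trans hAL
          have h5 := hH i
          have h6 : H / ε ^ 5 * E ≤ A * y ^ 5 * E := by
            rw [hyd, div_eq_mul_inv, inv_pow]; gcongr
          have h7 := hproj i
          set F1 := fderiv ℝ (D.G i) ψ
          set F2 := fderiv ℝ (D.G i) φ
          set g1 := gfun ((ψ i - s) / h)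
          set g2 := gfun ((φ i - t) / h)
          set P1 := D.PP h ε ψ s i
          set P2 := D.PP h ε φ t i
          set pr := ContinuousLinearMap.proj (R := ℝ) (φ := fun _ : Fin N => ℝ) i
          have e : g1 • F1 - P1 • pr - (g2 • F2 - P2 • pr) = g1 • (F1 - F2) + (g1 - g2) • F2 - (P1 - P2) • pr := by
            module
          rw [e]
          refine (norm_sub_le _ _).trans ((add_le_add (norm_add_le _ _) le_rfl).trans ?_)
          rw [norm_smul, norm_smul, norm_smul, Real.norm_eq_abs, Real.norm_eq_abs, Real.norm_eq_abs]
          calc _ ≤ 2 * A ^ 2 * x ^ 2 * (A * y ^ 5 * E) + 32 * A ^ 6 * x ^ 4 * y ^ 2 * E * A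
                + 12 * A ^ 6 * x ^ 4 * y ^ 2 * E * 1 := by
                gcongr
                · exact h5.trans h6
                · exact h2.trans (by gcongr)
                · exact h3.trans (by gcongr)
            _ = 2 * A ^ 3 * x ^ 2 * y ^ 5 * E + 32 * A ^ 7 * x ^ 4 * y ^ 2 * E
                + 12 * A ^ 6 * x ^ 4 * y ^ 2 * E := by ring
            _ ≤ 2 * A ^ 7 * x ^ 4 * y ^ 5 * E + 32 * A ^ 7 * x ^ 4 * y ^ 5 * E
                + 12 * A ^ 7 * x ^ 4 * y ^ 5 * E := by gcongr <;> norm_num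
            _ = _ := by ring
      _ = N * (46 * A ^ 7 * x ^ 4 * y ^ 5 * E) := by simp
      _ ≤ A * (46 * A ^ 7 * x ^ 4 * y ^ 5 * E) := by gcongr
      _ = _ := by ring
  set d1 := D.DD h ε ψ s
  set d2 := D.DD h ε φ t
  set B1 := D.BB h ε ψ s
  set B2 := D.BB h ε φ t
  have e : d1⁻¹ • B1 - d2⁻¹ • B2 = d1⁻¹ • (B1 - B2) - (d1⁻¹ * d2⁻¹ * (d1 - d2)) • B2 := by
    have : d1⁻¹ * d2⁻¹ * (d1 - d2) = d2⁻¹ - d1⁻¹ := by field_simp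
    rw [this]; module
  rw [e]
  refine (norm_sub_le _ _).trans ?_
  rw [norm_smul, norm_smul, norm_mul, norm_mul, norm_inv, norm_inv, Real.norm_of_nonneg hd0.le,
    Real.norm_of_nonneg hd0'.le, Real.norm_eq_abs]
  calc _ ≤ (A * y ^ 2) * (46 * A ^ 8 * x ^ 4 * y ^ 5 * E)
        + (A * y ^ 2) * (A * y ^ 2) * (12 * A ^ 7 * x ^ 4 * y ^ 2 * E) * (6 * A ^ 4 * x ^ 2) := by
        gcongr
        exact hDd.trans (by gcongr)
    _ = 46 * A ^ 9 * x ^ 4 * y ^ 7 * E + 72 * A ^ 13 * x ^ 6 * y ^ 6 * E := by ring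
    _ ≤ 46 * A ^ 13 * x ^ 6 * y ^ 7 * E + 72 * A ^ 13 * x ^ 6 * y ^ 7 * E := by gcongr <;> norm_num
    _ = _ := by ring

end CD

namespace CD
variable (D : CD n N)

theorem main (hN : 1 ≤ N) : ∃ C > (0:ℝ), ∀ h ε W : ℝ, 0 < h → h ≤ 1 → 0 < ε → ε < 1 / (2 * N) →
    1 ≤ W → W ≤ N → ∃ r : (Fin N → ℝ) → ℝ,
      (∀ ψ, (∀ i, ε < D.G i ψ) → D.HH h ε ψ (r ψ) = W ∧ ∀ s, D.HH h ε ψ s = W → s = r ψ) ∧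
      (∀ ψ, (∀ i, ε < D.G i ψ) → DifferentiableAt ℝ r ψ ∧ ‖fderiv ℝ r ψ‖ ≤ C * h⁻¹ ^ 6 * ε⁻¹ ^ 7) ∧
      ∀ ψ φ, (∀ i, ε < D.G i ψ) → (∀ i, ε < D.G i φ) →
        ‖fderiv ℝ r ψ - fderiv ℝ r φ‖ ≤ C * h⁻¹ ^ 6 * ε⁻¹ ^ 7 * ‖ψ - φ‖ ^ D.α := by
  obtain ⟨M, hM, hdiam⟩ := D.diam_bound
  obtain ⟨H, hH1, hH⟩ := D.G_C1
  have hL0 := D.Lam_nonneg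
  have hN' : (1:ℝ) ≤ N := by exact_mod_cast hN
  set A : ℝ := 24 + (2 + 4 * N + 2 * M) + D.Lam + H with hAd
  have hA24 : 24 ≤ A := by linarith
  have hAN : N ≤ A := by linarith
  have hAL : D.Lam ≤ A := by linarith
  have hAH : H ≤ A := by linarith
  have hAM : 2 + 4 * N + 2 * M ≤ A := by linarith
  have hA1 : 1 ≤ A := by linarith
  have hA0 : 0 < A := by linarith
  clear_value A
  refine ⟨118 * A ^ 13, by positivity, ?_⟩
  intro h ε W hh hh1 hε hεN hW1 hWN
  have hεN' : ε * (2 * N) < 1 := by rwa [lt_div_iff₀ (by positivity)] at hεN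
  have hε1 : ε ≤ 1 := by nlinarith
  set good : (Fin N → ℝ) → Prop := fun ψ => ∀ i, ε < D.G i ψ with hgood
  have hex : ∀ ψ, good ψ → ∃ s, D.HH h ε ψ s = W := fun ψ hψ =>
    D.HH_exists hh hN hε hεN' hW1 hWN hψ
  set r : (Fin N → ℝ) → ℝ := fun ψ => if hψ : good ψ then (hex ψ hψ).choose else 0 with hr
  have hrs : ∀ ψ, good ψ → D.HH h ε ψ (r ψ) = W := by
    intro ψ hψ
    simp only [hr, dif_pos hψ]
    exact (hex ψ hψ).choose_spec
  have hb : ∀ ψ, good ψ → (∀ i, qf ((ψ i - r ψ) / h) ≤ A * h⁻¹) ∧ A⁻¹ * ε ^ 2 ≤ D.DD h ε ψ (r ψ) :=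
    fun ψ hψ => D.bounds hM hh hh1 hN hε hεN' hW1 hWN hψ
      (hdiam ψ fun i => hε.trans (hψ i)) hAM (hrs ψ hψ)
  have hopen : ∀ ψ, good ψ → ∀ᶠ φ in nhds ψ, good φ := by
    intro ψ hψ
    rw [hgood]
    rw [eventually_all]
    intro i
    have hL : LipschitzWith D.Lam.toNNReal (D.G i) := LipschitzWith.of_dist_le' (fun x y => by
      rw [Real.dist_eq, dist_eq_norm]; exact D.G_lip' i x y)
    exact (hL.continuous.tendsto ψ).eventually (lt_mem_nhds (hψ i))
  obtain ⟨hHd, hHh⟩ := hH ε hε hε1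
  have hder : ∀ ψ, good ψ → HasFDerivAt r (-((D.DD h ε ψ (r ψ))⁻¹ • D.BB h ε ψ (r ψ))) ψ := by
    intro ψ hψ
    refine D.r_deriv (K := 7 * A ^ 5 * h⁻¹ ^ 2 * ε⁻¹ ^ 2) (W := W) (hHd ψ ((D.big_iff hε.le ψ).2 hψ))
      ((hopen ψ hψ).mono hrs) ?_ (lt_of_lt_of_le (by positivity) (hb ψ hψ).2)
    filter_upwards [hopen ψ hψ, ball_mem_nhds ψ one_pos] with φ hφ hφψ
    have h1 : ‖φ - ψ‖ ≤ 1 := (mem_ball_iff_norm.1 hφψ).le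
    rw [abs_le]
    constructor
    · have := D.r_lip hh hh1 hN hε hψ hφ hA24 hAN hAL (hrs ψ hψ) (hrs φ hφ) (hb ψ hψ).1 (hb φ hφ).2
        (by rwa [norm_sub_rev])
      rw [norm_sub_rev] at this
      linarith
    · exact D.r_lip hh hh1 hN hε hφ hψ hA24 hAN hAL (hrs φ hφ) (hrs ψ hψ) (hb φ hφ).1 (hb ψ hψ).2 h1
  have hest := fun ψ φ (hψ : good ψ) (hφ : good φ) => D.hol_est hh hh1 hN hε hε1 hψ hφ hA24 hAN hAL hAH
    (hHh ψ φ ((D.big_iff hε.le ψ).2 hψ) ((D.big_iff hε.le φ).2 hφ)) (hrs ψ hψ) (hrs φ hφ)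
    (hb ψ hψ).1 (hb ψ hψ).2 (hb φ hφ).1 (hb φ hφ).2
  have hn : ∀ ψ, good ψ → ‖fderiv ℝ r ψ‖ ≤ 6 * A ^ 13 * h⁻¹ ^ 6 * ε⁻¹ ^ 7 := by
    intro ψ hψ
    rw [(hder ψ hψ).fderiv, norm_neg]
    refine (hest ψ ψ hψ hψ).1.trans ?_
    gcongr
    norm_num
  refine ⟨r, fun ψ hψ => ⟨hrs ψ hψ, fun s hs => ?_⟩, fun ψ hψ => ⟨(hder ψ hψ).differentiableAt, ?_⟩,
    fun ψ φ hψ hφ => ?_⟩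
  · exact (D.HH_mono hh hN hψ).injective (hs.trans (hrs ψ hψ).symm)
  · refine (hn ψ hψ).trans ?_
    gcongr; norm_num
  · rcases le_or_gt ‖ψ - φ‖ 1 with hle | hgt
    · rw [(hder ψ hψ).fderiv, (hder φ hφ).fderiv, neg_sub_neg, norm_sub_rev]
      exact (hest ψ φ hψ hφ).2 hle
    · refine (norm_sub_le _ _).trans ((add_le_add (hn ψ hψ) (hn φ hφ)).trans ?_)
      have h1 : 1 ≤ ‖ψ - φ‖ ^ D.α := Real.one_le_rpow hgt.le D.hα.le
      calc _ = 12 * A ^ 13 * h⁻¹ ^ 6 * ε⁻¹ ^ 7 * 1 := by ring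
        _ ≤ _ := by gcongr; norm_num

end CD

lemma contDiff_det' : ContDiff ℝ 2 (fun A : Pt n →L[ℝ] Pt n => A.det) := by
  have e : (fun A : Pt n →L[ℝ] Pt n => A.det) = fun A =>
      ∑ σ : Equiv.Perm (Fin n), (Equiv.Perm.sign σ : ℝ) *
        ∏ i, (EuclideanSpace.proj (𝕜 := ℝ) (σ i) : Pt n →L[ℝ] ℝ) (A (EuclideanSpace.basisFun (Fin n) ℝ i)) := by
    ext A
    rw [ContinuousLinearMap.det, ← LinearMap.det_toMatrix (EuclideanSpace.basisFun (Fin n) ℝ).toBasis,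
      Matrix.det_apply']
    refine Finset.sum_congr rfl fun σ _ => ?_
    congr 1
    refine Finset.prod_congr rfl fun i _ => ?_
    simp [LinearMap.toMatrix_apply]
  rw [e]
  refine ContDiff.sum fun σ _ => contDiff_const.mul ?_
  refine contDiff_prod fun i _ => ?_
  fun_prop

lemma lip_of_C1 {E : Type*} [NormedAddCommGroup E] [NormedSpace ℝ E] {K : Set (Pt n)} (hK : Convex ℝ K)
    (hc : IsCompact K) (hi : (interior K).Nonempty) {f : Pt n → E} (hf : ContDiffOn ℝ 1 f K) :
    ∃ L, ∀ x ∈ K, ∀ y ∈ K, ‖f x - f y‖ ≤ L * ‖x - y‖ := by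
  have hu := uniqueDiffOn_convex hK hi
  obtain ⟨L, hL⟩ := hc.exists_bound_of_continuousOn (hf.continuousOn_fderivWithin hu le_rfl)
  exact ⟨L, fun x hx y hy => hK.norm_image_sub_le_of_norm_hasFDerivWithin_le
    (fun z hz => ((hf.differentiableOn one_ne_zero) z hz).hasFDerivWithinAt) hL hy hx⟩

lemma C11_of_C2 {K : Set (Pt n)} (hK : Convex ℝ K)
    (hc : IsCompact K) (hi : (interior K).Nonempty) {f : Pt n → ℝ} (hf : ContDiffOn ℝ 2 f K) :
    ∃ L, ∀ L', L ≤ L' → C11 K f (fderivWithin ℝ f K) L' := by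
  have hu := uniqueDiffOn_convex hK hi
  have h1 : ContDiffOn ℝ 1 (fderivWithin ℝ f K) K := hf.fderivWithin hu (by norm_num)
  obtain ⟨L, hL⟩ := hc.exists_bound_of_continuousOn h1.continuousOn
  obtain ⟨L1, hL1⟩ := lip_of_C1 hK hc hi h1
  refine ⟨max L L1, fun L' hL' => ⟨fun z hz => ((hf.differentiableOn two_ne_zero) z hz).hasFDerivWithinAt,
    fun x hx => (hL x hx).trans ((le_max_left _ _).trans hL'), fun x hx y hy => (hL1 x hx y hy).trans ?_⟩⟩
  gcongr
  exact (le_max_right _ _).trans hL'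

section chart
variable {K X : Set (Pt n)} {e ie : Pt n → Pt n}

lemma ch_comp (hX : IsCompact X) (hie : ContDiffOn ℝ 2 ie X) (hb : BijOn e K X) (hinv : InvOn ie e K X) :
    IsCompact K := by
  have : K = ie '' X := by
    rw [← hb.image_eq, hinv.1.image_image]
  rw [this]
  exact hX.image_of_continuousOn hie.continuousOn

lemma ch_int (hX : IsCompact X) (hK : Convex ℝ K) (he : ContDiffOn ℝ 2 e K) (hie : ContDiffOn ℝ 2 ie X)
    (hb : BijOn e K X) (hinv : InvOn ie e K X) (hv : volume X ≠ 0) : (interior K).Nonempty := by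
  by_contra hne
  rw [not_nonempty_iff_eq_empty] at hne
  have hc := (ch_comp hX hie hb hinv).isClosed
  have h0 : volume K = 0 := by
    have := Convex.addHaar_frontier (volume : Measure (Pt n)) hK
    rwa [hc.frontier_eq, hne, sdiff_empty] at this
  apply hv
  rw [← hb.image_eq]
  exact addHaar_image_eq_zero_of_differentiableOn_of_addHaar_eq_zero volume
    (he.differentiableOn two_ne_zero) h0

lemma ch_inv (hu : UniqueDiffOn ℝ K) (he : ContDiffOn ℝ 2 e K) (hie : ContDiffOn ℝ 2 ie X)
    (hb : BijOn e K X) (hinv : InvOn ie e K X) {p : Pt n} (hp : p ∈ K) :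
    (fderivWithin ℝ ie X (e p)).comp (fderivWithin ℝ e K p) = ContinuousLinearMap.id ℝ (Pt n) ∧
    (fderivWithin ℝ e K p).comp (fderivWithin ℝ ie X (e p)) = ContinuousLinearMap.id ℝ (Pt n) := by
  have h1 : HasFDerivWithinAt e (fderivWithin ℝ e K p) K p :=
    ((he.differentiableOn two_ne_zero) p hp).hasFDerivWithinAt
  have h2 : HasFDerivWithinAt ie (fderivWithin ℝ ie X (e p)) X (e p) :=
    ((hie.differentiableOn two_ne_zero) _ (hb.mapsTo hp)).hasFDerivWithinAt
  have h3 := h2.comp p h1 hb.mapsTo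
  have h4 : HasFDerivWithinAt (ie ∘ e) (ContinuousLinearMap.id ℝ (Pt n)) K p :=
    (hasFDerivWithinAt_id p K).congr (fun x hx => hinv.1 hx) (hinv.1 hp)
  have h5 := (hu p hp).eq h3 h4
  refine ⟨h5, ?_⟩
  have h6 : (fderivWithin ℝ ie X (e p) : Pt n →ₗ[ℝ] Pt n) * (fderivWithin ℝ e K p : Pt n →ₗ[ℝ] Pt n) = 1 := by
    ext1 v
    exact congrArg (fun T : Pt n →L[ℝ] Pt n => T v) h5
  have h7 := mul_eq_one_comm.1 h6
  ext1 v
  exact congrArg (fun T : Pt n →ₗ[ℝ] Pt n => T v) h7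

lemma ch_bdd (hX : IsCompact X) (hu : UniqueDiffOn ℝ K) (he : ContDiffOn ℝ 2 e K) (hie : ContDiffOn ℝ 2 ie X)
    (hb : BijOn e K X) (hinv : InvOn ie e K X) :
    ∃ L, (∀ p ∈ K, ‖fderivWithin ℝ e K p‖ ≤ L) ∧ ∀ x ∈ X, ‖fderivWithin ℝ ie X x‖ ≤ L := by
  have hc := ch_comp hX hie hb hinv
  have huX : UniqueDiffOn ℝ X := by
    rw [← hb.image_eq]
    refine hu.image (fun p hp => ((he.differentiableOn two_ne_zero) p hp).hasFDerivWithinAt) fun p hp => ?_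
    refine Function.Surjective.denseRange fun v => ⟨fderivWithin ℝ ie X (e p) v, ?_⟩
    exact congrArg (fun T : Pt n →L[ℝ] Pt n => T v) (ch_inv hu he hie hb hinv hp).2
  obtain ⟨L1, h1⟩ := hc.exists_bound_of_continuousOn (he.continuousOn_fderivWithin hu (by norm_num))
  obtain ⟨L2, h2⟩ := hX.exists_bound_of_continuousOn (hie.continuousOn_fderivWithin huX (by norm_num))
  exact ⟨max L1 L2, fun p hp => (h1 p hp).trans (le_max_left _ _), fun x hx => (h2 x hx).trans (le_max_right _ _)⟩

lemma ch_chain (he : ContDiffOn ℝ 2 e K) (hu : UniqueDiffOn ℝ K)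
    (hb : BijOn e K X) {f : Pt n → ℝ} (hf : ContDiffOn ℝ 2 f X) {p : Pt n} (hp : p ∈ K) :
    fderivWithin ℝ (fun q => f (e q)) K p = (fderivWithin ℝ f X (e p)).comp (fderivWithin ℝ e K p) :=
  fderivWithin_fun_comp p ((hf.differentiableOn two_ne_zero) _ (hb.mapsTo hp))
    ((he.differentiableOn two_ne_zero) p hp) hb.mapsTo (hu p hp)

lemma ch_twist (hc : IsCompact K) (hu : UniqueDiffOn ℝ K) (he : ContDiffOn ℝ 2 e K) (hie : ContDiffOn ℝ 2 ie X)
    (hb : BijOn e K X) (hinv : InvOn ie e K X) {f g : Pt n → ℝ} (hf : ContDiffOn ℝ 2 f X)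
    (hg : ContDiffOn ℝ 2 g X) (hne : ∀ x ∈ X, fderivWithin ℝ f X x ≠ fderivWithin ℝ g X x) :
    ∃ δ > 0, ∀ p ∈ K, δ ≤ ‖fderivWithin ℝ (fun q => f (e q)) K p - fderivWithin ℝ (fun q => g (e q)) K p‖ := by
  rcases K.eq_empty_or_nonempty with rfl | hne'
  · exact ⟨1, one_pos, by simp⟩
  have hf' : ContDiffOn ℝ 2 (fun q => f (e q)) K := hf.comp he hb.mapsTo
  have hg' : ContDiffOn ℝ 2 (fun q => g (e q)) K := hg.comp he hb.mapsTo
  have hcont : ContinuousOn (fun p => ‖fderivWithin ℝ (fun q => f (e q)) K p -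
      fderivWithin ℝ (fun q => g (e q)) K p‖) K :=
    ((hf'.continuousOn_fderivWithin hu (by norm_num)).sub (hg'.continuousOn_fderivWithin hu (by norm_num))).norm
  obtain ⟨p0, hp0, hmin⟩ := hc.exists_isMinOn hne' hcont
  refine ⟨_, ?_, fun p hp => hmin hp⟩
  rw [gt_iff_lt, norm_pos_iff, sub_ne_zero, ch_chain he hu hb hf hp0, ch_chain he hu hb hg hp0]
  intro h
  apply hne (e p0) (hb.mapsTo hp0)
  have h1 := congrArg (fun T => T.comp (fderivWithin ℝ ie X (e p0))) h
  simp only [ContinuousLinearMap.comp_assoc, (ch_inv hu he hie hb hinv hp0).2] at h1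
  simpa using h1

lemma ch_dens (hX : IsCompact X) (hK : Convex ℝ K) (hi : (interior K).Nonempty)
    (he : ContDiffOn ℝ 2 e K) (hie : ContDiffOn ℝ 2 ie X)
    (hb : BijOn e K X) (hinv : InvOn ie e K X) {ρ : Pt n → ℝ} (hρ : ContinuousOn ρ X) {α Cρ : ℝ}
    (hα : 0 < α) (hα1 : α ≤ 1) (hH : ∀ x ∈ X, ∀ y ∈ X, |ρ x - ρ y| ≤ Cρ * ‖x - y‖ ^ α) :
    ∃ L, (∀ p ∈ K, |(fderivWithin ℝ e K p).det| * max (ρ (e p)) 0 ≤ L) ∧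
      ∀ p ∈ K, ∀ q ∈ K, |(|(fderivWithin ℝ e K p).det| * max (ρ (e p)) 0) -
        |(fderivWithin ℝ e K q).det| * max (ρ (e q)) 0| ≤ L * ‖p - q‖ ^ α := by
  have hc := ch_comp hX hie hb hinv
  have hu := uniqueDiffOn_convex hK hi
  have hd : ContDiffOn ℝ 1 (fun p => (fderivWithin ℝ e K p).det) K := 
    (contDiff_det'.of_le (by norm_num)).comp_contDiffOn (he.fderivWithin hu (by norm_num))
  obtain ⟨d, hd1⟩ := hc.exists_bound_of_continuousOn hd.continuousOn
  obtain ⟨dl, hdl⟩ := lip_of_C1 hK hc hi hd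
  obtain ⟨el, hel⟩ := lip_of_C1 hK hc hi (he.of_le (by norm_num))
  obtain ⟨b, hb1⟩ := hX.exists_bound_of_continuousOn hρ
  obtain ⟨B, hB⟩ := hc.isBounded.exists_norm_le
  set M := 2 * |B| + 1 with hM
  have hM1 : 1 ≤ M := by have := abs_nonneg B; linarith
  set L := |d| * (|Cρ| * |el| ^ α) + |b| * (|dl| * M) with hL
  have hLa : 0 ≤ |el| ^ α := by positivity
  have hdet : ∀ p ∈ K, |(fderivWithin ℝ e K p).det| ≤ |d| := fun p hp => (hd1 p hp).trans (le_abs_self _)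
  have hrho : ∀ p ∈ K, |max (ρ (e p)) 0| ≤ |b| := by
    intro p hp
    rw [abs_of_nonneg (le_max_right _ _)]
    refine max_le ?_ (abs_nonneg _)
    exact (le_abs_self _).trans ((hb1 _ (hb.mapsTo hp)).trans (le_abs_self _))
  refine ⟨|d| * |b| + L, fun p hp => ?_, fun p hp q hq => ?_⟩
  · have hL0 : 0 ≤ L := by positivity
    have h1 := hdet p hp
    have h2 := (le_abs_self _).trans (hrho p hp)
    have : |(fderivWithin ℝ e K p).det| * max (ρ (e p)) 0 ≤ |d| * |b| :=
      mul_le_mul h1 h2 (le_max_right _ _) (abs_nonneg _)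
    linarith
  · set x := ‖p - q‖ with hx
    have hx0 : 0 ≤ x := norm_nonneg _
    have hxM : x ≤ M := by
      have := norm_sub_le p q
      have h1 := (hB p hp).trans (le_abs_self _)
      have h2 := (hB q hq).trans (le_abs_self _)
      linarith
    have hxa : x ≤ M * x ^ α := by
      rcases hx0.eq_or_lt with h0 | h0
      · rw [← h0]; positivity
      · calc x = x ^ (1 - α) * x ^ α := by rw [← Real.rpow_add h0]; simp
          _ ≤ M * x ^ α := by
            gcongr
            calc x ^ (1 - α) ≤ M ^ (1 - α) := by gcongr
              _ ≤ M ^ (1:ℝ) := Real.rpow_le_rpow_of_exponent_le hM1 (by linarith)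
              _ = M := by simp
    have hr : |max (ρ (e p)) 0 - max (ρ (e q)) 0| ≤ |Cρ| * |el| ^ α * x ^ α := by
      calc _ ≤ |ρ (e p) - ρ (e q)| := abs_max_sub_max_le_abs _ _ _
        _ ≤ Cρ * ‖e p - e q‖ ^ α := hH _ (hb.mapsTo hp) _ (hb.mapsTo hq)
        _ ≤ |Cρ| * (|el| * x) ^ α := by
          gcongr
          · exact le_abs_self _
          · refine (hel p hp q hq).trans ?_
            gcongr; exact le_abs_self _
        _ = _ := by rw [Real.mul_rpow (abs_nonneg _) hx0]; ring
    have hdd : |(|(fderivWithin ℝ e K p).det| - |(fderivWithin ℝ e K q).det|)| ≤ |dl| * M * x ^ α := by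
      calc _ ≤ |(fderivWithin ℝ e K p).det - (fderivWithin ℝ e K q).det| := abs_abs_sub_abs_le _ _
        _ ≤ dl * x := hdl p hp q hq
        _ ≤ |dl| * (M * x ^ α) := by
            gcongr; exact le_abs_self _
        _ = _ := by ring
    have h1 := hdet p hp
    have h2 := hrho q hq
    set a1 := |(fderivWithin ℝ e K p).det|
    set a2 := |(fderivWithin ℝ e K q).det|
    set r1 := max (ρ (e p)) 0
    set r2 := max (ρ (e q)) 0
    have ha : |a1| = a1 := abs_abs _
    calc |a1 * r1 - a2 * r2| = |a1 * (r1 - r2) + (a1 - a2) * r2| := by congr 1; ring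
      _ ≤ |a1| * |r1 - r2| + |a1 - a2| * |r2| := by
          rw [← abs_mul, ← abs_mul]; exact abs_add_le _ _
      _ ≤ |d| * (|Cρ| * |el| ^ α * x ^ α) + |dl| * M * x ^ α * |b| := by
          rw [ha]; gcongr
      _ = L * x ^ α := by rw [hL]; ring
      _ ≤ _ := by gcongr; have : 0 ≤ |d| * |b| := by positivity
                  linarith

lemma ch_meas (hX : IsCompact X) {f : Pt n → Fin N → ℝ} (hf : ContinuousOn f X) {S : Set (Fin N → ℝ)}
    (hS : MeasurableSet S) : MeasurableSet {x ∈ X | f x ∈ S} := by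
  have h1 : MeasurableSet ((X.domRestrict f) ⁻¹' S) := hf.domRestrict.measurable hS
  have h2 := hX.measurableSet.subtype_image h1
  convert h2 using 1
  ext x
  constructor
  · exact fun h => ⟨⟨x, h.1⟩, h.2, rfl⟩
  · rintro ⟨y, hy, rfl⟩
    exact ⟨y.2, hy⟩

lemma ch_nu (hX : IsCompact X) (he : ContDiffOn ℝ 2 e K) (hie : ContDiffOn ℝ 2 ie X)
    (hb : BijOn e K X) (hinv : InvOn ie e K X) {ρ : Pt n → ℝ} {μ : Measure (Pt n)}
    (hμ : μ = volume.withDensity (fun x => ENNReal.ofReal (ρ x)))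
    {f : Pt n → Fin N → ℝ} (hf : ContinuousOn f X) {S : Set (Fin N → ℝ)} (hS : MeasurableSet S) :
    μ {x ∈ X | f x ∈ S} = ∫⁻ p in {p ∈ K | f (e p) ∈ S},
      ENNReal.ofReal (|(fderivWithin ℝ e K p).det| * max (ρ (e p)) 0) := by
  have hc := ch_comp hX hie hb hinv
  have hT' : MeasurableSet {p ∈ K | f (e p) ∈ S} :=
    ch_meas hc (hf.comp he.continuousOn hb.mapsTo) hS
  have him : {x ∈ X | f x ∈ S} = e '' {p ∈ K | f (e p) ∈ S} := by
    ext x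
    constructor
    · rintro ⟨hx, hxS⟩
      obtain ⟨p, hp, rfl⟩ := hb.surjOn hx
      exact ⟨p, ⟨hp, hxS⟩, rfl⟩
    · rintro ⟨p, ⟨hp, hpS⟩, rfl⟩
      exact ⟨hb.mapsTo hp, hpS⟩
  rw [hμ, withDensity_apply _ (ch_meas hX hf hS), him,
    lintegral_image_eq_lintegral_abs_det_fderiv_mul volume hT' (f' := fderivWithin ℝ e K)
      (fun p hp => (((he.differentiableOn two_ne_zero) p hp.1).hasFDerivWithinAt).mono fun q hq => hq.1)
      (hb.injOn.mono fun q hq => hq.1)]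
  refine lintegral_congr fun p => ?_
  rw [← ENNReal.ofReal_mul (abs_nonneg _), mul_max_of_nonneg _ _ (abs_nonneg _), mul_zero,
    ENNReal.ofReal_max, ENNReal.ofReal_zero]
  simp

end chart

lemma fin_ub {ι : Type*} [Finite ι] (f : ι → ℝ) : ∃ B, 1 ≤ B ∧ ∀ i, f i ≤ B := by
  obtain ⟨B, hB⟩ := Set.finite_range f |>.bddAbove
  exact ⟨max 1 B, le_max_left _ _, fun i => (hB ⟨i, rfl⟩).trans (le_max_right _ _)⟩

lemma fin_lb {ι : Type*} [Finite ι] (f : ι → ℝ) (hf : ∀ i, 0 < f i) : ∃ b, 0 < b ∧ b ≤ 1 ∧ ∀ i, b ≤ f i := by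
  obtain ⟨B, hB1, hB⟩ := fin_ub fun i => (f i)⁻¹
  refine ⟨B⁻¹, by positivity, inv_le_one_of_one_le₀ hB1, fun i => ?_⟩
  exact inv_le_of_inv_le₀ (hf i) (hB i)

lemma lag_eq (X : Set (Pt n)) (c : Pt n → Fin N → ℝ) (ψ : Fin N → ℝ) (i : Fin N) :
    LagCell X c ψ i = {x ∈ X | c x ∈ cell ψ i} := by
  ext x
  refine and_congr_right fun _ => ?_
  have hbd : BddAbove (range fun j => -c x j - ψ j) := (finite_range _).bddAbove
  have : Nonempty (Fin N) := ⟨i⟩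
  constructor
  · intro h m
    have := le_ciSup hbd m
    rw [← h] at this
    linarith
  · intro h
    refine le_antisymm (le_ciSup hbd i) (ciSup_le fun m => ?_)
    have := h m
    linarith

theorem build (hN : 1 ≤ N)
    (X : Set (Pt n)) (hX : IsCompact X)
    (c : Pt n → Fin N → ℝ) (hreg : RegCond X c) (htw : TwistCond X c)
    (μ : Measure (Pt n)) (hprob : IsProbabilityMeasure μ)
    (hac : μ ≪ volume) (hsupp : μ Xᶜ = 0)
    (hqc : LoeperCond X c)
    (α : ℝ) (hα : 0 < α) (hα1 : α ≤ 1)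
    (hdens : HolderDensity X μ α) : ∃ D : CD n N, D.α = α ∧ ∀ ψ i, D.G i ψ = Gfun X c μ ψ i := by
  obtain ⟨K, e, ie, H⟩ := hqc
  have hK := fun i => (H i).1
  have he := fun i => (H i).2.1
  have hie := fun i => (H i).2.2.1
  have hb := fun i => (H i).2.2.2.1
  have hinv := fun i => (H i).2.2.2.2.1
  have hq := fun i => (H i).2.2.2.2.2
  obtain ⟨ρ, hμ, hρ, Cρ, hH⟩ := hdens
  have hμX : μ X = 1 := (prob_compl_eq_zero_iff hX.measurableSet).1 hsupp
  have hv : volume X ≠ 0 := fun h => by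
    have := hac h
    rw [hμX] at this
    exact one_ne_zero this
  have hc := fun i => ch_comp hX (hie i) (hb i) (hinv i)
  have hi := fun i => ch_int hX (hK i) (he i) (hie i) (hb i) (hinv i) hv
  have hu := fun i => uniqueDiffOn_convex (hK i) (hi i)
  have hF : ∀ j m, ContDiffOn ℝ 2 (fun q => c (e j q) m) (K j) := fun j m => (hreg m).comp (he j) (hb j).mapsTo
  have hcc : ContinuousOn c X := continuousOn_pi.2 fun m => (hreg m).continuousOn
  have hball : ∀ j, ∃ o : Pt n, ∃ r > 0, closedBall o r ⊆ K j := by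
    intro j
    obtain ⟨o, ho⟩ := hi j
    rw [mem_interior_iff_mem_nhds] at ho
    obtain ⟨r, hr, h⟩ := nhds_basis_closedBall.mem_iff.1 ho
    exact ⟨o, r, hr, h⟩
  choose o r hr hor using hball
  obtain ⟨r0, hr0, hr1, hrr⟩ := fin_lb r hr
  choose Bk hBk using fun j => (hc j).isBounded.exists_norm_le
  obtain ⟨Rad, hRad1, hRad⟩ := fin_ub Bk
  choose L1 hL1 using fun jm : Fin N × Fin N => C11_of_C2 (hK jm.1) (hc jm.1) (hi jm.1) (hF jm.1 jm.2)
  obtain ⟨B1, hB11, hB1⟩ := fin_ub L1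
  choose L2 hL2 using fun j => ch_bdd hX (hu j) (he j) (hie j) (hb j) (hinv j)
  obtain ⟨B2, hB21, hB2⟩ := fin_ub L2
  choose L3 hL3 using fun j => ch_dens hX (hK j) (hi j) (he j) (hie j) (hb j) (hinv j) hρ hα hα1 hH
  obtain ⟨B3, hB31, hB3⟩ := fin_ub L3
  have htwx : ∀ jim : Fin N × Fin N × Fin N, ∃ δ > 0, jim.2.1 ≠ jim.2.2 → ∀ p ∈ K jim.1,
      δ ≤ ‖fderivWithin ℝ (fun q => c (e jim.1 q) jim.2.1) (K jim.1) p -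
        fderivWithin ℝ (fun q => c (e jim.1 q) jim.2.2) (K jim.1) p‖ := by
    rintro ⟨j, i, m⟩
    by_cases him : i = m
    · exact ⟨1, one_pos, fun h => absurd him h⟩
    · obtain ⟨δ, hδ, h⟩ := ch_twist (hc j) (hu j) (he j) (hie j) (hb j) (hinv j) (hreg i) (hreg m)
        (fun x hx => htw x hx i m him)
      exact ⟨δ, hδ, fun _ => h⟩
  choose δ hδ hδt using htwx
  obtain ⟨δ0, hδ0, hδ1, hδδ⟩ := fin_lb δ hδ
  have hν : ∀ S, MeasurableSet S → (Measure.map c (μ.restrict X)) S = μ {x ∈ X | c x ∈ S} := by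
    intro S hS
    rw [Measure.map_apply_of_aemeasurable (hcc.aemeasurable hX.measurableSet) hS,
      Measure.restrict_apply' hX.measurableSet, inter_comm]
    rfl
  have hLB : B1 ≤ B1 + B2 * B2 + B3 := by nlinarith
  refine ⟨{
    K := K
    F := fun j m p => c (e j p) m
    F' := fun j m => fderivWithin ℝ (fun q => c (e j q) m) (K j)
    R := fun j p => |(fderivWithin ℝ (e j) (K j) p).det| * max (ρ (e j p)) 0
    ν := Measure.map c (μ.restrict X)
    o := o
    L := B1 + B2 * B2 + B3
    Rad := Rad
    r0 := r0
    δ := δ0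
    α := α
    hL := by nlinarith
    hRad := hRad1
    hr0 := hr0
    hr1 := hr1
    hδ := hδ0
    hδ1 := hδ1
    hα := hα
    hα1 := hα1
    Kconv := hK
    Kcomp := hc
    Kball := fun j => (closedBall_subset_closedBall (hrr j)).trans (hor j)
    Krad := fun j p hp => by
      rw [mem_closedBall_zero_iff]
      exact (hBk j p hp).trans (hRad j)
    FC := fun j m => hL1 (j, m) _ ((hB1 (j, m)).trans hLB)
    quasi := fun j m t => by
      convert hq j t m using 3
      rw [sub_eq_neg_add]
    twist := fun j i m him p hp => (hδδ (j, i, m)).trans (hδt (j, i, m) him p hp)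
    R0 := fun j p => mul_nonneg (abs_nonneg _) (le_max_right _ _)
    RL := fun j p hp => ((hL3 j).1 p hp).trans ((hB3 j).trans (by nlinarith))
    RH := fun j p hp q hq => ((hL3 j).2 p hp q hq).trans (by
      gcongr
      exact (hB3 j).trans (by nlinarith))
    νprob := ⟨by
      rw [hν _ MeasurableSet.univ]
      simpa using hμX⟩
    νeq := fun j S hS => by
      rw [hν S hS]
      exact ch_nu hX (he j) (hie j) (hb j) (hinv j) hμ hcc hS
    trans := fun i j p hp => by
      have hx : e j p ∈ X := (hb j).mapsTo hp
      obtain ⟨p', hp', hpe⟩ := (hb i).surjOn hx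
      refine ⟨p', hp', (fderivWithin ℝ (ie j) X (e j p)).comp (fderivWithin ℝ (e i) (K i) p'), ?_, ?_⟩
      · refine (ContinuousLinearMap.opNorm_comp_le _ _).trans ?_
        have h1 := ((hL2 j).2 _ hx).trans (hB2 j)
        have h2 := ((hL2 i).1 _ hp').trans (hB2 i)
        have h3 := mul_le_mul h1 h2 (norm_nonneg _) (by linarith)
        linarith
      · intro m
        refine ⟨by simp only [hpe], ?_⟩
        rw [ch_chain (he i) (hu i) (hb i) (hreg m) hp', ch_chain (he j) (hu j) (hb j) (hreg m) hp, hpe,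
          ContinuousLinearMap.comp_assoc, ← ContinuousLinearMap.comp_assoc (fderivWithin ℝ (e j) (K j) p),
          (ch_inv (hu j) (he j) (hie j) (hb j) (hinv j) hp).2, ContinuousLinearMap.id_comp] }, rfl, ?_⟩
  intro ψ i
  show ((Measure.map c (μ.restrict X)) (cell ψ i)).toReal = (μ (LagCell X c ψ i)).toReal
  rw [hν _ (cell_meas ψ i), lag_eq]

lemma le_eNorm2 (v : Fin N → ℝ) : ‖v‖ ≤ eNorm2 v := by
  unfold eNorm2
  rw [pi_norm_le_iff_of_nonneg (Real.sqrt_nonneg _)]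
  intro i
  refine Real.le_sqrt_of_sq_le ?_
  rw [Real.norm_eq_abs, sq_abs]
  exact Finset.single_le_sum (f := fun i => v i ^ 2) (fun i _ => sq_nonneg _) (Finset.mem_univ i)

theorem stmt14
    (n N : ℕ) (hn : 2 ≤ n) (hN : 1 ≤ N)
    (X : Set (Pt n)) (hX : IsCompact X)
    (Y : Fin N → Pt n) (hY : Function.Injective Y)
    (c : Pt n → Fin N → ℝ) (hreg : RegCond X c) (htw : TwistCond X c)
    (μ : Measure (Pt n)) (hprob : IsProbabilityMeasure μ)
    (hac : μ ≪ volume) (hsupp : μ Xᶜ = 0)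
    (hqc : LoeperCond X c)
    (α : ℝ) (hα : 0 < α) (hα1 : α ≤ 1)
    (hdens : HolderDensity X μ α) :
    ∃ C > (0:ℝ), ∀ (h ε : ℝ) (w : Fin N → ℝ),
      0 < h → h ≤ 1 → 0 < ε → ε < 1 / (2 * N) →
      (∀ i, w i ∈ Icc (0:ℝ) 1) → 1 ≤ ∑ i, w i →
      ∃ r : (Fin N → ℝ) → ℝ,
        (∀ ψ ∈ Kset X c μ ε,
          (ψ - r ψ • (fun _ => (1:ℝ))) ∈ Nset X c μ h ε w ∧
          ∀ s : ℝ, (ψ - s • (fun _ => (1:ℝ))) ∈ Nset X c μ h ε w → s = r ψ) ∧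
        (∀ ψ ∈ Kset X c μ ε,
          DifferentiableAt ℝ (fun φ => φ - r φ • (fun _ => (1:ℝ))) ψ ∧
          ‖fderiv ℝ (fun φ => φ - r φ • (fun _ => (1:ℝ))) ψ‖ ≤
            C * h ^ (-18:ℝ) * ε ^ (-9:ℝ)) ∧
        ∀ ψ₁ ∈ Kset X c μ ε, ∀ ψ₂ ∈ Kset X c μ ε,
          ‖fderiv ℝ (fun φ => φ - r φ • (fun _ => (1:ℝ))) ψ₁ -
              fderiv ℝ (fun φ => φ - r φ • (fun _ => (1:ℝ))) ψ₂‖ ≤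
            C * h ^ (-18:ℝ) * ε ^ (-9:ℝ) * eNorm2 (ψ₁ - ψ₂) ^ α := by

  obtain ⟨D, rfl, hG⟩ := build hN X hX c hreg htw μ hprob hac hsupp hqc α hα hα1 hdens
  obtain ⟨C, hC, hmain⟩ := D.main hN
  refine ⟨1 + C, by positivity, ?_⟩
  intro h ε w hh hh1 hε hεN hw hw1
  have hWN : ∑ i, w i ≤ N := by
    calc ∑ i, w i ≤ ∑ i : Fin N, (1:ℝ) := Finset.sum_le_sum fun i _ => (hw i).2
      _ = N := by simp
  obtain ⟨r, hr1, hr2, hr3⟩ := hmain h ε (∑ i, w i) hh hh1 hε hεN hw1 hWN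
  have hK : ∀ ψ, ψ ∈ Kset X c μ ε ↔ ∀ i, ε < D.G i ψ := by
    intro ψ
    simp only [hG]; rfl
  have hsub : ∀ (ψ : Fin N → ℝ) (s : ℝ) i, D.G i (ψ - s • (fun _ => (1:ℝ))) = D.G i ψ := by
    intro ψ s i
    rw [← D.G_add i ψ (-s)]
    congr 1
    ext m
    simp [sub_eq_add_neg]
  have hNs : ∀ (ψ : Fin N → ℝ) (s : ℝ), ψ ∈ Kset X c μ ε →
      ((ψ - s • (fun _ => (1:ℝ))) ∈ Nset X c μ h ε w ↔ D.HH h ε ψ s = ∑ i, w i) := by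
    intro ψ s hψ
    have h1 : (ψ - s • (fun _ => (1:ℝ))) ∈ Kset X c μ ε := by
      rw [hK] at hψ ⊢
      simpa only [hsub] using hψ
    have h2 : ∑ i, wmap X c μ h ε (ψ - s • (fun _ => (1:ℝ))) i = D.HH h ε ψ s := by
      unfold wmap CD.HH
      refine Finset.sum_congr rfl fun i _ => ?_
      rw [← hG, hsub]
      simp
    unfold Nset
    rw [mem_setOf_eq, h2]
    exact ⟨fun h => h.2.symm, fun h => ⟨h1, h.symm⟩⟩
  have hx : 1 ≤ h⁻¹ := (one_le_inv₀ hh).2 hh1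
  have hε1 : ε ≤ 1 := by
    have hN' : (1:ℝ) ≤ N := by exact_mod_cast hN
    refine hεN.le.trans ?_
    rw [div_le_one (by positivity)]
    linarith
  have hy : 1 ≤ ε⁻¹ := (one_le_inv₀ hε).2 hε1
  have e1 : h ^ (-18:ℝ) = h⁻¹ ^ 18 := by
    rw [Real.rpow_neg hh.le, inv_pow]; norm_cast
  have e2 : ε ^ (-9:ℝ) = ε⁻¹ ^ 9 := by
    rw [Real.rpow_neg hε.le, inv_pow]; norm_cast
  rw [e1, e2]
  have hcc : C * h⁻¹ ^ 6 * ε⁻¹ ^ 7 ≤ C * h⁻¹ ^ 18 * ε⁻¹ ^ 9 := by gcongr <;> norm_num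
  have hone : 1 ≤ h⁻¹ ^ 18 * ε⁻¹ ^ 9 :=
    one_le_mul_of_one_le_of_one_le (one_le_pow₀ hx) (one_le_pow₀ hy)
  set u : Fin N → ℝ := fun _ => (1:ℝ) with hu
  have hun : ‖u‖ ≤ 1 := by
    rw [pi_norm_le_iff_of_nonneg zero_le_one]; intro i; simp [hu]
  have hder : ∀ ψ ∈ Kset X c μ ε, HasFDerivAt (fun φ => φ - r φ • u)
      (ContinuousLinearMap.id ℝ (Fin N → ℝ) - (fderiv ℝ r ψ).smulRight u) ψ := by
    intro ψ hψ
    have h1 := (hr2 ψ ((hK ψ).1 hψ)).1.hasFDerivAt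
    exact (hasFDerivAt_id ψ).sub (h1.smul_const u)
  have hsr : ∀ l : (Fin N → ℝ) →L[ℝ] ℝ, ‖l.smulRight u‖ ≤ ‖l‖ := by
    intro l
    rw [ContinuousLinearMap.norm_smulRight_apply]
    exact mul_le_of_le_one_right (norm_nonneg _) hun
  refine ⟨r, fun ψ hψ => ⟨?_, fun s hs => ?_⟩, fun ψ hψ => ⟨(hder ψ hψ).differentiableAt, ?_⟩, ?_⟩
  · rw [hNs ψ _ hψ]; exact (hr1 ψ ((hK ψ).1 hψ)).1
  · rw [hNs ψ _ hψ] at hs; exact (hr1 ψ ((hK ψ).1 hψ)).2 s hs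
  · rw [(hder ψ hψ).fderiv]
    refine (norm_sub_le _ _).trans ?_
    have h1 := (hsr _).trans ((hr2 ψ ((hK ψ).1 hψ)).2.trans hcc)
    have h2 : ‖ContinuousLinearMap.id ℝ (Fin N → ℝ)‖ ≤ 1 := ContinuousLinearMap.norm_id_le
    calc _ ≤ h⁻¹ ^ 18 * ε⁻¹ ^ 9 + C * h⁻¹ ^ 18 * ε⁻¹ ^ 9 := add_le_add (h2.trans hone) h1
      _ = _ := by ring
  · intro ψ hψ φ hφ
    rw [(hder ψ hψ).fderiv, (hder φ hφ).fderiv]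
    have e3 : ContinuousLinearMap.id ℝ (Fin N → ℝ) - (fderiv ℝ r ψ).smulRight u -
        (ContinuousLinearMap.id ℝ (Fin N → ℝ) - (fderiv ℝ r φ).smulRight u) =
        -((fderiv ℝ r ψ - fderiv ℝ r φ).smulRight u) := by
      ext v i
      simp [hu]
    rw [e3, norm_neg]
    refine (hsr _).trans ((hr3 ψ φ ((hK ψ).1 hψ) ((hK φ).1 hφ)).trans ?_)
    have h0 := D.hα.le
    have h1 := le_eNorm2 (ψ - φ)
    have h2 : 0 ≤ eNorm2 (ψ - φ) := Real.sqrt_nonneg _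
    calc _ ≤ C * h⁻¹ ^ 18 * ε⁻¹ ^ 9 * eNorm2 (ψ - φ) ^ D.α := by gcongr
      _ ≤ _ := by
        gcongr
        linarith
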